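/- Let f be a tempered distribution on gl₃(𝕂) satisfying: (i) for every a ∈ 𝕂ˣ (with l = diag(a,1,a) ∈ GL₃(𝕂)), every g₁, g₂ ∈ N₃, and every Schwartz function φ on gl₃(𝕂), f(x ↦ φ(l·g₁·x·g₂^τ·l⁻¹)) = χ_{N₃}(g₁)⁻¹·χ_{N₃}(g₂)⁻¹·f(φ); and (ii) for every Schwartz function φ, f(x ↦ φ(x^τ)) = −f(φ). Then f is supported in the set Z₃,₂ = {x ∈ gl₃(𝕂) : x₃₃ = 0 and x₁₃ = x₃₁}; that is, f(φ) = 0 for every smooth compactly supported function φ on gl₃(𝕂) whose support is disjoint from Z₃,₂. -/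

import Mathlib

open Matrix

attribute [local instance] Matrix.normedAddCommGroup Matrix.normedSpace

/-- The subgroup `N₃ ⊆ GL₃(𝕂)` of matrices of the form `[[1,0,d],[0,1,c],[0,0,1]]`;
its character is `χ_{N₃}(g) = ψ(d)`, read off from the `(1,3)` entry of `g`. -/
def N3 (𝕂 : Type*) [RCLike 𝕂] : Set (Matrix (Fin 3) (Fin 3) 𝕂) :=
  {g | ∃ c d : 𝕂, g = !![1, 0, d; 0, 1, c; 0, 0, 1]}

section Distributions

open SchwartzMap
open scoped ContDiff

section GaussianTools

open scoped Nat

variable {E F : Type*} [NormedAddCommGroup E] [NormedSpace ℝ E]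
  [NormedAddCommGroup F] [NormedSpace ℝ F]

theorem norm_iteratedFDeriv_cexp_le (n : ℕ) (z : ℂ) :
    ‖iteratedFDeriv ℝ n Complex.exp z‖ ≤ Real.exp z.re := by
  induction n generalizing z with
  | zero => simp [Complex.norm_exp]
  | succ n ih =>
    have h : fderiv ℝ Complex.exp = (ContinuousLinearMap.mul ℝ ℂ) ∘ Complex.exp := by
      funext z
      have h1 := (Complex.hasDerivAt_exp z).complexToReal_fderiv
      ext; simp [h1.fderiv]
    rw [← norm_iteratedFDeriv_fderiv, h]
    refine (ContinuousLinearMap.norm_iteratedFDeriv_comp_left _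
      (Complex.contDiff_exp.contDiffAt) le_rfl).trans ?_
    refine (mul_le_of_le_one_left (norm_nonneg _) ?_).trans (ih z)
    exact ContinuousLinearMap.opNorm_mul_le ℝ ℂ

theorem Function.HasTemperateGrowth.norm_iteratedFDeriv_cexp_le {Q : E → ℂ}
    (hQ : Q.HasTemperateGrowth) (n : ℕ) :
    ∃ (k : ℕ) (C : ℝ), 0 ≤ C ∧ ∀ x, ‖iteratedFDeriv ℝ n (fun x ↦ Complex.exp (Q x)) x‖ ≤
      C * (1 + ‖x‖) ^ k * Real.exp (Q x).re := by
  obtain ⟨k, C, hC, h⟩ := hQ.norm_iteratedFDeriv_le_uniform n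
  refine ⟨k * n, n ! * (1 + C) ^ n, by positivity, fun x ↦ ?_⟩
  have := norm_iteratedFDeriv_comp_le (n := n) (D := (1 + C) * (1 + ‖x‖) ^ k)
    (Complex.contDiff_exp (n := ∞) (𝕜 := ℝ)) hQ.1 (mod_cast le_top) x
    (fun i _ ↦ _root_.norm_iteratedFDeriv_cexp_le i (Q x)) (fun i hi hi' ↦ by
      calc _ ≤ C * (1 + ‖x‖) ^ k := h i hi' x
        _ ≤ (1 + C) * (1 + ‖x‖) ^ k := by gcongr; simp
        _ ≤ _ := by
          apply le_self_pow₀ (one_le_mul_of_one_le_of_one_le (by simp [hC])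
            (by simp [one_le_pow₀]))
          grind)
  refine this.trans (le_of_eq ?_)
  rw [mul_pow, pow_mul]; ring

theorem Function.HasTemperateGrowth.cexp {Q : E → ℂ} (hQ : Q.HasTemperateGrowth) {C : ℝ}
    (hC : ∀ x, (Q x).re ≤ C) : (fun x ↦ Complex.exp (Q x)).HasTemperateGrowth := by
  refine ⟨Complex.contDiff_exp.comp hQ.1, fun n ↦ ?_⟩
  obtain ⟨k, D, hD, h⟩ := hQ.norm_iteratedFDeriv_cexp_le n
  refine ⟨k, D * Real.exp C, fun x ↦ (h x).trans ?_⟩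
  have := Real.exp_le_exp.2 (hC x)
  calc D * (1 + ‖x‖) ^ k * Real.exp (Q x).re ≤ D * (1 + ‖x‖) ^ k * Real.exp C := by gcongr
    _ = _ := by ring

theorem exists_pow_mul_exp_neg_sq_le {c : ℝ} (hc : 0 < c) (n : ℕ) :
    ∃ M : ℝ, ∀ r : ℝ, 0 ≤ r → (1 + r) ^ n * Real.exp (-c * r ^ 2) ≤ M := by
  have h1 : Filter.Tendsto (fun r : ℝ ↦ (1 + r) ^ n * Real.exp (-1 * (1 + r))) Filter.atTop
      (nhds 0) := by
    have := (Real.tendsto_pow_mul_exp_neg_atTop_nhds_zero n).comp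
      (Filter.tendsto_atTop_add_const_left _ (1 : ℝ) Filter.tendsto_id)
    simpa [Function.comp_def] using this
  have h2 : Continuous (fun r : ℝ ↦ (1 + r) ^ n * Real.exp (-1 * (1 + r))) := by fun_prop
  obtain ⟨R, hR⟩ := (h1.eventually (gt_mem_nhds (zero_lt_one))).exists_forall_of_atTop
  obtain ⟨M, hM⟩ := (isCompact_Icc (a := (0 : ℝ)) (b := R)).bddAbove_image h2.continuousOn
  have h3 : ∀ r, 0 ≤ r → (1 + r) ^ n * Real.exp (-1 * (1 + r)) ≤ max M 1 := by
    intro r hr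
    rcases le_total r R with h | h
    · exact (hM ⟨r, ⟨hr, h⟩, rfl⟩).trans (le_max_left _ _)
    · exact (hR r h).le.trans (le_max_right _ _)
  refine ⟨max M 1 * Real.exp (1 + 1 / (4 * c)), fun r hr ↦ ?_⟩
  have h4 : Real.exp (-c * r ^ 2) ≤ Real.exp (-1 * (1 + r)) * Real.exp (1 + 1 / (4 * c)) := by
    rw [← Real.exp_add]
    apply Real.exp_le_exp.2
    have : 0 ≤ c * (r - 1 / (2 * c)) ^ 2 := by positivity
    have e : c * (r - 1 / (2 * c)) ^ 2 = c * r ^ 2 - r + 1 / (4 * c) := by field_simp; ring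
    linarith
  calc _ ≤ (1 + r) ^ n * (Real.exp (-1 * (1 + r)) * Real.exp (1 + 1 / (4 * c))) := by gcongr
    _ = ((1 + r) ^ n * Real.exp (-1 * (1 + r))) * Real.exp (1 + 1 / (4 * c)) := by ring
    _ ≤ _ := by gcongr; exact h3 r hr

/-- The Schwartz function `exp ∘ Q`, for `Q` of temperate growth with real part tending to `-∞`
at least quadratically. -/
noncomputable def SchwartzMap.cexp (Q : E → ℂ) (hQ : Q.HasTemperateGrowth) {C c : ℝ} (hc : 0 < c)
    (h : ∀ x, (Q x).re ≤ C - c * ‖x‖ ^ 2) : 𝓢(E, ℂ) where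
  toFun x := Complex.exp (Q x)
  smooth' := Complex.contDiff_exp.comp hQ.1
  decay' k n := by
    obtain ⟨m, D, hD, h'⟩ := hQ.norm_iteratedFDeriv_cexp_le n
    obtain ⟨M, hM⟩ := exists_pow_mul_exp_neg_sq_le hc (k + m)
    refine ⟨D * Real.exp C * M, fun x ↦ ?_⟩
    have h1 : ‖x‖ ^ k ≤ (1 + ‖x‖) ^ k := by gcongr; simp
    have h2 : Real.exp (Q x).re ≤ Real.exp C * Real.exp (-c * ‖x‖ ^ 2) := by
      rw [← Real.exp_add]; apply Real.exp_le_exp.2; linarith [h x]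
    calc _ ≤ (1 + ‖x‖) ^ k * (D * (1 + ‖x‖) ^ m * (Real.exp C * Real.exp (-c * ‖x‖ ^ 2))) := by
          gcongr; exact (h' x).trans (by gcongr)
      _ = D * Real.exp C * ((1 + ‖x‖) ^ (k + m) * Real.exp (-c * ‖x‖ ^ 2)) := by
          rw [pow_add]; ring
      _ ≤ _ := by gcongr; exact hM _ (norm_nonneg _)

@[simp]
theorem SchwartzMap.cexp_apply (Q : E → ℂ) (hQ : Q.HasTemperateGrowth) {C c : ℝ} (hc : 0 < c)
    (h : ∀ x, (Q x).re ≤ C - c * ‖x‖ ^ 2) (x : E) :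
    SchwartzMap.cexp Q hQ hc h x = Complex.exp (Q x) := rfl

end GaussianTools

section Tensor

variable {V W : Type*} [NormedAddCommGroup V] [NormedSpace ℝ V]
  [NormedAddCommGroup W] [NormedSpace ℝ W]

/-- The tensor product of two Schwartz functions. -/
noncomputable def SchwartzMap.tensor (k : 𝓢(W, ℂ)) (γ : 𝓢(V, ℂ)) : 𝓢(W × V, ℂ) where
  toFun p := k p.1 * γ p.2
  smooth' := ((k.smooth ⊤).comp contDiff_fst).mul ((γ.smooth ⊤).comp contDiff_snd)
  decay' p n := by
    have hk : ContDiff ℝ ∞ (fun x : W × V ↦ k x.1) := (k.smooth ⊤).comp contDiff_fst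
    have hγ : ContDiff ℝ ∞ (fun x : W × V ↦ γ x.2) := (γ.smooth ⊤).comp contDiff_snd
    have bk : ∀ i (x : W × V), ‖iteratedFDeriv ℝ i (fun x : W × V ↦ k x.1) x‖ ≤
        ‖iteratedFDeriv ℝ i k x.1‖ := by
      intro i x
      have := (ContinuousLinearMap.fst ℝ W V).iteratedFDeriv_comp_right (k.smooth ⊤) x
        (i := i) (mod_cast le_top)
      simp only [Function.comp_def, ContinuousLinearMap.coe_fst'] at this
      rw [this]
      refine (ContinuousMultilinearMap.norm_compContinuousLinearMap_le _ _).trans ?_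
      refine mul_le_of_le_one_right (norm_nonneg _) (Finset.prod_le_one (fun _ _ ↦ norm_nonneg _)
        fun _ _ ↦ ContinuousLinearMap.norm_fst_le ℝ W V)
    have bγ : ∀ i (x : W × V), ‖iteratedFDeriv ℝ i (fun x : W × V ↦ γ x.2) x‖ ≤
        ‖iteratedFDeriv ℝ i γ x.2‖ := by
      intro i x
      have := (ContinuousLinearMap.snd ℝ W V).iteratedFDeriv_comp_right (γ.smooth ⊤) x
        (i := i) (mod_cast le_top)
      simp only [Function.comp_def, ContinuousLinearMap.coe_snd'] at this
      rw [this]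
      refine (ContinuousMultilinearMap.norm_compContinuousLinearMap_le _ _).trans ?_
      refine mul_le_of_le_one_right (norm_nonneg _) (Finset.prod_le_one (fun _ _ ↦ norm_nonneg _)
        fun _ _ ↦ ContinuousLinearMap.norm_snd_le ℝ W V)
    refine ⟨∑ i ∈ Finset.range (n + 1), (n.choose i : ℝ) *
      (SchwartzMap.seminorm ℝ p i k * SchwartzMap.seminorm ℝ 0 (n - i) γ +
       SchwartzMap.seminorm ℝ 0 i k * SchwartzMap.seminorm ℝ p (n - i) γ), fun x ↦ ?_⟩
    have := norm_iteratedFDeriv_mul_le (𝕜 := ℝ) hk hγ x (n := n) (mod_cast le_top)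
    calc _ ≤ ‖x‖ ^ p * ∑ i ∈ Finset.range (n + 1), (n.choose i : ℝ) *
            ‖iteratedFDeriv ℝ i k x.1‖ * ‖iteratedFDeriv ℝ (n - i) γ x.2‖ := by
          gcongr
          refine this.trans (Finset.sum_le_sum fun i _ ↦ ?_)
          gcongr
          · exact bk i x
          · exact bγ _ x
      _ = ∑ i ∈ Finset.range (n + 1), (n.choose i : ℝ) *
            (‖x‖ ^ p * (‖iteratedFDeriv ℝ i k x.1‖ * ‖iteratedFDeriv ℝ (n - i) γ x.2‖)) := by
          rw [Finset.mul_sum]; exact Finset.sum_congr rfl fun i _ ↦ by ring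
      _ ≤ _ := by
          refine Finset.sum_le_sum fun i _ ↦ mul_le_mul_of_nonneg_left ?_ (by positivity)
          have a1 := SchwartzMap.le_seminorm ℝ p i k x.1
          have a2 : ‖iteratedFDeriv ℝ i k x.1‖ ≤ _ :=
            SchwartzMap.norm_iteratedFDeriv_le_seminorm ℝ k i x.1
          have a3 := SchwartzMap.le_seminorm ℝ p (n - i) γ x.2
          have a4 : ‖iteratedFDeriv ℝ (n - i) γ x.2‖ ≤ _ :=
            SchwartzMap.norm_iteratedFDeriv_le_seminorm ℝ γ (n - i) x.2
          have hx : ‖x‖ ^ p ≤ ‖x.1‖ ^ p + ‖x.2‖ ^ p := by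
            rcases le_total ‖x.1‖ ‖x.2‖ with h | h
            · rw [Prod.norm_def, max_eq_right h]; simp
            · rw [Prod.norm_def, max_eq_left h]; simp
          calc _ ≤ (‖x.1‖ ^ p + ‖x.2‖ ^ p) *
                  (‖iteratedFDeriv ℝ i k x.1‖ * ‖iteratedFDeriv ℝ (n - i) γ x.2‖) := by gcongr
            _ = (‖x.1‖ ^ p * ‖iteratedFDeriv ℝ i k x.1‖) * ‖iteratedFDeriv ℝ (n - i) γ x.2‖ +
                ‖iteratedFDeriv ℝ i k x.1‖ *
                  (‖x.2‖ ^ p * ‖iteratedFDeriv ℝ (n - i) γ x.2‖) := by ring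
            _ ≤ _ := by gcongr

@[simp]
theorem SchwartzMap.tensor_apply (k : 𝓢(W, ℂ)) (γ : 𝓢(V, ℂ)) (p : W × V) :
    k.tensor γ p = k p.1 * γ p.2 := rfl

end Tensor

section Translation

universe u v
variable {E : Type u} [NormedAddCommGroup E] [NormedSpace ℝ E]

/-- The first-order Taylor remainder of a Schwartz function under a translation. -/
noncomputable def SchwartzMap.taylorRem {F : Type*} [NormedAddCommGroup F] [NormedSpace ℝ F]
    (w : E) (Φ : 𝓢(E, F)) : 𝓢(E, F) :=
  compSubConstCLM ℝ (-w) Φ - Φ - SchwartzMap.evalCLM ℝ E F w (fderivCLM ℝ E F Φ)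

theorem SchwartzMap.taylorRem_apply {F : Type*} [NormedAddCommGroup F] [NormedSpace ℝ F]
    (w : E) (Φ : 𝓢(E, F)) (x : E) :
    taylorRem w Φ x = Φ (x + w) - Φ x - fderiv ℝ Φ x w := by
  simp [taylorRem]

theorem SchwartzMap.fderiv_taylorRem {F : Type*} [NormedAddCommGroup F] [NormedSpace ℝ F]
    (w : E) (Φ : 𝓢(E, F)) (x : E) :
    fderiv ℝ (taylorRem w Φ) x = taylorRem w (fderivCLM ℝ E F Φ) x := by
  have h : (taylorRem w Φ : E → F) = fun x ↦ Φ (x + w) - Φ x - fderiv ℝ Φ x w :=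
    funext (taylorRem_apply w Φ)
  have hd : DifferentiableAt ℝ (fderiv ℝ Φ) x := (fderivCLM ℝ E F Φ).differentiableAt
  have h1 : DifferentiableAt ℝ (fun x ↦ Φ (x + w)) x :=
    (Φ.differentiableAt).comp x (by fun_prop)
  have h2 : DifferentiableAt ℝ (fun x ↦ fderiv ℝ Φ x w) x := hd.clm_apply (by fun_prop)
  have h12 : DifferentiableAt ℝ (fun x ↦ Φ (x + w) - Φ x) x := h1.sub Φ.differentiableAt
  rw [h, taylorRem_apply, fderiv_fun_sub h12 h2,
    fderiv_fun_sub h1 Φ.differentiableAt, fderiv_comp_add_right]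
  have e : (fderivCLM ℝ E F Φ : E → E →L[ℝ] F) = fderiv ℝ Φ := rfl
  simp only [e]
  congr 1
  ext m
  rw [fderiv_clm_apply hd (by fun_prop)]
  simp
  have := (Φ.contDiffAt 2 (x := x)).isSymmSndFDerivAt (by simp)
  exact this m w

theorem SchwartzMap.exists_norm_taylorRem_le {F : Type*} [NormedAddCommGroup F] [NormedSpace ℝ F]
    (Φ : 𝓢(E, F)) (k : ℕ) :
    ∃ M, 0 ≤ M ∧ ∀ w : E, ‖w‖ ≤ 1 → ∀ x, ‖x‖ ^ k * ‖taylorRem w Φ x‖ ≤ M * ‖w‖ ^ 2 := by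
  set M := 2 ^ k * (Finset.Iic (k, 2)).sup (fun m => SchwartzMap.seminorm ℝ m.1 m.2) Φ
  have hM : ∀ y, (1 + ‖y‖) ^ k * ‖iteratedFDeriv ℝ 2 Φ y‖ ≤ M := fun y ↦
    one_add_le_sup_seminorm_apply (𝕜 := ℝ) (m := (k, 2)) le_rfl le_rfl Φ y
  refine ⟨M, by positivity, fun w hw x ↦ ?_⟩
  have hd : Differentiable ℝ (fderiv ℝ Φ) := (fderivCLM ℝ E F Φ).differentiable
  have key : ∀ y ∈ Metric.closedBall x ‖w‖, ‖x‖ ^ k * ‖fderiv ℝ (fderiv ℝ Φ) y‖ ≤ M := by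
    intro y hy
    have : ‖x‖ ≤ 1 + ‖y‖ := by
      have h1 := norm_le_norm_add_norm_sub' x y
      rw [mem_closedBall_iff_norm, norm_sub_rev] at hy
      linarith
    have e : ‖fderiv ℝ (fderiv ℝ Φ) y‖ = ‖iteratedFDeriv ℝ 2 Φ y‖ := by
      rw [← norm_iteratedFDeriv_fderiv, ← norm_iteratedFDeriv_fderiv, norm_iteratedFDeriv_zero]
    rw [e]
    exact le_trans (by gcongr) (hM y)
  rcases (norm_nonneg x).eq_or_lt' with hx | hx
  · rcases k with _ | k
    swap
    · simp [hx]; positivity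
    all_goals
    have h1 : ∀ y ∈ Metric.closedBall x ‖w‖, ‖fderiv ℝ Φ y - fderiv ℝ Φ x‖ ≤ M * ‖w‖ := by
      intro y hy
      have := (convex_closedBall x ‖w‖).norm_image_sub_le_of_norm_fderiv_le (𝕜 := ℝ)
        (f := fderiv ℝ Φ) (C := M) (fun y _ ↦ hd y) (fun y hy ↦ by simpa using key y hy)
        (Metric.mem_closedBall_self (norm_nonneg _)) hy
      refine this.trans ?_
      rw [mem_closedBall_iff_norm] at hy
      gcongr
    have h2 := (convex_closedBall x ‖w‖).norm_image_sub_le_of_norm_fderiv_le' (𝕜 := ℝ)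
      (f := Φ) (fun y _ ↦ Φ.differentiableAt) h1 (Metric.mem_closedBall_self (norm_nonneg _))
      (y := x + w) (by simp)
    rw [taylorRem_apply, pow_zero, one_mul]
    simpa [pow_two, mul_assoc] using h2
  · have hxk : 0 < ‖x‖ ^ k := by positivity
    have h1 : ∀ y ∈ Metric.closedBall x ‖w‖,
        ‖fderiv ℝ Φ y - fderiv ℝ Φ x‖ ≤ M / ‖x‖ ^ k * ‖w‖ := by
      intro y hy
      have := (convex_closedBall x ‖w‖).norm_image_sub_le_of_norm_fderiv_le (𝕜 := ℝ)
        (f := fderiv ℝ Φ) (C := M / ‖x‖ ^ k) (fun y _ ↦ hd y)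
        (fun y hy ↦ by rw [le_div_iff₀ hxk, mul_comm]; exact key y hy)
        (Metric.mem_closedBall_self (norm_nonneg _)) hy
      refine this.trans ?_
      rw [mem_closedBall_iff_norm] at hy
      gcongr
    have h2 := (convex_closedBall x ‖w‖).norm_image_sub_le_of_norm_fderiv_le' (𝕜 := ℝ)
      (f := Φ) (fun y _ ↦ Φ.differentiableAt) h1 (Metric.mem_closedBall_self (norm_nonneg _))
      (y := x + w) (by simp)
    rw [taylorRem_apply, mul_comm, ← le_div_iff₀ hxk]
    refine (le_of_eq ?_).trans (h2.trans (le_of_eq ?_))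
    · simp
    · simp; ring

theorem SchwartzMap.exists_seminorm_taylorRem_le_aux (n : ℕ) {F : Type (max u v)}
    [NormedAddCommGroup F] [NormedSpace ℝ F] (Φ : 𝓢(E, F)) (k : ℕ) :
    ∃ M, 0 ≤ M ∧ ∀ w : E, ‖w‖ ≤ 1 → ∀ x,
      ‖x‖ ^ k * ‖iteratedFDeriv ℝ n (taylorRem w Φ) x‖ ≤ M * ‖w‖ ^ 2 := by
  induction n generalizing F with
  | zero => simpa using exists_norm_taylorRem_le Φ k
  | succ n ih =>
    obtain ⟨M, hM, h⟩ := ih (fderivCLM ℝ E F Φ)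
    refine ⟨M, hM, fun w hw x ↦ ?_⟩
    rw [← norm_iteratedFDeriv_fderiv, funext (fderiv_taylorRem w Φ)]
    exact h w hw x

theorem SchwartzMap.exists_seminorm_taylorRem_le (n : ℕ) (Φ : 𝓢(E, ℂ)) (k : ℕ) :
    ∃ M, 0 ≤ M ∧ ∀ w : E, ‖w‖ ≤ 1 → SchwartzMap.seminorm ℂ k n (taylorRem w Φ) ≤ M * ‖w‖ ^ 2 := by
  let U : ℂ ≃ₗᵢ[ℝ] ULift.{u} ℂ := (LinearIsometryEquiv.ulift ℝ ℂ).symm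
  obtain ⟨M, hM, h⟩ := exists_seminorm_taylorRem_le_aux.{u, u} n
    (SchwartzMap.postcompCLM (𝕜 := ℝ) (U : ℂ →L[ℝ] ULift.{u} ℂ) Φ) k
  refine ⟨M, hM, fun w hw ↦ seminorm_le_bound _ _ _ _ (by positivity) fun x ↦ ?_⟩
  have e : ⇑(taylorRem w (SchwartzMap.postcompCLM (𝕜 := ℝ) (U : ℂ →L[ℝ] ULift.{u} ℂ) Φ)) =
      U ∘ taylorRem w Φ := by
    ext1 x
    have : (SchwartzMap.postcompCLM (𝕜 := ℝ) (U : ℂ →L[ℝ] ULift.{u} ℂ) Φ : E → ULift.{u} ℂ) =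
      fun x ↦ U (Φ x) := by ext; simp
    have h2 : fderiv ℝ (fun x ↦ U (Φ x)) x = (U : ℂ →L[ℝ] ULift.{u} ℂ) ∘L fderiv ℝ Φ x :=
      (U.toContinuousLinearEquiv.hasFDerivAt.comp x (Φ.differentiableAt (x := x)).hasFDerivAt).fderiv
    simp [taylorRem_apply, this, h2]
  have := h w hw x
  rwa [e, LinearIsometryEquiv.norm_iteratedFDeriv_comp_left] at this

theorem SchwartzMap.exists_bound (S : 𝓢(E, ℂ) →L[ℂ] ℂ) :
    ∃ (s : Finset (ℕ × ℕ)) (C : ℝ), 0 ≤ C ∧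
      ∀ φ, ‖S φ‖ ≤ C * ∑ i ∈ s, SchwartzMap.seminorm ℂ i.1 i.2 φ := by
  let q : Seminorm ℂ 𝓢(E, ℂ) := (normSeminorm ℂ ℂ).comp S.toLinearMap
  have hq : Continuous q := by
    change Continuous fun φ ↦ ‖S φ‖
    exact S.continuous.norm
  obtain ⟨s, C, -, h⟩ := Seminorm.bound_of_continuous (schwartz_withSeminorms ℂ E ℂ) q hq
  refine ⟨s, C, C.2, fun φ ↦ ?_⟩
  have h1 := h φ
  refine h1.trans ?_
  rw [_root_.smul_apply]
  refine mul_le_mul_of_nonneg_left ?_ C.2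
  have h2 := Seminorm.finset_sup_le_sum (schwartzSeminormFamily ℂ E ℂ) s φ
  refine h2.trans (le_of_eq ?_)
  have h3 : ∀ t : Finset (ℕ × ℕ), (∑ i ∈ t, schwartzSeminormFamily ℂ E ℂ i) φ =
      ∑ i ∈ t, SchwartzMap.seminorm ℂ i.1 i.2 φ := by
    intro t
    induction t using Finset.induction_on with
    | empty => simp
    | insert a t ha ih => rw [Finset.sum_insert ha, Finset.sum_insert ha, ← ih]; rfl
  exact h3 s

/-- A tempered distribution is differentiable along translations, with quadratic remainder. -/
theorem SchwartzMap.exists_norm_translate_sub_le (S : 𝓢(E, ℂ) →L[ℂ] ℂ) (Φ : 𝓢(E, ℂ)) :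
    ∃ M, 0 ≤ M ∧ ∀ w : E, ‖w‖ ≤ 1 →
      ‖S (compSubConstCLM ℂ (-w) Φ) - S Φ -
        S (SchwartzMap.evalCLM ℂ E ℂ w (fderivCLM ℂ E ℂ Φ))‖ ≤ M * ‖w‖ ^ 2 := by
  obtain ⟨s, C, hC, h⟩ := exists_bound S
  choose M hM hM' using fun i : ℕ × ℕ ↦ exists_seminorm_taylorRem_le i.2 Φ i.1
  refine ⟨C * ∑ i ∈ s, M i, mul_nonneg hC (Finset.sum_nonneg fun i _ ↦ hM i), fun w hw ↦ ?_⟩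
  have e : compSubConstCLM ℂ (-w) Φ - Φ - SchwartzMap.evalCLM ℂ E ℂ w (fderivCLM ℂ E ℂ Φ) =
      taylorRem w Φ := by ext; simp [taylorRem]
  rw [← map_sub, ← map_sub, e]
  refine (h _).trans ?_
  rw [mul_assoc, Finset.sum_mul]
  gcongr with i
  exact hM' i w hw

variable {V : Type*} [NormedAddCommGroup V] [NormedSpace ℝ V]

/-- Restriction of a Schwartz function on a product to the slice through the origin. -/
noncomputable def SchwartzMap.sliceCLM : 𝓢(E × V, ℂ) →L[ℂ] 𝓢(V, ℂ) :=
  compCLMOfAntilipschitz (K := 1) ℂ (g := ContinuousLinearMap.inr ℝ E V)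
    (ContinuousLinearMap.hasTemperateGrowth _)
    (AntilipschitzWith.of_le_mul_dist fun x y ↦ by simp [Prod.dist_eq])

@[simp]
theorem SchwartzMap.sliceCLM_apply (Φ : 𝓢(E × V, ℂ)) (x : V) : sliceCLM Φ x = Φ (0, x) := rfl

/-- Pairing a tempered distribution with a Schwartz family of test functions. -/
theorem SchwartzMap.exists_norm_slice_sub_le (S : 𝓢(V, ℂ) →L[ℂ] ℂ) (Φ : 𝓢(E × V, ℂ))
    (Ψ : E → 𝓢(V, ℂ)) (hΨ : ∀ w x, Ψ w x = Φ (w, x)) (D : E → 𝓢(V, ℂ))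
    (hD : ∀ w x, D w x = fderiv ℝ Φ (0, x) (w, 0)) :
    ∃ M, 0 ≤ M ∧ ∀ w : E, ‖w‖ ≤ 1 → ‖S (Ψ w) - S (Ψ 0) - S (D w)‖ ≤ M * ‖w‖ ^ 2 := by
  obtain ⟨M, hM, h⟩ := exists_norm_translate_sub_le (S ∘L sliceCLM) Φ
  refine ⟨M, hM, fun w hw ↦ ?_⟩
  have h1 := h (w, 0) (by simpa using hw)
  have e1 : sliceCLM (compSubConstCLM ℂ (-(w, (0 : V))) Φ) = Ψ w := by ext x; simp [hΨ]
  have e2 : sliceCLM Φ = Ψ 0 := by ext x; simp [hΨ]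
  have e3 : sliceCLM (SchwartzMap.evalCLM ℂ (E × V) ℂ (w, 0) (fderivCLM ℂ (E × V) ℂ Φ)) = D w := by
    ext x; simp [hD]
  simpa only [ContinuousLinearMap.comp_apply, e1, e2, e3, Prod.norm_mk, norm_zero,
    max_eq_left (norm_nonneg w)] using h1

end Translation

section Flows

theorem hasDerivAt_zero_of_norm_le {𝕜 G : Type*} [RCLike 𝕜] [NormedAddCommGroup G]
    [NormedSpace 𝕜 G]
    {F : 𝕜 → G} {d : G} {M r : ℝ} (hr : 0 < r)
    (h : ∀ s, ‖s‖ ≤ r → ‖F s - F 0 - s • d‖ ≤ M * ‖s‖ ^ 2) : HasDerivAt F d 0 := by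
  rw [hasDerivAt_iff_isLittleO_nhds_zero]
  have h1 : (fun s : 𝕜 ↦ F (0 + s) - F 0 - s • d) =O[nhds 0] fun s ↦ s ^ 2 := by
    refine Asymptotics.IsBigO.of_bound M ?_
    filter_upwards [Metric.closedBall_mem_nhds (0 : 𝕜) hr] with s hs
    simpa using h s (by simpa using hs)
  exact h1.trans_isLittleO (by simpa using Asymptotics.isLittleO_pow_id (𝕜 := 𝕜) one_lt_two)

variable {V : Type*} [NormedAddCommGroup V] [NormedSpace ℝ V]

theorem SchwartzMap.hasDerivAt_linear_flow (S : 𝓢(V, ℂ) →L[ℂ] ℂ) (φ : 𝓢(V, ℂ)) (B : V →L[ℝ] V)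
    (Ψ : ℝ → 𝓢(V, ℂ)) (hΨ : ∀ᶠ s in nhds 0, ∀ x, Ψ s x = φ (x + s • B x))
    (D : 𝓢(V, ℂ)) (hD : ∀ x, D x = fderiv ℝ φ x (B x)) :
    HasDerivAt (fun s ↦ S (Ψ s)) (S D) 0 := by
  set r : ℝ := 1 / (4 * (‖B‖ + 1)) with hr
  have hr0 : 0 < r := by positivity
  let χ : ContDiffBump (0 : ℝ) := ⟨r, 2 * r, hr0, by linarith⟩
  have hχ : (fun s : ℝ ↦ ((χ s : ℝ) : ℂ)).HasTemperateGrowth :=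
    (χ.hasCompactSupport.comp_left (g := ((↑) : ℝ → ℂ)) (by simp)).hasTemperateGrowth
      (Complex.ofRealCLM.contDiff.comp χ.contDiff)
  let η : 𝓢(ℝ, ℂ) := (χ.hasCompactSupport.comp_left (g := ((↑) : ℝ → ℂ)) (by simp)).toSchwartzMap
    (Complex.ofRealCLM.contDiff.comp χ.contDiff)
  have hη : ∀ s, η s = ((χ s : ℝ) : ℂ) := fun s ↦ rfl
  let β : ℝ → ℝ := fun s ↦ s * χ s
  have hβt : β.HasTemperateGrowth :=
    Function.HasTemperateGrowth.id'.mul (χ.hasCompactSupport.hasTemperateGrowth χ.contDiff)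
  have hβ : ∀ s, |β s| * ‖B‖ ≤ 1 / 2 := by
    intro s
    have h1 : |β s| ≤ 2 * r := by
      by_cases hs : |s| ≤ 2 * r
      · rw [abs_mul]
        calc _ ≤ 2 * r * 1 := by
              gcongr
              rw [abs_of_nonneg χ.nonneg]; exact χ.le_one
          _ = _ := mul_one _
      · have : χ s = 0 := χ.zero_of_le_dist (by simpa using (not_le.1 hs).le)
        simp [β, this, hr0.le]
    calc |β s| * ‖B‖ ≤ 2 * r * (‖B‖ + 1) := by gcongr; linarith
      _ = 1 / 2 := by rw [hr]; field_simp; norm_num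
  have hβ1 : ∀ s, |s| ≤ r → β s = s := by
    intro s hs
    have : χ s = 1 := χ.one_of_mem_closedBall (by simpa using hs)
    simp [β, this]
  let g : ℝ × V → ℝ × V := fun p ↦ p + ContinuousLinearMap.inr ℝ ℝ V (β p.1 • B p.2)
  have hg : g.HasTemperateGrowth := by
    refine Function.HasTemperateGrowth.id'.add
      ((ContinuousLinearMap.hasTemperateGrowth (ContinuousLinearMap.inr ℝ ℝ V)).comp ?_)
    exact (hβt.comp (ContinuousLinearMap.hasTemperateGrowth (ContinuousLinearMap.fst ℝ ℝ V))).smul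
      (ContinuousLinearMap.hasTemperateGrowth (B ∘L ContinuousLinearMap.snd ℝ ℝ V))
  have hgb : ∀ p, ‖p‖ ≤ 2 * (1 + ‖g p‖) ^ 1 := by
    intro p
    have h1 : ‖p.1‖ ≤ ‖g p‖ := by
      refine le_trans (le_of_eq ?_) (norm_fst_le _); simp [g]
    have h2 : ‖p.2 + β p.1 • B p.2‖ ≤ ‖g p‖ := by
      refine le_trans (le_of_eq ?_) (norm_snd_le _); simp [g]
    have h3 : ‖β p.1 • B p.2‖ ≤ ‖p.2‖ / 2 := by
      rw [norm_smul]
      calc _ ≤ |β p.1| * (‖B‖ * ‖p.2‖) := by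
            gcongr
            · exact le_of_eq (Real.norm_eq_abs _)
            · exact B.le_opNorm _
        _ = (|β p.1| * ‖B‖) * ‖p.2‖ := by ring
        _ ≤ 1 / 2 * ‖p.2‖ := by gcongr; exact hβ _
        _ = _ := by ring
    have h4 := norm_sub_le_norm_add p.2 (β p.1 • B p.2)
    rw [Prod.norm_def, pow_one]
    refine max_le ?_ ?_
    · linarith [norm_nonneg (g p)]
    · linarith
  let Φ : 𝓢(ℝ × V, ℂ) := compCLM ℂ hg ⟨1, 2, hgb⟩ (η.tensor φ)
  have hΦ : ∀ s x, Φ (s, x) = (χ s : ℂ) * φ (x + β s • B x) := by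
    intro s x
    simp [Φ, g, hη]
  have hΦ1 : ∀ s x, |s| ≤ r → Φ (s, x) = φ (x + s • B x) := by
    intro s x hs
    have : χ s = 1 := χ.one_of_mem_closedBall (by simpa using hs)
    rw [hΦ, hβ1 s hs, this]; simp
  obtain ⟨M, hM, h⟩ := exists_norm_slice_sub_le S Φ
    (fun s ↦ sliceCLM (compSubConstCLM ℂ (-(s, (0 : V))) Φ)) (fun w x ↦ by simp)
    (fun s ↦ (s : ℂ) • D) (fun w x ↦ by
      have h1 : HasDerivAt (fun t : ℝ ↦ Φ (t, x)) (fderiv ℝ Φ (0, x) (1, 0)) 0 := by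
        have h2 : HasDerivAt (fun t : ℝ ↦ ((t, x) : ℝ × V)) (1, 0) 0 :=
          (hasDerivAt_id _).prodMk (hasDerivAt_const _ _)
        exact (Φ.differentiableAt (x := (0, x))).hasFDerivAt.comp_hasDerivAt 0 h2
      have h2 : HasDerivAt (fun t : ℝ ↦ φ (x + t • B x)) (fderiv ℝ φ x (B x)) 0 := by
        have h3 : HasDerivAt (fun t : ℝ ↦ x + t • B x) (B x) 0 := by
          simpa using ((hasDerivAt_id (0 : ℝ)).smul_const (B x)).const_add x
        have h4 := (φ.differentiableAt (x := x + (0 : ℝ) • B x)).hasFDerivAt.comp_hasDerivAt 0 h3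
        simpa [Function.comp_def] using h4
      have h3 : (fun t : ℝ ↦ Φ (t, x)) =ᶠ[nhds 0] fun t : ℝ ↦ φ (x + t • B x) := by
        filter_upwards [Metric.closedBall_mem_nhds (0 : ℝ) hr0] with s hs
        exact hΦ1 s x (by simpa using hs)
      have h4 := (h1.congr_of_eventuallyEq h3.symm).unique h2
      have h5 : ((w, 0) : ℝ × V) = w • (1, 0) := by simp
      rw [h5, map_smul, h4, ← hD]
      simp)
  have hev : (fun s ↦ S (Ψ s)) =ᶠ[nhds 0]
      fun s ↦ S (sliceCLM (compSubConstCLM ℂ (-(s, (0 : V))) Φ)) := by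
    filter_upwards [hΨ, Metric.closedBall_mem_nhds (0 : ℝ) hr0] with s hs hs'
    congr 1
    ext x
    rw [hs x]
    simp [hΦ1 s x (by simpa using hs')]
  refine HasDerivAt.congr_of_eventuallyEq ?_ hev
  refine hasDerivAt_zero_of_norm_le one_pos (M := M) fun s hs ↦ ?_
  have h1 := h s hs
  rwa [map_smul, smul_eq_mul, ← Complex.real_smul] at h1

end Flows

section Entire

variable {V : Type*} [NormedAddCommGroup V] [NormedSpace ℝ V]

/-- A real quadratic-like weight, of temperate growth and bounded below by a multiple of the
square of the norm. -/
structure CoerciveWeight (V : Type*) [NormedAddCommGroup V] [NormedSpace ℝ V] where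
  /-- The underlying function. -/
  q : V → ℝ
  hq : q.HasTemperateGrowth
  /-- The coercivity constant. -/
  c : ℝ
  hc : 0 < c
  le : ∀ x, c * ‖x‖ ^ 2 ≤ q x

/-- The Gaussian `exp (-q + ℓ)`. -/
noncomputable def CoerciveWeight.gauss (w : CoerciveWeight V) (ℓ : V →L[ℝ] ℂ) : 𝓢(V, ℂ) :=
  SchwartzMap.cexp (fun x ↦ -(w.q x : ℂ) + ℓ x) (C := ‖ℓ‖ ^ 2 / (2 * w.c)) (c := w.c / 2)
    ((Function.HasTemperateGrowth.comp Function.Complex.hasTemperateGrowth_ofReal w.hq).neg.add ℓ.hasTemperateGrowth)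
    (half_pos w.hc) (fun x ↦ by
      have h1 := w.le x
      have hc := w.hc
      have h2 : (ℓ x).re ≤ ‖ℓ‖ * ‖x‖ := (Complex.re_le_norm _).trans (ℓ.le_opNorm x)
      have h3 : 0 ≤ (‖ℓ‖ - w.c * ‖x‖) ^ 2 / (2 * w.c) := by positivity
      have h4 : (‖ℓ‖ - w.c * ‖x‖) ^ 2 / (2 * w.c) =
        ‖ℓ‖ ^ 2 / (2 * w.c) - ‖ℓ‖ * ‖x‖ + w.c / 2 * ‖x‖ ^ 2 := by field_simp; ring
      simp only [Complex.add_re, Complex.neg_re, Complex.ofReal_re]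
      linarith)

@[simp]
theorem CoerciveWeight.gauss_apply (w : CoerciveWeight V) (ℓ : V →L[ℝ] ℂ) (x : V) :
    w.gauss ℓ x = Complex.exp (-(w.q x : ℂ) + ℓ x) := rfl

theorem CoerciveWeight.hasDerivAt_zero (w : CoerciveWeight V) (S : 𝓢(V, ℂ) →L[ℂ] ℂ)
    (ℓ₀ ℓ₁ : V →L[ℝ] ℂ) :
    HasDerivAt (fun s : ℂ ↦ S (w.gauss (ℓ₀ + s • ℓ₁))) (S (smulLeftCLM ℂ ℓ₁ (w.gauss ℓ₀))) 0 := by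
  have hc := w.hc
  set C := ‖ℓ₁‖ ^ 2 / w.c + w.c / 2
  have hC : 0 ≤ C := by positivity
  let Q : ℂ × V → ℂ := fun p ↦ -((C * ‖p.1‖ ^ 2 : ℝ) : ℂ) - (w.q p.2 : ℂ) + ℓ₀ p.2 + p.1 * ℓ₁ p.2
  have t1 := ContinuousLinearMap.hasTemperateGrowth (ContinuousLinearMap.fst ℝ ℂ V)
  have t2 := ContinuousLinearMap.hasTemperateGrowth (ContinuousLinearMap.snd ℝ ℂ V)
  have hQ : Q.HasTemperateGrowth := by
    refine ((((Function.HasTemperateGrowth.comp Function.Complex.hasTemperateGrowth_ofReal ?_).neg).sub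
      (Function.HasTemperateGrowth.comp Function.Complex.hasTemperateGrowth_ofReal (w.hq.comp t2))).add
      (ℓ₀.hasTemperateGrowth.comp t2)).add (t1.mul (ℓ₁.hasTemperateGrowth.comp t2))
    exact (Function.HasTemperateGrowth.const C).mul
      ((Function.hasTemperateGrowth_norm_sq ℂ).comp t1)
  have hQre : ∀ p, (Q p).re ≤ ‖ℓ₀‖ ^ 2 / w.c - w.c / 2 * ‖p‖ ^ 2 := by
    intro p
    have h1 := w.le p.2
    have h2 : (ℓ₀ p.2).re ≤ ‖ℓ₀‖ * ‖p.2‖ := (Complex.re_le_norm _).trans (ℓ₀.le_opNorm _)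
    have h3 : (p.1 * ℓ₁ p.2).re ≤ ‖p.1‖ * (‖ℓ₁‖ * ‖p.2‖) :=
      (Complex.re_le_norm _).trans (by rw [norm_mul]; gcongr; exact ℓ₁.le_opNorm _)
    have h4 : 0 ≤ (2 * ‖ℓ₀‖ - w.c * ‖p.2‖) ^ 2 / (4 * w.c) := by positivity
    have h4' : (2 * ‖ℓ₀‖ - w.c * ‖p.2‖) ^ 2 / (4 * w.c) =
      ‖ℓ₀‖ ^ 2 / w.c - ‖ℓ₀‖ * ‖p.2‖ + w.c / 4 * ‖p.2‖ ^ 2 := by field_simp; ring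
    have h5 : 0 ≤ (2 * ‖ℓ₁‖ * ‖p.1‖ - w.c * ‖p.2‖) ^ 2 / (4 * w.c) := by positivity
    have h5' : (2 * ‖ℓ₁‖ * ‖p.1‖ - w.c * ‖p.2‖) ^ 2 / (4 * w.c) =
      ‖ℓ₁‖ ^ 2 / w.c * ‖p.1‖ ^ 2 - ‖p.1‖ * (‖ℓ₁‖ * ‖p.2‖) + w.c / 4 * ‖p.2‖ ^ 2 := by
        field_simp; ring
    have h6 : ‖p‖ ^ 2 ≤ ‖p.1‖ ^ 2 + ‖p.2‖ ^ 2 := by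
      rw [Prod.norm_def]
      rcases le_total ‖p.1‖ ‖p.2‖ with h | h
      · rw [max_eq_right h]; linarith [sq_nonneg ‖p.1‖]
      · rw [max_eq_left h]; linarith [sq_nonneg ‖p.2‖]
    have h7 := mul_le_mul_of_nonneg_left h6 (half_pos hc).le
    have h8 : (Q p).re = -(C * ‖p.1‖ ^ 2) - w.q p.2 + (ℓ₀ p.2).re + (p.1 * ℓ₁ p.2).re := by
      simp only [Q, Complex.add_re, Complex.sub_re, Complex.neg_re, Complex.ofReal_re]
    have h9 : C * ‖p.1‖ ^ 2 = ‖ℓ₁‖ ^ 2 / w.c * ‖p.1‖ ^ 2 + w.c / 2 * ‖p.1‖ ^ 2 := by ring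
    rw [h8]
    linarith
  let Φ : 𝓢(ℂ × V, ℂ) := SchwartzMap.cexp Q hQ (half_pos hc) hQre
  obtain ⟨M, hM, h⟩ := exists_norm_slice_sub_le S Φ
    (fun s ↦ Complex.exp (-((C * ‖s‖ ^ 2 : ℝ) : ℂ)) • w.gauss (ℓ₀ + s • ℓ₁))
    (fun s x ↦ by
      simp only [Φ, Q, SchwartzMap.cexp_apply, _root_.smul_apply, CoerciveWeight.gauss_apply, smul_eq_mul,
        ← Complex.exp_add]
      congr 1
      simp only [_root_.add_apply, _root_.smul_apply, smul_eq_mul]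
      ring)
    (fun s ↦ s • smulLeftCLM ℂ ℓ₁ (w.gauss ℓ₀)) (fun s x ↦ by
      have h1 : HasDerivAt (fun t : ℝ ↦ Φ (t • s, x)) (fderiv ℝ Φ (0, x) (s, 0)) 0 := by
        have h2 : HasDerivAt (fun t : ℝ ↦ ((t • s, x) : ℂ × V)) (s, 0) 0 := by
          simpa using ((hasDerivAt_id (0 : ℝ)).smul_const s).prodMk (hasDerivAt_const _ x)
        have h3 := (Φ.differentiableAt (x := ((0 : ℝ) • s, x))).hasFDerivAt.comp_hasDerivAt 0 h2
        simpa [Function.comp_def] using h3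
      have h2 : HasDerivAt (fun t : ℝ ↦ Φ (t • s, x)) (s * (ℓ₁ x * w.gauss ℓ₀ x)) 0 := by
        have h3 : HasDerivAt (fun t : ℝ ↦ Q (t • s, x)) (s * ℓ₁ x) 0 := by
          have e : (fun t : ℝ ↦ Q (t • s, x)) = fun t : ℝ ↦
              ((-(C * ‖s‖ ^ 2) * t ^ 2 : ℝ) : ℂ) + (t : ℂ) * (s * ℓ₁ x) +
                (-(w.q x : ℂ) + ℓ₀ x) := by
            funext t
            have e1 : ‖t • s‖ ^ 2 = t ^ 2 * ‖s‖ ^ 2 := by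
              rw [norm_smul, mul_pow, Real.norm_eq_abs, sq_abs]
            simp only [Q, e1]
            simp only [Complex.real_smul]
            push_cast; ring
          rw [e]
          have a1 : HasDerivAt (fun t : ℝ ↦ -(C * ‖s‖ ^ 2) * t ^ 2) 0 0 := by
            simpa using (hasDerivAt_pow 2 (0 : ℝ)).const_mul (-(C * ‖s‖ ^ 2))
          have a2 : HasDerivAt (fun t : ℝ ↦ (t : ℂ) * (s * ℓ₁ x)) (s * ℓ₁ x) 0 := by
            simpa using (Complex.ofRealCLM.hasDerivAt (x := (0 : ℝ))).mul_const (s * ℓ₁ x)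
          simpa using (a1.ofReal_comp.add a2).add_const (-(w.q x : ℂ) + ℓ₀ x)
        have h4 := h3.cexp
        refine h4.congr_deriv ?_
        simp [Q]; ring
      rw [h1.unique h2]
      simp [smulLeftCLM_apply_apply ℓ₁.hasTemperateGrowth] )
  have hG : HasDerivAt (fun s : ℂ ↦
      S (Complex.exp (-((C * ‖s‖ ^ 2 : ℝ) : ℂ)) • w.gauss (ℓ₀ + s • ℓ₁)))
      (S (smulLeftCLM ℂ ℓ₁ (w.gauss ℓ₀))) 0 := by
    refine hasDerivAt_zero_of_norm_le one_pos (M := M) fun s hs ↦ ?_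
    have h1 := h s hs
    rwa [map_smul S s] at h1
  have hE : HasDerivAt (fun s : ℂ ↦ ((C * ‖s‖ ^ 2 : ℝ) : ℂ)) 0 0 := by
    refine hasDerivAt_zero_of_norm_le one_pos (M := C) fun s hs ↦ ?_
    simp [abs_of_nonneg hC]
  have hF := hE.cexp.mul hG
  refine (hF.congr_deriv ?_).congr_of_eventuallyEq (Filter.Eventually.of_forall fun s ↦ ?_)
  · simp
  · simp only [map_smul, Pi.mul_apply, smul_eq_mul, ← mul_assoc, ← Complex.exp_add]
    simp

theorem CoerciveWeight.hasDerivAt (w : CoerciveWeight V) (S : 𝓢(V, ℂ) →L[ℂ] ℂ)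
    (ℓ₀ ℓ₁ : V →L[ℝ] ℂ) (s : ℂ) :
    HasDerivAt (fun s : ℂ ↦ S (w.gauss (ℓ₀ + s • ℓ₁)))
      (S (smulLeftCLM ℂ ℓ₁ (w.gauss (ℓ₀ + s • ℓ₁)))) s := by
  have h := w.hasDerivAt_zero S (ℓ₀ + s • ℓ₁) ℓ₁
  have h2 := HasDerivAt.comp_sub_const s s (f := fun t ↦ S (w.gauss (ℓ₀ + s • ℓ₁ + t • ℓ₁)))
    (by simpa using h)
  refine h2.congr_of_eventuallyEq (Filter.Eventually.of_forall fun t ↦ ?_)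
  have e : ℓ₀ + t • ℓ₁ = ℓ₀ + s • ℓ₁ + (t - s) • ℓ₁ := by module
  simp only [e]

theorem CoerciveWeight.differentiable (w : CoerciveWeight V) (S : 𝓢(V, ℂ) →L[ℂ] ℂ)
    (ℓ₀ ℓ₁ : V →L[ℝ] ℂ) : Differentiable ℂ (fun s : ℂ ↦ S (w.gauss (ℓ₀ + s • ℓ₁))) :=
  fun s ↦ (w.hasDerivAt S ℓ₀ ℓ₁ s).differentiableAt

/-- If all moments vanish, the Laplace transform vanishes. -/
theorem CoerciveWeight.eq_zero_of_moments (w : CoerciveWeight V) (S : 𝓢(V, ℂ) →L[ℂ] ℂ)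
    (ℓ₀ ℓ₁ : V →L[ℝ] ℂ)
    (h : ∀ n : ℕ, S (smulLeftCLM ℂ (fun x ↦ ℓ₁ x ^ n) (w.gauss ℓ₀)) = 0) (s : ℂ) :
    S (w.gauss (ℓ₀ + s • ℓ₁)) = 0 := by
  have hℓ := ℓ₁.hasTemperateGrowth
  have hder : ∀ n : ℕ, iteratedDeriv n (fun s : ℂ ↦ S (w.gauss (ℓ₀ + s • ℓ₁))) =
      fun s : ℂ ↦ S (smulLeftCLM ℂ (fun x ↦ ℓ₁ x ^ n) (w.gauss (ℓ₀ + s • ℓ₁))) := by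
    intro n
    induction n with
    | zero => simp
    | succ n ih =>
      rw [iteratedDeriv_succ, ih]
      funext s
      have := (w.hasDerivAt (S ∘L smulLeftCLM ℂ (fun x ↦ ℓ₁ x ^ n)) ℓ₀ ℓ₁ s).deriv
      simp only [ContinuousLinearMap.comp_apply] at this
      rw [this, smulLeftCLM_smulLeftCLM_apply (g₁ := fun x ↦ ℓ₁ x ^ n) (hℓ.pow n) hℓ]
      congr 3
  have h0 : ∀ n, iteratedDeriv n (fun s : ℂ ↦ S (w.gauss (ℓ₀ + s • ℓ₁))) 0 = 0 := by
    intro n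
    have e : ℓ₀ + (0 : ℂ) • ℓ₁ = ℓ₀ := by ext; simp
    rw [hder]; simp only [e]; exact h n
  have h1 := (Complex.taylorSeries_eq_of_entire' (c := 0) (z := s) (w.differentiable S ℓ₀ ℓ₁))
  simp only [h0] at h1
  simpa using h1.symm

/-- If the Laplace transform vanishes on a real line, it vanishes on its complexification. -/
theorem CoerciveWeight.eq_zero_of_real (w : CoerciveWeight V) (S : 𝓢(V, ℂ) →L[ℂ] ℂ)
    (ℓ₀ ℓ₁ : V →L[ℝ] ℂ)
    (h : ∀ s : ℝ, S (w.gauss (ℓ₀ + (s : ℂ) • ℓ₁)) = 0) (s : ℂ) :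
    S (w.gauss (ℓ₀ + s • ℓ₁)) = 0 := by
  have han : AnalyticOnNhd ℂ (fun s : ℂ ↦ S (w.gauss (ℓ₀ + s • ℓ₁))) Set.univ :=
    (w.differentiable S ℓ₀ ℓ₁).differentiableOn.analyticOnNhd isOpen_univ
  have h2 := han.eq_of_frequently_eq (g := fun _ ↦ 0) (z₀ := 0) analyticOnNhd_const ?_
  · exact congrFun h2 s
  · have h3 : Filter.Tendsto (fun t : ℝ ↦ (t : ℂ)) (nhdsWithin 0 {0}ᶜ) (nhdsWithin 0 {0}ᶜ) := by
      refine tendsto_nhdsWithin_iff.2 ⟨?_, ?_⟩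
      · exact (Complex.continuous_ofReal.tendsto' 0 0 (by simp)).mono_left nhdsWithin_le_nhds
      · filter_upwards [self_mem_nhdsWithin] with t ht
        simpa using ht
    exact h3.frequently (Filter.Eventually.frequently (Filter.Eventually.of_forall fun t ↦ h t))

end Entire

section Interchange

universe u
variable {V : Type u} [NormedAddCommGroup V] [NormedSpace ℝ V]

open scoped BoundedContinuousFunction

theorem ContinuousMultilinearMap.norm_le_of_unit_ball {n : ℕ} (T : V [×n]→L[ℝ] ℂ) {M : ℝ}
    (hM : 0 ≤ M) (h : ∀ m : Fin n → Metric.closedBall (0 : V) 1, ‖T fun i ↦ m i‖ ≤ M) :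
    ‖T‖ ≤ M := by
  refine T.opNorm_le_bound hM fun m ↦ ?_
  have hu : ∀ i, ‖m i‖⁻¹ • m i ∈ Metric.closedBall (0 : V) 1 := fun i ↦ by
    rw [mem_closedBall_zero_iff, norm_smul, norm_inv, norm_norm]
    exact inv_mul_le_one
  have e : m = fun i ↦ ‖m i‖ • (‖m i‖⁻¹ • m i) := by
    ext1 i
    rcases eq_or_ne (m i) 0 with h0 | h0
    · simp [h0]
    · rw [smul_smul, mul_inv_cancel₀ (norm_ne_zero_iff.2 h0), one_smul]
  conv_lhs => rw [e]
  rw [T.map_smul_univ, norm_smul, norm_prod, mul_comm]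
  simp only [norm_norm]
  gcongr
  exact h fun i ↦ ⟨_, hu i⟩

theorem norm_pow_smul_iteratedFDeriv_apply_le (k n : ℕ) (φ : 𝓢(V, ℂ))
    (p : V × (Fin n → Metric.closedBall (0 : V) 1)) :
    ‖(‖p.1‖ ^ k : ℝ) • iteratedFDeriv ℝ n φ p.1 (fun i ↦ p.2 i)‖ ≤
      SchwartzMap.seminorm ℂ k n φ := by
  refine le_trans ?_ (le_seminorm ℂ k n φ p.1)
  rw [norm_smul, norm_pow, norm_norm]
  gcongr
  refine (ContinuousMultilinearMap.le_opNorm _ _).trans (mul_le_of_le_one_right (norm_nonneg _) ?_)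
  refine Finset.prod_le_one (fun _ _ ↦ norm_nonneg _) fun i _ ↦ ?_
  exact mem_closedBall_zero_iff.1 (p.2 i).2

/-- The weighted `n`-th derivative of a Schwartz function as a bounded continuous function. -/
noncomputable def SchwartzMap.weightedDeriv (k n : ℕ) :
    𝓢(V, ℂ) →L[ℂ] ((V × (Fin n → Metric.closedBall (0 : V) 1)) →ᵇ ℂ) :=
  mkCLMtoNormedSpace (𝕜 := ℂ) (𝕜' := ℂ)
    (fun φ : 𝓢(V, ℂ) ↦ BoundedContinuousFunction.ofNormedAddCommGroup
      (fun p ↦ (‖p.1‖ ^ k : ℝ) • iteratedFDeriv ℝ n φ p.1 (fun i ↦ p.2 i))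
      (by
        have h1 : Continuous (iteratedFDeriv ℝ n φ) :=
          (φ.smooth n).continuous_iteratedFDeriv le_rfl
        have h2 : Continuous fun p : V × (Fin n → Metric.closedBall (0 : V) 1) ↦
            iteratedFDeriv ℝ n φ p.1 (fun i ↦ p.2 i) :=
          (h1.comp continuous_fst).eval (by fun_prop)
        fun_prop)
      (SchwartzMap.seminorm ℂ k n φ) (norm_pow_smul_iteratedFDeriv_apply_le k n φ))
    (fun φ ψ ↦ by
      ext1 p
      have := iteratedFDeriv_add_apply (x := p.1) (φ.contDiffAt n) (ψ.contDiffAt n)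
      change (‖p.1‖ ^ k : ℝ) • iteratedFDeriv ℝ n (⇑φ + ⇑ψ) p.1 _ = _
      rw [this, _root_.add_apply, smul_add]; rfl)
    (fun a φ ↦ by
      ext1 p
      have := iteratedFDeriv_const_smul_apply (x := p.1) (a := a) (φ.contDiffAt n)
      change (‖p.1‖ ^ k : ℝ) • iteratedFDeriv ℝ n (a • ⇑φ) p.1 _ = _
      rw [this, _root_.smul_apply, smul_comm]; rfl)
    ⟨{(k, n)}, 1, zero_le_one, fun φ ↦ by
      refine (BoundedContinuousFunction.norm_ofNormedAddCommGroup_le _ (apply_nonneg _ _) _).trans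
        (le_of_eq ?_)
      simp⟩

theorem SchwartzMap.weightedDeriv_apply (k n : ℕ) (φ : 𝓢(V, ℂ))
    (p : V × (Fin n → Metric.closedBall (0 : V) 1)) :
    weightedDeriv k n φ p = (‖p.1‖ ^ k : ℝ) • iteratedFDeriv ℝ n φ p.1 (fun i ↦ p.2 i) := rfl

theorem SchwartzMap.seminorm_le_norm_weightedDeriv (k n : ℕ) (φ : 𝓢(V, ℂ)) :
    SchwartzMap.seminorm ℂ k n φ ≤ ‖weightedDeriv k n φ‖ := by
  refine seminorm_le_bound ℂ k n φ (norm_nonneg _) fun x ↦ ?_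
  have : ‖(‖x‖ ^ k : ℝ) • iteratedFDeriv ℝ n φ x‖ ≤ ‖weightedDeriv k n φ‖ :=
    ContinuousMultilinearMap.norm_le_of_unit_ball _ (norm_nonneg _) fun m ↦
      (weightedDeriv k n φ).norm_coe_le_norm (x, m)
  rwa [norm_smul, norm_pow, norm_norm] at this

theorem SchwartzMap.norm_weightedDeriv_le (k n : ℕ) (φ : 𝓢(V, ℂ)) :
    ‖weightedDeriv k n φ‖ ≤ SchwartzMap.seminorm ℂ k n φ :=
  (BoundedContinuousFunction.norm_le (apply_nonneg _ _)).2
    (norm_pow_smul_iteratedFDeriv_apply_le k n φ)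

/-- A tempered distribution factors through finitely many weighted derivatives. -/
theorem SchwartzMap.exists_factor (S : 𝓢(V, ℂ) →L[ℂ] ℂ) :
    ∃ (s : Finset (ℕ × ℕ))
      (ℓ : (∀ i : s, (V × (Fin i.1.2 → Metric.closedBall (0 : V) 1)) →ᵇ ℂ) →L[ℂ] ℂ),
      ∀ φ, S φ = ℓ (fun i ↦ weightedDeriv i.1.1 i.1.2 φ) := by
  obtain ⟨s, C, hC, h⟩ := exists_bound S
  let ι : 𝓢(V, ℂ) →ₗ[ℂ] (∀ i : s, (V × (Fin i.1.2 → Metric.closedBall (0 : V) 1)) →ᵇ ℂ) :=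
    LinearMap.pi fun i : s ↦ (weightedDeriv i.1.1 i.1.2 : 𝓢(V, ℂ) →L[ℂ] _).toLinearMap
  have hb : ∀ φ, ‖S φ‖ ≤ (C * s.card) * ‖ι φ‖ := fun φ ↦ by
    refine (h φ).trans ?_
    rw [mul_assoc]
    gcongr
    rw [← nsmul_eq_mul]
    refine Finset.sum_le_card_nsmul _ _ _ fun i hi ↦ ?_
    exact (seminorm_le_norm_weightedDeriv _ _ φ).trans (norm_le_pi_norm (ι φ) ⟨i, hi⟩)
  have hk : LinearMap.ker ι ≤ LinearMap.ker S.toLinearMap := fun φ hφ ↦ by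
    have := hb φ
    rw [LinearMap.mem_ker] at hφ
    rw [hφ, norm_zero, mul_zero, norm_le_zero_iff] at this
    exact this
  obtain ⟨g, hg⟩ : ∃ g : LinearMap.range ι →ₗ[ℂ] ℂ, ∀ φ, g ⟨ι φ, φ, rfl⟩ = S φ := by
    refine ⟨(LinearMap.ker ι).liftQ S.toLinearMap hk ∘ₗ ι.quotKerEquivRange.symm.toLinearMap,
      fun φ ↦ ?_⟩
    have e : ι.quotKerEquivRange.symm ⟨ι φ, φ, rfl⟩ = (LinearMap.ker ι).mkQ φ :=
      ι.quotKerEquivRange_symm_apply_image φ ⟨φ, rfl⟩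
    simp [e]
  let G : StrongDual ℂ (LinearMap.range ι) := g.mkContinuous (C * s.card) (by
    rintro ⟨_, φ, rfl⟩
    rw [hg]
    exact hb φ)
  obtain ⟨ℓ, hℓ, -⟩ := exists_extension_norm_eq (LinearMap.range ι) G
  refine ⟨s, ℓ, fun φ ↦ ?_⟩
  rw [← hg φ]
  exact (hℓ ⟨ι φ, φ, rfl⟩).symm

open MeasureTheory in
/-- A tempered distribution commutes with absolutely convergent integrals. -/
theorem SchwartzMap.map_eq_integral {W : Type*} [TopologicalSpace W] [SecondCountableTopology W]
    [MeasurableSpace W] [OpensMeasurableSpace W] (μ : Measure W)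
    (S : 𝓢(V, ℂ) →L[ℂ] ℂ) (Ψ : W → 𝓢(V, ℂ)) (hΨ : Continuous Ψ)
    (h_int : ∀ k n, ∃ b : W → ℝ, Integrable b μ ∧ ∀ w, SchwartzMap.seminorm ℂ k n (Ψ w) ≤ b w)
    (g : 𝓢(V, ℂ))
    (hg : ∀ n x m, iteratedFDeriv ℝ n g x m = ∫ w, iteratedFDeriv ℝ n (Ψ w) x m ∂μ) :
    S g = ∫ w, S (Ψ w) ∂μ := by
  obtain ⟨s, ℓ, hℓ⟩ := exists_factor S
  have hi : ∀ k n, Integrable (fun w ↦ weightedDeriv k n (Ψ w)) μ := fun k n ↦ by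
    obtain ⟨b, hb, hle⟩ := h_int k n
    exact hb.mono' ((weightedDeriv k n).continuous.comp hΨ).aestronglyMeasurable
      (.of_forall fun w ↦ (norm_weightedDeriv_le k n _).trans (hle w))
  have hI : Integrable (fun w ↦ fun i : s ↦ weightedDeriv i.1.1 i.1.2 (Ψ w)) μ :=
    Integrable.of_eval fun i ↦ hi _ _
  simp only [hℓ]
  rw [ℓ.integral_comp_comm hI]
  congr 1
  ext1 i
  rw [eval_integral fun i ↦ hi _ _]
  ext1 x
  have := (BoundedContinuousFunction.evalCLM ℝ x).integral_comp_comm (hi i.1.1 i.1.2)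
  simp only [BoundedContinuousFunction.evalCLM_apply] at this
  rw [← this, weightedDeriv_apply, hg]
  simp only [weightedDeriv_apply]
  rw [integral_smul]

end Interchange

section ParametricIntegral

universe u v
variable {W : Type v} {V : Type u} [NormedAddCommGroup W] [NormedSpace ℝ W]
  [NormedAddCommGroup V] [NormedSpace ℝ V]

open MeasureTheory LineDeriv

theorem SchwartzMap.exists_seminorm_slice_le (Φ : 𝓢(W × V, ℂ)) (Ψ : W → 𝓢(V, ℂ))
    (hΨ : ∀ w x, Ψ w x = Φ (w, x)) (N k n : ℕ) :
    ∃ C, ∀ w, SchwartzMap.seminorm ℂ k n (Ψ w) ≤ C * (1 + ‖w‖) ^ (-(N : ℝ)) := by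
  set C := 2 ^ (N + k) * (Finset.Iic (N + k, n)).sup
    (fun m => SchwartzMap.seminorm ℝ m.1 m.2) Φ
  have hC : ∀ y, (1 + ‖y‖) ^ (N + k) * ‖iteratedFDeriv ℝ n Φ y‖ ≤ C := fun y ↦
    one_add_le_sup_seminorm_apply (𝕜 := ℝ) (m := (N + k, n)) le_rfl le_rfl Φ y
  have hC0 : 0 ≤ C := by positivity
  refine ⟨C, fun w ↦ seminorm_le_bound _ _ _ _ (by positivity) fun x ↦ ?_⟩
  have e : (Ψ w : V → ℂ) = (fun p ↦ Φ ((w, 0) + p)) ∘ ContinuousLinearMap.inr ℝ W V := by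
    ext1 y; simp [hΨ]
  have h1 : ‖iteratedFDeriv ℝ n (Ψ w) x‖ ≤ ‖iteratedFDeriv ℝ n Φ (w, x)‖ := by
    have hs : ContDiff ℝ n (fun p ↦ Φ ((w, 0) + p)) := (Φ.smooth n).comp (by fun_prop)
    rw [e, ContinuousLinearMap.iteratedFDeriv_comp_right _ hs _ le_rfl,
      iteratedFDeriv_comp_add_left]
    refine (ContinuousMultilinearMap.norm_compContinuousLinearMap_le _ _).trans ?_
    have h3 : ((w, (0 : V)) + ContinuousLinearMap.inr ℝ W V x) = (w, x) := by simp
    rw [h3]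
    refine mul_le_of_le_one_right (norm_nonneg _) ?_
    refine Finset.prod_le_one (fun _ _ ↦ norm_nonneg _) fun i _ ↦ ?_
    exact ContinuousLinearMap.norm_inr_le_one ℝ W V
  have h2 := hC (w, x)
  rw [Real.rpow_neg (by positivity), Real.rpow_natCast, ← div_eq_mul_inv,
    le_div_iff₀ (by positivity)]
  refine le_trans ?_ h2
  rw [pow_add]
  have hw : ‖w‖ ≤ ‖(w, x)‖ := norm_fst_le (w, x)
  have hx : ‖x‖ ≤ 1 + ‖(w, x)‖ := (norm_snd_le (w, x)).trans (by simp)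
  calc ‖x‖ ^ k * ‖iteratedFDeriv ℝ n (Ψ w) x‖ * (1 + ‖w‖) ^ N
      = ((1 + ‖w‖) ^ N * ‖x‖ ^ k) * ‖iteratedFDeriv ℝ n (Ψ w) x‖ := by ring
    _ ≤ _ := by gcongr

variable [FiniteDimensional ℝ W] [MeasurableSpace W] [BorelSpace W] (μ : Measure W) [μ.IsAddHaarMeasure]

theorem SchwartzMap.exists_bound_slice (Φ : 𝓢(W × V, ℂ)) :
    ∃ b : W → ℝ, Integrable b μ ∧ ∀ w x, ‖Φ (w, x)‖ ≤ b w := by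
  let Ψ : W → 𝓢(V, ℂ) := fun w ↦ sliceCLM (compSubConstCLM ℂ (-(w, (0 : V))) Φ)
  have hΨ : ∀ w x, Ψ w x = Φ (w, x) := fun w x ↦ by simp [Ψ]
  obtain ⟨C, hC⟩ := exists_seminorm_slice_le Φ Ψ hΨ (Module.finrank ℝ W + 1) 0 0
  refine ⟨_, (integrable_one_add_norm (r := ((Module.finrank ℝ W + 1 : ℕ) : ℝ)) (by push_cast; linarith)).const_mul C, fun w x ↦ ?_⟩
  rw [← hΨ]
  exact (norm_le_seminorm ℂ _ x).trans (hC w)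

theorem SchwartzMap.hasDerivAt_integral_slice (Φ : 𝓢(W × V, ℂ)) (x v : V) :
    HasDerivAt (fun t : ℝ ↦ ∫ w, Φ (w, x + t • v) ∂μ)
      (∫ w, ∂_{((0 : W), v)} Φ (w, x) ∂μ) 0 := by
  obtain ⟨b, hb, hle⟩ := exists_bound_slice μ (∂_{((0 : W), v)} Φ)
  obtain ⟨b', hb', hle'⟩ := exists_bound_slice μ Φ
  have hm : ∀ (Θ : 𝓢(W × V, ℂ)) y, AEStronglyMeasurable (fun w ↦ Θ (w, y)) μ := fun Θ y ↦
    (Θ.continuous.comp (by fun_prop)).aestronglyMeasurable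
  have := (hasDerivAt_integral_of_dominated_loc_of_deriv_le (μ := μ) (𝕜 := ℝ)
    (F := fun t w ↦ Φ (w, x + t • v)) (F' := fun t w ↦ ∂_{((0 : W), v)} Φ (w, x + t • v))
    (x₀ := 0) (s := Set.univ) (bound := b) Filter.univ_mem (.of_forall fun t ↦ hm _ _)
    (hb'.mono' (hm _ _) (.of_forall fun w ↦ hle' w _)) (hm _ _)
    (.of_forall fun w t _ ↦ hle w _) hb (.of_forall fun w t _ ↦ ?_)).2
  · simpa using this
  · have h1 : HasFDerivAt Φ (fderiv ℝ Φ (w, x + t • v)) (w, x + t • v) :=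
      Φ.differentiableAt.hasFDerivAt
    have h2 : HasDerivAt (fun t : ℝ ↦ (w, x + t • v)) ((0 : W), v) t := by
      refine (hasDerivAt_const t w).prodMk ?_
      simpa using ((hasDerivAt_id t).smul_const v).const_add x
    rw [SchwartzMap.lineDerivOp_apply_eq_fderiv]
    exact h1.comp_hasDerivAt t h2

theorem SchwartzMap.lineDerivOp_integral_slice (Φ : 𝓢(W × V, ℂ)) (g : 𝓢(V, ℂ))
    (hg : ∀ x, g x = ∫ w, Φ (w, x) ∂μ) (x v : V) :
    ∂_{v} g x = ∫ w, ∂_{((0 : W), v)} Φ (w, x) ∂μ := by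
  have h := hasDerivAt_integral_slice μ Φ x v
  simp only [← hg] at h
  have h1 : HasFDerivAt g (fderiv ℝ g x) (x + (0 : ℝ) • v) := by
    simpa using (g.differentiableAt (x := x)).hasFDerivAt
  have h2 : HasDerivAt (fun t : ℝ ↦ x + t • v) v 0 := by
    simpa using ((hasDerivAt_id (0 : ℝ)).smul_const v).const_add x
  rw [SchwartzMap.lineDerivOp_apply_eq_fderiv]
  exact (h1.comp_hasDerivAt 0 h2).unique h

theorem SchwartzMap.iteratedFDeriv_integral_slice (n : ℕ) (Φ : 𝓢(W × V, ℂ)) (Ψ : W → 𝓢(V, ℂ))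
    (hΨ : ∀ w x, Ψ w x = Φ (w, x)) (g : 𝓢(V, ℂ)) (hg : ∀ x, g x = ∫ w, Φ (w, x) ∂μ)
    (x : V) (m : Fin n → V) :
    iteratedFDeriv ℝ n g x m = ∫ w, iteratedFDeriv ℝ n (Ψ w) x m ∂μ := by
  induction n generalizing Φ Ψ g with
  | zero => simp [hΨ, hg]
  | succ n ih =>
    have key := ih (∂_{((0 : W), m (Fin.last n))} Φ) (fun w ↦ ∂_{m (Fin.last n)} (Ψ w))
      (fun w x ↦ ?_) (∂_{m (Fin.last n)} g)
      (fun x ↦ lineDerivOp_integral_slice μ Φ g hg x _) (Fin.init m)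
    · simpa only [← SchwartzMap.iteratedLineDerivOp_eq_iteratedFDeriv,
        iteratedLineDerivOp_succ_right] using key
    · have e : (Ψ w : V → ℂ) = fun x ↦ Φ (w, x) := funext (hΨ w)
      rw [SchwartzMap.lineDerivOp_apply_eq_fderiv, SchwartzMap.lineDerivOp_apply_eq_fderiv, e]
      have h1 : HasFDerivAt Φ (fderiv ℝ Φ (w, x)) (w, x) := Φ.differentiableAt.hasFDerivAt
      have h2 := (h1.comp x (hasFDerivAt_prodMk_right w x)).fderiv
      simp only [Function.comp_def] at h2
      simp [h2]

variable [FiniteDimensional ℝ V]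

theorem SchwartzMap.continuous_translate {E : Type u} [NormedAddCommGroup E] [NormedSpace ℝ E]
    [FiniteDimensional ℝ E] (Φ : 𝓢(E, ℂ)) :
    Continuous fun w : E ↦ compSubConstCLM ℂ (-w) Φ := by
  rw [continuous_iff_continuousAt]
  intro w₀
  set Ψ := compSubConstCLM ℂ (-w₀) Φ with hΨ
  let A : E →ₗ[ℝ] 𝓢(E, ℂ) :=
    { toFun := fun h ↦ SchwartzMap.evalCLM ℝ E ℂ h (fderivCLM ℝ E ℂ Ψ)
      map_add' := fun a b ↦ by ext; simp
      map_smul' := fun a b ↦ by ext; simp }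
  have hA : Continuous A := A.continuous_of_finiteDimensional
  rw [ContinuousAt, (schwartz_withSeminorms ℂ E ℂ).tendsto_nhds]
  rintro ⟨k, n⟩ ε hε
  obtain ⟨M, hM, h⟩ := exists_seminorm_taylorRem_le n Ψ k
  have hAs : Continuous fun h ↦ SchwartzMap.seminorm ℂ k n (A h) :=
    ((schwartz_withSeminorms ℂ E ℂ).continuous_seminorm (k, n)).comp hA
  have hlim : Filter.Tendsto
      (fun w ↦ M * ‖w - w₀‖ ^ 2 + SchwartzMap.seminorm ℂ k n (A (w - w₀))) (nhds w₀) (nhds 0) := by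
    have : Continuous fun w ↦ M * ‖w - w₀‖ ^ 2 + SchwartzMap.seminorm ℂ k n (A (w - w₀)) :=
      (by fun_prop : Continuous fun w ↦ M * ‖w - w₀‖ ^ 2).add (hAs.comp (by fun_prop))
    simpa using this.tendsto w₀
  filter_upwards [hlim.eventually (gt_mem_nhds hε), Metric.closedBall_mem_nhds w₀ one_pos]
    with w hw hw1
  have e : compSubConstCLM ℂ (-w) Φ - compSubConstCLM ℂ (-w₀) Φ =
      taylorRem (w - w₀) Ψ + A (w - w₀) := by
    have : compSubConstCLM ℂ (-w) Φ = compSubConstCLM ℝ (-(w - w₀)) Ψ := by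
      ext x; simp [hΨ]; congr 1; abel
    simp [this, taylorRem, A, hΨ]
  refine lt_of_le_of_lt ?_ hw
  change SchwartzMap.seminorm ℂ k n _ ≤ _
  rw [e]
  refine (map_add_le_add _ _ _).trans ?_
  gcongr
  exact h _ (mem_closedBall_iff_norm.1 hw1)

/-- Fubini for a tempered distribution and a Schwartz family of test functions. -/
theorem SchwartzMap.map_integral_slice (S : 𝓢(V, ℂ) →L[ℂ] ℂ) (Φ : 𝓢(W × V, ℂ))
    (Ψ : W → 𝓢(V, ℂ)) (hΨ : ∀ w x, Ψ w x = Φ (w, x)) (g : 𝓢(V, ℂ))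
    (hg : ∀ x, g x = ∫ w, Φ (w, x) ∂μ) :
    S g = ∫ w, S (Ψ w) ∂μ := by
  refine map_eq_integral μ S Ψ ?_ (fun k n ↦ ?_) g
    fun n ↦ iteratedFDeriv_integral_slice μ n Φ Ψ hΨ g hg
  · have h1 : Ψ = fun w ↦ sliceCLM (compSubConstCLM ℂ (-(w, (0 : V))) Φ) := by
      ext w x; simp [hΨ]
    rw [h1]
    exact sliceCLM.continuous.comp ((continuous_translate Φ).comp (by fun_prop))
  · obtain ⟨C, hC⟩ := exists_seminorm_slice_le Φ Ψ hΨ (Module.finrank ℝ W + 1) k n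
    exact ⟨_, (integrable_one_add_norm (r := ((Module.finrank ℝ W + 1 : ℕ) : ℝ)) (by push_cast; linarith)).const_mul C, hC⟩

end ParametricIntegral

section Density

variable {V : Type*} [NormedAddCommGroup V] [NormedSpace ℝ V]

theorem Function.HasTemperateGrowth.cexp_mul_I {E : Type*} [NormedAddCommGroup E] [NormedSpace ℝ E]
    {Q : E → ℝ} (hQ : Q.HasTemperateGrowth) :
    (fun x ↦ Complex.exp ((Q x : ℂ) * Complex.I)).HasTemperateGrowth :=
  Function.HasTemperateGrowth.cexp (C := 0)
    ((Function.HasTemperateGrowth.comp Function.Complex.hasTemperateGrowth_ofReal hQ).mul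
      (Function.HasTemperateGrowth.const Complex.I))
    (fun x ↦ by simp)

variable [FiniteDimensional ℝ V]

open MeasureTheory FourierTransform in
/-- A tempered distribution that kills all modulations of `γ` kills all multiples of `γ`. -/
theorem SchwartzMap.map_mul_eq_zero_of_modulation (S : 𝓢(V, ℂ) →L[ℂ] ℂ) (γ : 𝓢(V, ℂ))
    (hS : ∀ (L : V →L[ℝ] ℝ) (θ : 𝓢(V, ℂ)),
      (∀ x, θ x = Complex.exp ((L x : ℂ) * Complex.I) * γ x) → S θ = 0)
    (η g : 𝓢(V, ℂ)) (hg : ∀ x, g x = η x * γ x) : S g = 0 := by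
  let W := EuclideanSpace ℝ (Fin (Module.finrank ℝ V))
  let e : V ≃L[ℝ] W := toEuclidean
  let η' : 𝓢(W, ℂ) := compCLMOfContinuousLinearEquiv ℂ e.symm η
  let k : 𝓢(W, ℂ) := 𝓕 η'
  let Q : W × V → ℝ := fun p ↦ 2 * Real.pi * inner ℝ p.1 (e p.2)
  have hQ : Q.HasTemperateGrowth :=
    (Function.HasTemperateGrowth.const _).mul
      ((innerSL ℝ (E := W)).bilinear_hasTemperateGrowth
        (ContinuousLinearMap.fst ℝ W V).hasTemperateGrowth
        ((e : V →L[ℝ] W) ∘L ContinuousLinearMap.snd ℝ W V).hasTemperateGrowth)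
  let Φ : 𝓢(W × V, ℂ) := smulLeftCLM ℂ (fun p ↦ Complex.exp ((Q p : ℂ) * Complex.I)) (tensor k γ)
  have hΦ : ∀ w x, Φ (w, x) = Complex.exp ((Q (w, x) : ℂ) * Complex.I) * (k w * γ x) := fun w x ↦ by
    simp [Φ, smulLeftCLM_apply_apply hQ.cexp_mul_I]
  let L : W → (V →L[ℝ] ℝ) := fun w ↦ (2 * Real.pi) • ((innerSL ℝ w) ∘L (e : V →L[ℝ] W))
  have hL : ∀ w x, L w x = Q (w, x) := fun w x ↦ by simp [L, Q]
  have hL' : ∀ w, (L w : V → ℝ).HasTemperateGrowth := fun w ↦ (L w).hasTemperateGrowth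
  let θ : W → 𝓢(V, ℂ) := fun w ↦ smulLeftCLM ℂ (fun x ↦ Complex.exp ((L w x : ℂ) * Complex.I)) γ
  have hθ : ∀ w x, θ w x = Complex.exp ((L w x : ℂ) * Complex.I) * γ x := fun w x ↦ by
    simp [θ, smulLeftCLM_apply_apply (hL' w).cexp_mul_I]
  have key := map_integral_slice (volume : Measure W) S Φ (fun w ↦ k w • θ w)
    (fun w x ↦ by simp [hθ, hΦ, hL]; ring) g (fun x ↦ ?_)
  · rw [key]
    simp [hS _ _ (hθ _)]
  · rw [hg]
    have h1 : η x = η' (e x) := by simp [η']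
    have h2 : η' = 𝓕⁻ k := by simp [k]
    rw [h1, h2, fourierInv_coe, Real.fourierInv_eq', ← integral_mul_const]
    congr 1
    ext w
    rw [hΦ, smul_eq_mul, mul_assoc]

/-- A tempered distribution whose Laplace transform with a Gaussian factor vanishes kills all
compactly supported test functions. -/
theorem CoerciveWeight.map_eq_zero_of_hasCompactSupport (w : CoerciveWeight V)
    (S : 𝓢(V, ℂ) →L[ℂ] ℂ)
    (h : ∀ L : V →L[ℝ] ℝ, S (w.gauss (Complex.ofRealCLM ∘L L)) = 0)
    (φ : 𝓢(V, ℂ)) (hφ : HasCompactSupport φ) : S φ = 0 := by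
  have hc : HasCompactSupport fun x ↦ φ x * Complex.exp (w.q x : ℂ) := hφ.mul_right
  have hs : ContDiff ℝ ∞ fun x ↦ φ x * Complex.exp (w.q x : ℂ) :=
    (φ.smooth ⊤).mul (Complex.ofRealCLM.contDiff.comp w.hq.1).cexp
  refine map_mul_eq_zero_of_modulation S (w.gauss 0) (fun L θ hθ ↦ ?_) (hc.toSchwartzMap hs) φ
    fun x ↦ ?_
  · have h1 := w.eq_zero_of_real S 0 (Complex.ofRealCLM ∘L L) (fun s ↦ ?_) Complex.I
    · convert h1 using 2
      ext x
      rw [hθ]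
      simp [← Complex.exp_add]
      ring_nf
    · convert h (s • L) using 3
      ext x
      simp
  · simp [mul_assoc, ← Complex.exp_add]

end Density

section Character

variable {𝕂 : Type*} [RCLike 𝕂]

theorem exists_continuousLinearMap_of_character (ψ : 𝕂 → ℂ) (hadd : ∀ s t, ψ (s + t) = ψ s * ψ t)
    (hunit : ∀ t, ‖ψ t‖ = 1) (hcont : Continuous ψ) :
    ∃ ℓ : 𝕂 →L[ℝ] ℝ, ∀ t, ψ t = Complex.exp ((ℓ t : ℂ) * Complex.I) := by
  have hmem : ∀ t, ψ t ∈ Submonoid.unitSphere ℂ := fun t ↦ by simp [Submonoid.unitSphere, hunit]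
  let g : C(𝕂, Circle) := ⟨fun t ↦ ⟨ψ t, hmem t⟩, Continuous.subtype_mk hcont hmem⟩
  have h0 : ψ 0 = 1 := by
    have h1 := hadd 0 0
    have h2 : ψ 0 ≠ 0 := fun h ↦ by simpa [h] using hunit 0
    rw [add_zero] at h1
    exact (mul_eq_left₀ h2).1 h1.symm
  have hg : ∀ s t, g (s + t) = g s * g t := fun s t ↦ Circle.ext (hadd s t)
  obtain ⟨F, ⟨hF0, hF⟩, -⟩ := Circle.isCoveringMap_exp.existsUnique_continuousMap_lifts g 0 0
    (Circle.ext ((by simp : ((Circle.exp 0 : Circle) : ℂ) = 1).trans h0.symm))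
  have hF' : ∀ t, Circle.exp (F t) = g t := fun t ↦ congrFun hF t
  have hFadd : ∀ s t, F (s + t) = F s + F t := by
    intro s t
    obtain ⟨G, -, hG⟩ := Circle.isCoveringMap_exp.existsUnique_continuousMap_lifts
      (g.comp ⟨fun t ↦ s + t, by fun_prop⟩) 0 (F s) (by simp [hF'])
    have h1 := hG (F.comp ⟨fun t ↦ s + t, by fun_prop⟩) ⟨by simp, by ext; simp [hF']⟩
    have h2 := hG ⟨fun t ↦ F s + F t, by fun_prop⟩ ⟨by simp [hF0], by
      ext; simp [hF', hg, Circle.exp_add]⟩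
    exact DFunLike.congr_fun (h1.trans h2.symm) t
  let ℓ : 𝕂 →L[ℝ] ℝ := (AddMonoidHom.mk' F hFadd).toRealLinearMap F.continuous
  refine ⟨ℓ, fun t ↦ ?_⟩
  have := congrArg ((↑) : Circle → ℂ) (hF' t)
  exact this.symm.trans (Circle.coe_exp _)

end Character

section Recursion

/-- The only skew solution of the contiguity relation is zero. -/
theorem eq_zero_of_skew_recursion (T : ℕ → ℕ → ℂ)
    (h : ∀ i j : ℕ, ((i : ℂ) - j) * T i j = T (i + 1) j - T i (j + 1))
    (hskew : ∀ i j, T i j = -T j i) (i j : ℕ) : T i j = 0 := by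
  suffices H : ∀ N i j, i + j = N → T i j = 0 from H _ i j rfl
  intro N
  induction N with
  | zero =>
    intro i j hij
    obtain ⟨rfl, rfl⟩ : i = 0 ∧ j = 0 := by omega
    exact self_eq_neg.1 (hskew 0 0)
  | succ N ih =>
    have hstep : ∀ i j, i + j = N → T (i + 1) j = T i (j + 1) := fun i j hij ↦ by
      have := h i j
      rw [ih i j hij, mul_zero] at this
      exact (sub_eq_zero.1 this.symm)
    have hall : ∀ i j, i + j = N + 1 → T i j = T 0 (N + 1) := by
      intro i
      induction i with
      | zero => intro j hj; rw [show j = N + 1 by omega]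
      | succ i ihi => intro j hj; rw [hstep i j (by omega), ihi (j + 1) (by omega)]
    intro i j hij
    rw [hall i j hij]
    have h1 := hskew 0 (N + 1)
    rw [hall (N + 1) 0 (by omega)] at h1
    exact self_eq_neg.1 h1

theorem eq_zero_of_moment_recursion (T : ℕ → ℕ → ℕ → ℕ → ℂ)
    (h : ∀ a b c e : ℕ, ((a : ℂ) + b - c - e) * T a b c e
      = 2 * (T (a + 1) (b + 1) c e - T a b (c + 1) (e + 1)))
    (hskew : ∀ a b c e, T a b c e = -T c e a b)
    (hrot : (∀ a b c e, a + e ≠ b + c → T a b c e = 0) ∨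
      ((∀ a b c e, T a b c e = T (a + b) 0 (c + e) 0) ∧
        ∀ a c, Odd (a + c) → T a 0 c 0 = 0)) (a b c e : ℕ) : T a b c e = 0 := by
  have H : ∀ k l i j, T (k + i) (l + i) (k + j) (l + j) = 0 := fun k l ↦
    eq_zero_of_skew_recursion (fun i j ↦ T (k + i) (l + i) (k + j) (l + j)) (fun i j ↦ by
      have := h (k + i) (l + i) (k + j) (l + j)
      push_cast at this
      simp only [← add_assoc]
      linear_combination this / 2) (fun i j ↦ hskew _ _ _ _)
  rcases hrot with hrot | ⟨hr, ho⟩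
  · by_cases hw : a + e = b + c
    · rcases le_total c a with hc | hc
      · have := H c e (a - c) 0
        rwa [show c + (a - c) = a by omega, show e + (a - c) = b by omega] at this
      · have := H a b 0 (c - a)
        rwa [show a + (c - a) = c by omega, show b + (c - a) = e by omega] at this
    · exact hrot a b c e hw
  · rw [hr]
    generalize a + b = n
    generalize c + e = m
    rcases Nat.even_or_odd (n + m) with hp | hp
    · obtain ⟨d, hd⟩ := hp
      rcases le_total m n with hc | hc
      · have := H m 0 (d - m) 0
        rw [hr] at this
        rwa [show m + (d - m) + (0 + (d - m)) = n by omega] at this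
      · have := H n 0 0 (d - n)
        rw [hr] at this
        rwa [show n + (d - n) + (0 + (d - n)) = m by omega] at this
    · exact ho n m hp

end Recursion

theorem SchwartzMap.map_derivAlong {V : Type*} [NormedAddCommGroup V] [NormedSpace ℝ V]
    (S : 𝓢(V, ℂ) →L[ℂ] ℂ) (φ : 𝓢(V, ℂ)) (B : V →L[ℝ] V)
    (Ψ : ℝ → 𝓢(V, ℂ)) (hΨ : ∀ᶠ s in nhds 0, ∀ x, Ψ s x = φ (x + s • B x))
    (D : 𝓢(V, ℂ)) (hD : ∀ x, HasDerivAt (fun s : ℝ ↦ φ (x + s • B x)) (D x) 0) :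
    HasDerivAt (fun s ↦ S (Ψ s)) (S D) 0 := by
  refine hasDerivAt_linear_flow S φ B Ψ hΨ D fun x ↦ ?_
  have h3 : HasDerivAt (fun t : ℝ ↦ x + t • B x) (B x) 0 := by
    simpa using ((hasDerivAt_id (0 : ℝ)).smul_const (B x)).const_add x
  have h4 := (φ.differentiableAt (x := x + (0 : ℝ) • B x)).hasFDerivAt.comp_hasDerivAt 0 h3
  exact (hD x).unique (by simpa [Function.comp_def] using h4)

section MatrixGaussian

variable {𝕂 : Type*} [RCLike 𝕂]

/-- A matrix entry, as a continuous real-linear map. -/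
noncomputable def entryCLM (i j : Fin 3) : (Fin 3 → Fin 3 → 𝕂) →L[ℝ] 𝕂 :=
  ContinuousLinearMap.proj j ∘L ContinuousLinearMap.proj (φ := fun _ : Fin 3 ↦ Fin 3 → 𝕂) i

@[simp]
theorem entryCLM_apply (i j : Fin 3) (x : (Fin 3 → Fin 3 → 𝕂)) : entryCLM i j x = x i j := rfl

theorem hasTemperateGrowth_re_entry (i j : Fin 3) :
    (fun x : (Fin 3 → Fin 3 → 𝕂) ↦ RCLike.re (x i j)).HasTemperateGrowth :=
  ((RCLike.reCLM : 𝕂 →L[ℝ] ℝ) ∘L entryCLM i j).hasTemperateGrowth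

theorem hasTemperateGrowth_im_entry (i j : Fin 3) :
    (fun x : (Fin 3 → Fin 3 → 𝕂) ↦ RCLike.im (x i j)).HasTemperateGrowth :=
  ((RCLike.imCLM : 𝕂 →L[ℝ] ℝ) ∘L entryCLM i j).hasTemperateGrowth

/-- The sum of the squares of the absolute values of the entries. -/
noncomputable def matWeight (𝕂 : Type*) [RCLike 𝕂] :
    CoerciveWeight (Fin 3 → Fin 3 → 𝕂) where
  q x := ∑ i, ∑ j, (RCLike.re (x i j) ^ 2 + RCLike.im (x i j) ^ 2)
  hq := Function.HasTemperateGrowth.sum fun i _ ↦ Function.HasTemperateGrowth.sum fun j _ ↦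
    ((hasTemperateGrowth_re_entry i j).pow 2).add ((hasTemperateGrowth_im_entry i j).pow 2)
  c := 1
  hc := one_pos
  le x := by
    rw [one_mul]
    have h : ∀ i j, 0 ≤ RCLike.re (x i j) ^ 2 + RCLike.im (x i j) ^ 2 := fun i j ↦ by positivity
    refine (Real.le_sqrt (norm_nonneg _) (Finset.sum_nonneg fun i _ ↦ Finset.sum_nonneg fun j _ ↦ h i j)).1 ?_
    refine (pi_norm_le_iff_of_nonneg (Real.sqrt_nonneg _)).2 fun i ↦
      (pi_norm_le_iff_of_nonneg (Real.sqrt_nonneg _)).2 fun j ↦ Real.le_sqrt_of_sq_le ?_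
    rw [RCLike.norm_sq_eq_def, ← sq, ← sq]
    refine le_trans ?_ (Finset.single_le_sum (f := fun i ↦ ∑ j, (RCLike.re (x i j) ^ 2 + RCLike.im (x i j) ^ 2)) (fun i _ ↦ Finset.sum_nonneg fun j _ ↦ h i j) (Finset.mem_univ i))
    exact Finset.single_le_sum (f := fun j ↦ (RCLike.re (x i j) ^ 2 + RCLike.im (x i j) ^ 2)) (fun j _ ↦ h i j) (Finset.mem_univ j)

/-- The real inner product of matrices. -/
noncomputable def matInner (x v : (Fin 3 → Fin 3 → 𝕂)) : ℝ :=
  ∑ i, ∑ j, (RCLike.re (x i j) * RCLike.re (v i j) + RCLike.im (x i j) * RCLike.im (v i j))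

theorem hasDerivAt_entry (i j : Fin 3) (x v : (Fin 3 → Fin 3 → 𝕂)) :
    HasDerivAt (fun s : ℝ ↦ (x + s • v) i j) (v i j) 0 := by
  simpa using ((hasDerivAt_id (0 : ℝ)).smul_const (v i j)).const_add (x i j)

theorem hasDerivAt_clm_comp {F : Type*} [NormedAddCommGroup F] [NormedSpace ℝ F] (L : 𝕂 →L[ℝ] F)
    (i j : Fin 3) (x v : (Fin 3 → Fin 3 → 𝕂)) :
    HasDerivAt (fun s : ℝ ↦ L ((x + s • v) i j)) (L (v i j)) 0 :=
  L.hasFDerivAt.comp_hasDerivAt 0 (hasDerivAt_entry i j x v)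

theorem hasDerivAt_matGauss (ℓ : (Fin 3 → Fin 3 → 𝕂) →L[ℝ] ℂ)
    (x v : (Fin 3 → Fin 3 → 𝕂)) :
    HasDerivAt (fun s : ℝ ↦ (matWeight 𝕂).gauss ℓ (x + s • v))
      ((-(2 * matInner x v : ℝ) + ℓ v) * (matWeight 𝕂).gauss ℓ x) 0 := by
  have h1 : HasDerivAt (fun s : ℝ ↦ (matWeight 𝕂).q (x + s • v)) (2 * matInner x v) 0 := by
    have : HasDerivAt (fun s : ℝ ↦ ∑ i, ∑ j, (RCLike.reCLM ((x + s • v) i j) ^ 2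
        + RCLike.imCLM ((x + s • v) i j) ^ 2))
        (∑ i, ∑ j, (2 * RCLike.re (x i j) * RCLike.re (v i j)
          + 2 * RCLike.im (x i j) * RCLike.im (v i j))) 0 := by
      refine HasDerivAt.fun_sum fun i _ ↦ HasDerivAt.fun_sum fun j _ ↦ ?_
      convert! ((hasDerivAt_clm_comp RCLike.reCLM i j x v).pow 2).add
        ((hasDerivAt_clm_comp RCLike.imCLM i j x v).pow 2) using 1
      simp
    convert! this using 1
    simp only [matInner, Finset.mul_sum]
    congr! 2
    ring
  have h2 : HasDerivAt (fun s : ℝ ↦ ℓ (x + s • v)) (ℓ v) 0 := by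
    have h3 : HasDerivAt (fun t : ℝ ↦ x + t • v) v 0 := by
      simpa using ((hasDerivAt_id (0 : ℝ)).smul_const v).const_add x
    exact ℓ.hasFDerivAt.comp_hasDerivAt 0 h3
  have h3 := (h1.ofReal_comp.neg.add h2).cexp
  convert! h3 using 1
  simp
  ring

theorem map_mul_complex (a b : 𝕂) : RCLike.map 𝕂 ℂ (a * b) = RCLike.map 𝕂 ℂ a * RCLike.map 𝕂 ℂ b := by
  rcases RCLike.I_mul_I_ax (K := 𝕂) with h | h
  · have h1 : ∀ z : 𝕂, RCLike.im z = 0 := fun z ↦ by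
      have := RCLike.mul_im_I_ax z
      rw [h] at this
      simpa using this.symm
    simp [h1]
  · apply Complex.ext <;> simp

/-- The monomial `q^a q̄^b r^c r̄^e` in the entries `q = x₁₂` and `r = x₂₁`. -/
noncomputable def mono (a b c e : ℕ) (x : (Fin 3 → Fin 3 → 𝕂)) : ℂ :=
  RCLike.map 𝕂 ℂ (x 0 1) ^ a * (starRingEnd ℂ) (RCLike.map 𝕂 ℂ (x 0 1)) ^ b * RCLike.map 𝕂 ℂ (x 1 0) ^ c *
    (starRingEnd ℂ) (RCLike.map 𝕂 ℂ (x 1 0)) ^ e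

theorem hasTemperateGrowth_cx_entry (i j : Fin 3) :
    (fun x : (Fin 3 → Fin 3 → 𝕂) ↦ RCLike.map 𝕂 ℂ (x i j)).HasTemperateGrowth :=
  (RCLike.map 𝕂 ℂ ∘L entryCLM i j).hasTemperateGrowth

theorem hasTemperateGrowth_conj_cx_entry (i j : Fin 3) :
    (fun x : (Fin 3 → Fin 3 → 𝕂) ↦ (starRingEnd ℂ) (RCLike.map 𝕂 ℂ (x i j))).HasTemperateGrowth :=
  ((Complex.conjCLE : ℂ →L[ℝ] ℂ) ∘L RCLike.map 𝕂 ℂ ∘L entryCLM i j).hasTemperateGrowth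

theorem hasTemperateGrowth_mono (a b c e : ℕ) :
    (mono a b c e : (Fin 3 → Fin 3 → 𝕂) → ℂ).HasTemperateGrowth :=
  ((((hasTemperateGrowth_cx_entry 0 1).pow a).mul ((hasTemperateGrowth_conj_cx_entry 0 1).pow b)).mul
    ((hasTemperateGrowth_cx_entry 1 0).pow c)).mul ((hasTemperateGrowth_conj_cx_entry 1 0).pow e)

end MatrixGaussian

section Core

variable {𝕂 : Type*} [RCLike 𝕂]

/-- Conjugation by `diag (a, 1, a)`. -/
def torusConj (a : 𝕂) (x : Fin 3 → Fin 3 → 𝕂) : Fin 3 → Fin 3 → 𝕂 :=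
  fun i j ↦ (![a, 1, a] : Fin 3 → 𝕂) i * x i j * (![a⁻¹, 1, a⁻¹] : Fin 3 → 𝕂) j

/-- A distribution that is invariant under translations in the entries `(1,3), (2,3), (3,1), (3,2)`
and under a torus, and skew under transposition. -/
structure IsSkewInvariant (S : 𝓢((Fin 3 → Fin 3 → 𝕂), ℂ) →L[ℂ] ℂ) : Prop where
  trans : ∀ u : Fin 3 → Fin 3 → 𝕂, u 0 0 = 0 → u 0 1 = 0 → u 1 0 = 0 → u 1 1 = 0 → u 2 2 = 0 →
    ∀ φ D : 𝓢((Fin 3 → Fin 3 → 𝕂), ℂ),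
      (∀ x, HasDerivAt (fun s : ℝ ↦ φ (x + s • u)) (D x) 0) → S D = 0
  torus : ∀ a : 𝕂, a ≠ 0 → ∀ φ φ' : 𝓢((Fin 3 → Fin 3 → 𝕂), ℂ),
    (∀ x, φ' x = φ (torusConj a x)) → S φ' = S φ
  skew : ∀ φ φ' : 𝓢((Fin 3 → Fin 3 → 𝕂), ℂ), (∀ x, φ' x = φ (fun i j ↦ x j i)) → S φ' = -S φ

theorem exists_comp_mul (m : Fin 3 → Fin 3 → 𝕂) (hm : ∀ i j, m i j ≠ 0)
    (φ : 𝓢((Fin 3 → Fin 3 → 𝕂), ℂ)) :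
    ∃ φ' : 𝓢((Fin 3 → Fin 3 → 𝕂), ℂ), ∀ x, φ' x = φ (m * x) := by
  refine ⟨compCLM ℂ (g := fun x ↦ m * x) (ContinuousLinearMap.mul ℝ _ m).hasTemperateGrowth
    ⟨1, ‖m⁻¹‖, fun x ↦ ?_⟩ φ, fun x ↦ rfl⟩
  have : x = m⁻¹ * (m * x) := by
    ext i j
    simp [hm i j]
  calc ‖x‖ = ‖m⁻¹ * (m * x)‖ := by rw [← this]
    _ ≤ ‖m⁻¹‖ * ‖m * x‖ := norm_mul_le _ _
    _ ≤ _ := by rw [pow_one]; gcongr; linarith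

theorem IsSkewInvariant.torus_deriv {S : 𝓢((Fin 3 → Fin 3 → 𝕂), ℂ) →L[ℂ] ℂ}
    (hS : IsSkewInvariant S) (t : 𝕂) (φ D₁ D₂ : 𝓢((Fin 3 → Fin 3 → 𝕂), ℂ))
    (h₁ : ∀ x, HasDerivAt (fun s : ℝ ↦ φ (x + s • (![![0, t, 0], ![0, 0, 0], ![0, t, 0]] * x)))
      (D₁ x) 0)
    (h₂ : ∀ x, HasDerivAt (fun s : ℝ ↦ φ (x + s • (![![0, 0, 0], ![t, 0, t], ![0, 0, 0]] * x)))
      (D₂ x) 0) : S D₁ = S D₂ := by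
  have hex : ∀ m : Fin 3 → Fin 3 → 𝕂, (∀ i j, m i j = 0 ∨ m i j = t) →
      ∀ s : ℝ, ∃ Ψ : 𝓢((Fin 3 → Fin 3 → 𝕂), ℂ), 1 + s • t ≠ 0 → ∀ x, Ψ x = φ (x + s • (m * x)) := by
    intro m hm s
    by_cases hs : 1 + s • t = 0
    · exact ⟨0, fun h ↦ absurd hs h⟩
    · obtain ⟨Ψ, hΨ⟩ := exists_comp_mul (1 + s • m) (fun i j ↦ by
        rcases hm i j with h | h <;> simp [h, hs]) φ
      refine ⟨Ψ, fun _ x ↦ ?_⟩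
      rw [hΨ, add_mul, one_mul, smul_mul_assoc]
  choose Ψ₁ hΨ₁ using hex ![![0, t, 0], ![0, 0, 0], ![0, t, 0]]
    (fun i j ↦ by fin_cases i <;> fin_cases j <;> simp)
  choose Ψ₂ hΨ₂ using hex ![![0, 0, 0], ![t, 0, t], ![0, 0, 0]]
    (fun i j ↦ by fin_cases i <;> fin_cases j <;> simp)
  have hev : ∀ᶠ s : ℝ in nhds 0, 1 + s • t ≠ 0 := by
    have : Continuous fun s : ℝ ↦ 1 + s • t := by fun_prop
    exact this.continuousAt.eventually_ne (by simp)
  have e₁ := map_derivAlong S φ (ContinuousLinearMap.mul ℝ _ _) Ψ₁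
    (hev.mono fun s hs x ↦ hΨ₁ s hs x) D₁ h₁
  have e₂ := map_derivAlong S φ (ContinuousLinearMap.mul ℝ _ _) Ψ₂
    (hev.mono fun s hs x ↦ hΨ₂ s hs x) D₂ h₂
  refine e₁.unique (e₂.congr_of_eventuallyEq (hev.mono fun s hs ↦ ?_))
  refine hS.torus (1 + s • t) hs _ _ fun x ↦ ?_
  rw [hΨ₁ s hs, hΨ₂ s hs]
  congr 1
  ext i j
  rw [RCLike.real_smul_eq_coe_mul] at hs
  simp only [Pi.add_apply, Pi.smul_apply, Pi.mul_apply, RCLike.real_smul_eq_coe_mul]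
  fin_cases i <;> fin_cases j <;> simp [torusConj] <;> field_simp

theorem hasDerivAt_pow_of_eigen {g : ℝ → ℂ} {κ : ℂ} (h : HasDerivAt g (κ * g 0) 0) (n : ℕ) :
    HasDerivAt (fun s ↦ g s ^ n) (n * κ * g 0 ^ n) 0 := by
  convert! h.pow n using 1
  cases n with
  | zero => simp
  | succ n => simp; ring

theorem hasDerivAt_mono (a b c e : ℕ) (x v : Fin 3 → Fin 3 → 𝕂) (μ ν : 𝕂)
    (hμ : v 0 1 = μ * x 0 1) (hν : v 1 0 = ν * x 1 0) :
    HasDerivAt (fun s : ℝ ↦ mono a b c e (x + s • v))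
      ((a * RCLike.map 𝕂 ℂ μ + b * (starRingEnd ℂ) (RCLike.map 𝕂 ℂ μ) + c * RCLike.map 𝕂 ℂ ν + e * (starRingEnd ℂ) (RCLike.map 𝕂 ℂ ν)) *
        mono a b c e x) 0 := by
  have h1 : HasDerivAt (fun s : ℝ ↦ RCLike.map 𝕂 ℂ ((x + s • v) 0 1)) (RCLike.map 𝕂 ℂ μ * RCLike.map 𝕂 ℂ ((x + (0 : ℝ) • v) 0 1)) 0 := by
    have := hasDerivAt_clm_comp (RCLike.map 𝕂 ℂ) 0 1 x v
    rw [hμ, map_mul_complex] at this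
    simpa using this
  have h2 : HasDerivAt (fun s : ℝ ↦ RCLike.map 𝕂 ℂ ((x + s • v) 1 0)) (RCLike.map 𝕂 ℂ ν * RCLike.map 𝕂 ℂ ((x + (0 : ℝ) • v) 1 0)) 0 := by
    have := hasDerivAt_clm_comp (RCLike.map 𝕂 ℂ) 1 0 x v
    rw [hν, map_mul_complex] at this
    simpa using this
  have h1' := (Complex.conjCLE : ℂ →L[ℝ] ℂ).hasFDerivAt.comp_hasDerivAt 0 h1
  have h2' := (Complex.conjCLE : ℂ →L[ℝ] ℂ).hasFDerivAt.comp_hasDerivAt 0 h2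
  simp only [ContinuousLinearEquiv.coe_coe, Complex.conjCLE_apply, map_mul] at h1' h2'
  convert! (((hasDerivAt_pow_of_eigen h1 a).mul (hasDerivAt_pow_of_eigen h1' b)).mul
    (hasDerivAt_pow_of_eigen h2 c)).mul (hasDerivAt_pow_of_eigen h2' e) using 1
  simp [mono]
  ring

/-- The Gaussian times a monomial. -/
noncomputable def mom (ℓ : (Fin 3 → Fin 3 → 𝕂) →L[ℝ] ℂ) (a b c e : ℕ) :
    𝓢((Fin 3 → Fin 3 → 𝕂), ℂ) :=
  smulLeftCLM ℂ (mono a b c e) ((matWeight 𝕂).gauss ℓ)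

theorem mom_apply (ℓ : (Fin 3 → Fin 3 → 𝕂) →L[ℝ] ℂ) (a b c e : ℕ) (x : Fin 3 → Fin 3 → 𝕂) :
    mom ℓ a b c e x = mono a b c e x * (matWeight 𝕂).gauss ℓ x := by
  rw [mom, smulLeftCLM_apply_apply (hasTemperateGrowth_mono a b c e), smul_eq_mul]

theorem hasDerivAt_mom (ℓ : (Fin 3 → Fin 3 → 𝕂) →L[ℝ] ℂ) (a b c e : ℕ)
    (x v : Fin 3 → Fin 3 → 𝕂) (μ ν : 𝕂) (hμ : v 0 1 = μ * x 0 1) (hν : v 1 0 = ν * x 1 0) :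
    HasDerivAt (fun s : ℝ ↦ mom ℓ a b c e (x + s • v))
      ((a * RCLike.map 𝕂 ℂ μ + b * (starRingEnd ℂ) (RCLike.map 𝕂 ℂ μ) + c * RCLike.map 𝕂 ℂ ν + e * (starRingEnd ℂ) (RCLike.map 𝕂 ℂ ν)
        - (2 * matInner x v : ℝ) + ℓ v) * mom ℓ a b c e x) 0 := by
  simp only [mom_apply]
  convert! (hasDerivAt_mono a b c e x v μ ν hμ hν).mul (hasDerivAt_matGauss ℓ x v) using 1
  simp
  ring

/-- The square of the absolute value of an entry. -/
noncomputable def nrm (i j : Fin 3) (x : Fin 3 → Fin 3 → 𝕂) : ℂ :=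
  ((RCLike.re (x i j) ^ 2 + RCLike.im (x i j) ^ 2 : ℝ) : ℂ)

theorem hasTemperateGrowth_nrm (i j : Fin 3) :
    (nrm i j : (Fin 3 → Fin 3 → 𝕂) → ℂ).HasTemperateGrowth :=
  Function.HasTemperateGrowth.comp Function.Complex.hasTemperateGrowth_ofReal
    (((hasTemperateGrowth_re_entry i j).pow 2).add ((hasTemperateGrowth_im_entry i j).pow 2))

theorem nrm_eq (i j : Fin 3) (x : Fin 3 → Fin 3 → 𝕂) :
    nrm i j x = RCLike.map 𝕂 ℂ (x i j) * (starRingEnd ℂ) (RCLike.map 𝕂 ℂ (x i j)) := by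
  apply Complex.ext <;> (simp [nrm, pow_two]; try ring)

end Core

section Core

variable {𝕂 : Type*} [RCLike 𝕂]

/-- Functionals on matrices that only involve the diagonal. -/
def IsDiagonalFunctional (ℓ : (Fin 3 → Fin 3 → 𝕂) →L[ℝ] ℂ) : Prop :=
  ∀ v : Fin 3 → Fin 3 → 𝕂, v 0 0 = 0 → v 1 1 = 0 → v 2 2 = 0 → ℓ v = 0

theorem IsSkewInvariant.nrm_vertical_aux {S : 𝓢((Fin 3 → Fin 3 → 𝕂), ℂ) →L[ℂ] ℂ}
    (hS : IsSkewInvariant S) {ℓ : (Fin 3 → Fin 3 → 𝕂) →L[ℝ] ℂ} (hℓ : IsDiagonalFunctional ℓ)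
    (a b c e : ℕ) (u : Fin 3 → Fin 3 → 𝕂) (h00 : u 0 0 = 0) (h01 : u 0 1 = 0) (h10 : u 1 0 = 0)
    (h11 : u 1 1 = 0) (h22 : u 2 2 = 0) (L : (Fin 3 → Fin 3 → 𝕂) →L[ℝ] ℝ)
    (hL : ∀ x, matInner x u * L x = L u * L x ^ 2) :
    2 * S (smulLeftCLM ℂ (fun x ↦ ((L u * L x ^ 2 : ℝ) : ℂ)) (mom ℓ a b c e))
      = L u * S (mom ℓ a b c e) := by
  have hLt : (fun x ↦ ((L x : ℝ) : ℂ)).HasTemperateGrowth :=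
    (Complex.ofRealCLM ∘L L).hasTemperateGrowth
  have hLt2 : (fun x ↦ ((L u * L x ^ 2 : ℝ) : ℂ)).HasTemperateGrowth :=
    Function.HasTemperateGrowth.comp Function.Complex.hasTemperateGrowth_ofReal
      ((Function.HasTemperateGrowth.const _).mul (L.hasTemperateGrowth.pow 2))
  have key := hS.trans u h00 h01 h10 h11 h22 (smulLeftCLM ℂ (fun x ↦ (L x : ℂ)) (mom ℓ a b c e))
    ((L u : ℂ) • mom ℓ a b c e -
      (2 : ℂ) • smulLeftCLM ℂ (fun x ↦ ((L u * L x ^ 2 : ℝ) : ℂ)) (mom ℓ a b c e)) (fun x ↦ ?_)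
  · rw [map_sub, map_smul, map_smul] at key
    simp only [smul_eq_mul] at key
    exact (sub_eq_zero.1 key).symm
  · have h1 : HasDerivAt (fun s : ℝ ↦ ((L (x + s • u) : ℝ) : ℂ)) (L u : ℂ) 0 := by
      have h3 : HasDerivAt (fun t : ℝ ↦ x + t • u) u 0 := by
        simpa using ((hasDerivAt_id (0 : ℝ)).smul_const u).const_add x
      exact (L.hasFDerivAt.comp_hasDerivAt 0 h3).ofReal_comp
    have h2 := h1.mul (hasDerivAt_mom ℓ a b c e x u 0 0 (by simp [h01]) (by simp [h10]))
    rw [hℓ u h00 h11 h22] at h2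
    convert! h2 using 1
    · ext s
      rw [smulLeftCLM_apply_apply hLt]
      simp
    · have := congrArg (fun t : ℝ ↦ (t : ℂ)) (hL x)
      simp only [Complex.ofReal_mul, Complex.ofReal_pow] at this
      rw [_root_.sub_apply, _root_.smul_apply, _root_.smul_apply,
        smulLeftCLM_apply_apply hLt2]
      simp
      linear_combination (2 * mom ℓ a b c e x) * this

/-- The product of the squared absolute value of an entry with a Gaussian moment. -/
noncomputable def nrmMom (ℓ : (Fin 3 → Fin 3 → 𝕂) →L[ℝ] ℂ) (i j : Fin 3) (a b c e : ℕ) :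
    𝓢((Fin 3 → Fin 3 → 𝕂), ℂ) :=
  smulLeftCLM ℂ (nrm i j) (mom ℓ a b c e)

theorem nrmMom_apply (ℓ : (Fin 3 → Fin 3 → 𝕂) →L[ℝ] ℂ) (i j : Fin 3) (a b c e : ℕ)
    (x : Fin 3 → Fin 3 → 𝕂) : nrmMom ℓ i j a b c e x = nrm i j x * mom ℓ a b c e x := by
  rw [nrmMom, smulLeftCLM_apply_apply (hasTemperateGrowth_nrm i j), smul_eq_mul]

theorem nrmMom_zero_one (ℓ : (Fin 3 → Fin 3 → 𝕂) →L[ℝ] ℂ) (a b c e : ℕ) :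
    nrmMom ℓ 0 1 a b c e = mom ℓ (a + 1) (b + 1) c e := by
  ext x
  rw [nrmMom_apply, nrm_eq, mom_apply, mom_apply, mono, mono]
  ring

theorem nrmMom_one_zero (ℓ : (Fin 3 → Fin 3 → 𝕂) →L[ℝ] ℂ) (a b c e : ℕ) :
    nrmMom ℓ 1 0 a b c e = mom ℓ a b (c + 1) (e + 1) := by
  ext x
  rw [nrmMom_apply, nrm_eq, mom_apply, mom_apply, mono, mono]
  ring

theorem IsSkewInvariant.nrm_vertical {S : 𝓢((Fin 3 → Fin 3 → 𝕂), ℂ) →L[ℂ] ℂ}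
    (hS : IsSkewInvariant S) {ℓ : (Fin 3 → Fin 3 → 𝕂) →L[ℝ] ℂ} (hℓ : IsDiagonalFunctional ℓ)
    (a b c e : ℕ) (i j : Fin 3) (hij : (i, j) = (1, 2) ∨ (i, j) = (2, 1)) :
    2 * S (nrmMom ℓ i j a b c e) =
      (1 + (RCLike.im (RCLike.I : 𝕂) : ℝ)) * S (mom ℓ a b c e) := by
  have hin : ∀ (t : 𝕂) (x : Fin 3 → Fin 3 → 𝕂), matInner x (Pi.single i (Pi.single j t)) =
      RCLike.re (x i j) * RCLike.re t + RCLike.im (x i j) * RCLike.im t := by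
    intro t x
    rcases hij with h | h <;> obtain ⟨rfl, rfl⟩ := Prod.ext_iff.1 h <;>
      simp [matInner, Fin.sum_univ_three, Pi.single_apply]
  have hz : ∀ (t : 𝕂) (k l : Fin 3), (k, l) ≠ (i, j) →
      (Pi.single i (Pi.single j t) : Fin 3 → Fin 3 → 𝕂) k l = 0 := by
    intro t k l hkl
    rcases eq_or_ne k i with rfl | hk
    · have : l ≠ j := fun h ↦ hkl (by rw [h])
      simp [this]
    · simp [hk]
  have h1 := hS.nrm_vertical_aux hℓ a b c e (Pi.single i (Pi.single j 1))
    (hz _ _ _ (by rcases hij with h | h <;> simp [h])) (hz _ _ _ (by rcases hij with h | h <;> simp [h]))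
    (hz _ _ _ (by rcases hij with h | h <;> simp [h])) (hz _ _ _ (by rcases hij with h | h <;> simp [h]))
    (hz _ _ _ (by rcases hij with h | h <;> simp [h]))
    ((RCLike.reCLM : 𝕂 →L[ℝ] ℝ) ∘L entryCLM i j) (fun x ↦ by simp [hin]; ring)
  have h2 := hS.nrm_vertical_aux hℓ a b c e (Pi.single i (Pi.single j RCLike.I))
    (hz _ _ _ (by rcases hij with h | h <;> simp [h])) (hz _ _ _ (by rcases hij with h | h <;> simp [h]))
    (hz _ _ _ (by rcases hij with h | h <;> simp [h])) (hz _ _ _ (by rcases hij with h | h <;> simp [h]))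
    (hz _ _ _ (by rcases hij with h | h <;> simp [h]))
    ((RCLike.imCLM : 𝕂 →L[ℝ] ℝ) ∘L entryCLM i j) (fun x ↦ by
      simp only [hin, ContinuousLinearMap.comp_apply, entryCLM_apply, Pi.single_eq_same,
        RCLike.imCLM_apply, RCLike.I_re]
      ring)
  simp only [ContinuousLinearMap.comp_apply, entryCLM_apply, Pi.single_eq_same, RCLike.reCLM_apply,
    RCLike.imCLM_apply, RCLike.one_re] at h1 h2
  have hsum : nrmMom ℓ i j a b c e =
      smulLeftCLM ℂ (fun x : Fin 3 → Fin 3 → 𝕂 ↦ ((1 * RCLike.re (x i j) ^ 2 : ℝ) : ℂ))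
        (mom ℓ a b c e) + smulLeftCLM ℂ (fun x : Fin 3 → Fin 3 → 𝕂 ↦
          ((RCLike.im (RCLike.I : 𝕂) * RCLike.im (x i j) ^ 2 : ℝ) : ℂ)) (mom ℓ a b c e) := by
    ext x
    have e1 : (fun x : Fin 3 → Fin 3 → 𝕂 ↦
        ((1 * RCLike.re (x i j) ^ 2 : ℝ) : ℂ)).HasTemperateGrowth :=
      Function.HasTemperateGrowth.comp Function.Complex.hasTemperateGrowth_ofReal
        ((Function.HasTemperateGrowth.const _).mul ((hasTemperateGrowth_re_entry i j).pow 2))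
    have e2 : (fun x : Fin 3 → Fin 3 → 𝕂 ↦
        ((RCLike.im (RCLike.I : 𝕂) * RCLike.im (x i j) ^ 2 : ℝ) : ℂ)).HasTemperateGrowth :=
      Function.HasTemperateGrowth.comp Function.Complex.hasTemperateGrowth_ofReal
        ((Function.HasTemperateGrowth.const _).mul ((hasTemperateGrowth_im_entry i j).pow 2))
    have e3 : RCLike.im (RCLike.I : 𝕂) * RCLike.im (x i j) ^ 2 = RCLike.im (x i j) ^ 2 := by
      have := RCLike.mul_im_I_ax (x i j)
      linear_combination RCLike.im (x i j) * this
    rw [nrmMom_apply, _root_.add_apply, smulLeftCLM_apply_apply e1, smulLeftCLM_apply_apply e2,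
      e3, nrm]
    simp
    ring
  rw [hsum, map_add]
  push_cast at h1 h2 ⊢
  linear_combination h1 + h2

theorem IsSkewInvariant.mom_skew {S : 𝓢((Fin 3 → Fin 3 → 𝕂), ℂ) →L[ℂ] ℂ}
    (hS : IsSkewInvariant S) {ℓ : (Fin 3 → Fin 3 → 𝕂) →L[ℝ] ℂ} (hℓ : IsDiagonalFunctional ℓ)
    (a b c e : ℕ) : S (mom ℓ a b c e) = -S (mom ℓ c e a b) := by
  refine hS.skew _ _ fun x ↦ ?_
  have h1 : ℓ x = ℓ (fun i j ↦ x j i) := by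
    rw [← sub_eq_zero, ← map_sub]
    exact hℓ _ (by simp) (by simp) (by simp)
  have h2 : (matWeight 𝕂).q x = (matWeight 𝕂).q (fun i j ↦ x j i) := by
    simp [matWeight, Fin.sum_univ_three]
    ring
  rw [mom_apply, mom_apply, CoerciveWeight.gauss_apply, CoerciveWeight.gauss_apply, h1, h2]
  simp only [mono]
  ring

theorem IsSkewInvariant.mom_torus {S : 𝓢((Fin 3 → Fin 3 → 𝕂), ℂ) →L[ℂ] ℂ}
    (hS : IsSkewInvariant S) {ℓ : (Fin 3 → Fin 3 → 𝕂) →L[ℝ] ℂ} (hℓ : IsDiagonalFunctional ℓ)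
    (a b c e : ℕ) (t : 𝕂) :
    (a * RCLike.map 𝕂 ℂ t + b * (starRingEnd ℂ) (RCLike.map 𝕂 ℂ t)) * S (mom ℓ a b c e) -
      2 * RCLike.re t * (S (mom ℓ (a + 1) (b + 1) c e) + S (nrmMom ℓ 2 1 a b c e)) =
    (c * RCLike.map 𝕂 ℂ t + e * (starRingEnd ℂ) (RCLike.map 𝕂 ℂ t)) * S (mom ℓ a b c e) -
      2 * RCLike.re t * (S (mom ℓ a b (c + 1) (e + 1)) + S (nrmMom ℓ 1 2 a b c e)) := by
  have key := hS.torus_deriv t (mom ℓ a b c e)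
    ((a * RCLike.map 𝕂 ℂ t + b * (starRingEnd ℂ) (RCLike.map 𝕂 ℂ t)) • mom ℓ a b c e -
      (2 * RCLike.re t : ℂ) • (nrmMom ℓ 0 1 a b c e + nrmMom ℓ 2 1 a b c e))
    ((c * RCLike.map 𝕂 ℂ t + e * (starRingEnd ℂ) (RCLike.map 𝕂 ℂ t)) • mom ℓ a b c e -
      (2 * RCLike.re t : ℂ) • (nrmMom ℓ 1 0 a b c e + nrmMom ℓ 1 2 a b c e))
    (fun x ↦ ?_) (fun x ↦ ?_)
  · simpa only [map_sub, map_smul, map_add, smul_eq_mul, nrmMom_zero_one, nrmMom_one_zero] using key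
  · convert! hasDerivAt_mom ℓ a b c e x (![![0, t, 0], ![0, 0, 0], ![0, t, 0]] * x) t 0 (by simp) (by simp) using 1
    rw [hℓ _ (by simp) (by simp) (by simp)]
    simp [nrmMom_apply, nrm, matInner, Fin.sum_univ_three]
    ring
  · convert! hasDerivAt_mom ℓ a b c e x (![![0, 0, 0], ![t, 0, t], ![0, 0, 0]] * x) 0 t (by simp) (by simp) using 1
    rw [hℓ _ (by simp) (by simp) (by simp)]
    simp [nrmMom_apply, nrm, matInner, Fin.sum_univ_three]
    ring

theorem IsSkewInvariant.mom_eq_zero {S : 𝓢((Fin 3 → Fin 3 → 𝕂), ℂ) →L[ℂ] ℂ}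
    (hS : IsSkewInvariant S) {ℓ : (Fin 3 → Fin 3 → 𝕂) →L[ℝ] ℂ} (hℓ : IsDiagonalFunctional ℓ)
    (a b c e : ℕ) : S (mom ℓ a b c e) = 0 := by
  refine eq_zero_of_moment_recursion (fun a b c e ↦ S (mom ℓ a b c e)) (fun a b c e ↦ ?_)
    (hS.mom_skew hℓ) ?_ a b c e
  · have h := hS.mom_torus hℓ a b c e 1
    have h1 := hS.nrm_vertical hℓ a b c e 1 2 (by simp)
    have h2 := hS.nrm_vertical hℓ a b c e 2 1 (by simp)
    simp at h
    linear_combination h - h1 + h2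
  · by_cases hI : (RCLike.I : 𝕂) = 0
    · right
      have him : ∀ z : 𝕂, RCLike.im z = 0 := fun z ↦ by
        have := RCLike.mul_im_I_ax z
        rw [hI] at this
        simpa using this.symm
      constructor
      · intro a b c e
        congr 1
        ext x
        simp [mom_apply, mono, him]
        ring
      · intro a c hac
        have h1 := hS.torus (-1) (by simp) (mom ℓ a 0 c 0) (-mom ℓ a 0 c 0) fun x ↦ by
          have h1 : ℓ x = ℓ (torusConj (-1) x) := by
            rw [← sub_eq_zero, ← map_sub]
            exact hℓ _ (by simp [torusConj]) (by simp [torusConj]) (by simp [torusConj])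
          have h2 : (matWeight 𝕂).q x = (matWeight 𝕂).q (torusConj (-1) x) := by
            simp [matWeight, Fin.sum_univ_three, torusConj]
          rw [_root_.neg_apply, mom_apply, mom_apply, CoerciveWeight.gauss_apply,
            CoerciveWeight.gauss_apply, h1, h2, ← neg_mul]
          congr 1
          have h3 : (-1 : ℂ) ^ a * (-1) ^ c = -1 := by rw [← pow_add]; exact hac.neg_one_pow
          simp [mono, torusConj, him]
          rw [neg_pow, neg_pow (RCLike.re (x 1 0) : ℂ)]
          linear_combination (-(RCLike.re (x 0 1) : ℂ) ^ a * (RCLike.re (x 1 0) : ℂ) ^ c) * h3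
        rw [map_neg] at h1
        exact neg_eq_self.1 h1
    · left
      intro a b c e hne
      have h := hS.mom_torus hℓ a b c e RCLike.I
      have him : RCLike.im (RCLike.I : 𝕂) = 1 := by
        have h2 := congrArg RCLike.re (RCLike.I_mul_I_ax.resolve_left hI : (RCLike.I : 𝕂) * RCLike.I = -1)
        have h3 := RCLike.mul_im_I_ax (RCLike.I : 𝕂)
        simp only [RCLike.mul_re, RCLike.I_re, map_neg, RCLike.one_re] at h2
        linear_combination -h3 - h2
      have hcx : RCLike.map 𝕂 ℂ (RCLike.I : 𝕂) = Complex.I := by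
        apply Complex.ext <;> simp [him]
      rw [hcx, Complex.conj_I, RCLike.I_re] at h
      push_cast at h
      have h2 : ((a + e : ℕ) : ℂ) - ((b + c : ℕ) : ℂ) ≠ 0 := by
        rw [sub_ne_zero]; exact_mod_cast hne
      have h4 : (((a + e : ℕ) : ℂ) - ((b + c : ℕ) : ℂ)) * S (mom ℓ a b c e) = 0 := by
        push_cast
        have h5 : Complex.I * Complex.I = -1 := Complex.I_mul_I
        linear_combination (-Complex.I) * h + ((a : ℂ) + e - b - c) * S (mom ℓ a b c e) * h5
      exact (mul_eq_zero.1 h4).resolve_left h2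

end Core

section Core

variable {𝕂 : Type*} [RCLike 𝕂]

theorem clm_expand (L : (Fin 3 → Fin 3 → 𝕂) →L[ℝ] ℝ) (x : Fin 3 → Fin 3 → 𝕂) :
    L x = ∑ i, ∑ j, (RCLike.re (x i j) * L (Pi.single i (Pi.single j 1)) +
      RCLike.im (x i j) * L (Pi.single i (Pi.single j RCLike.I))) := by
  have h : x = ∑ i, ∑ j, (RCLike.re (x i j) • (Pi.single i (Pi.single j 1) : Fin 3 → Fin 3 → 𝕂) +
      RCLike.im (x i j) • (Pi.single i (Pi.single j RCLike.I) : Fin 3 → Fin 3 → 𝕂)) := by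
    ext k l
    simp only [Finset.sum_apply, Pi.add_apply, Pi.smul_apply]
    rw [Finset.sum_eq_single k, Finset.sum_eq_single l]
    · simp [RCLike.real_smul_eq_coe_mul, RCLike.re_add_im]
    · intro j _ hj
      simp [hj.symm]
    · simp
    · intro i _ hi
      simp [hi.symm]
    · simp
  conv_lhs => rw [h]
  simp only [map_sum, map_add, map_smul, smul_eq_mul]

theorem smulLeftCLM_mom_succ {α α' β β' : ℂ} {ℓ₀ ℓ₁ : (Fin 3 → Fin 3 → 𝕂) →L[ℝ] ℂ}
    (h : ∀ x, ℓ₁ x = α * RCLike.map 𝕂 ℂ (x 0 1) + α' * (starRingEnd ℂ) (RCLike.map 𝕂 ℂ (x 0 1)) + β * RCLike.map 𝕂 ℂ (x 1 0) +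
      β' * (starRingEnd ℂ) (RCLike.map 𝕂 ℂ (x 1 0))) (n a b c e : ℕ) :
    smulLeftCLM ℂ (fun x ↦ ℓ₁ x ^ (n + 1)) (mom ℓ₀ a b c e) =
      α • smulLeftCLM ℂ (fun x ↦ ℓ₁ x ^ n) (mom ℓ₀ (a + 1) b c e) +
      α' • smulLeftCLM ℂ (fun x ↦ ℓ₁ x ^ n) (mom ℓ₀ a (b + 1) c e) +
      β • smulLeftCLM ℂ (fun x ↦ ℓ₁ x ^ n) (mom ℓ₀ a b (c + 1) e) +
      β' • smulLeftCLM ℂ (fun x ↦ ℓ₁ x ^ n) (mom ℓ₀ a b c (e + 1)) := by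
  have ht : ∀ n : ℕ, (fun x ↦ ℓ₁ x ^ n).HasTemperateGrowth := fun n ↦ ℓ₁.hasTemperateGrowth.pow n
  ext x
  simp only [_root_.add_apply, _root_.smul_apply, smulLeftCLM_apply_apply (ht _), mom_apply, smul_eq_mul, mono]
  rw [pow_succ (ℓ₁ x), h x]
  ring

theorem IsSkewInvariant.map_gauss_add {S : 𝓢((Fin 3 → Fin 3 → 𝕂), ℂ) →L[ℂ] ℂ}
    (hS : IsSkewInvariant S) {α α' β β' : ℂ} {ℓ₀ ℓ₁ : (Fin 3 → Fin 3 → 𝕂) →L[ℝ] ℂ}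
    (hℓ : IsDiagonalFunctional ℓ₀)
    (h : ∀ x, ℓ₁ x = α * RCLike.map 𝕂 ℂ (x 0 1) + α' * (starRingEnd ℂ) (RCLike.map 𝕂 ℂ (x 0 1)) + β * RCLike.map 𝕂 ℂ (x 1 0) +
      β' * (starRingEnd ℂ) (RCLike.map 𝕂 ℂ (x 1 0))) : S ((matWeight 𝕂).gauss (ℓ₀ + ℓ₁)) = 0 := by
  have key : ∀ n a b c e : ℕ, S (smulLeftCLM ℂ (fun x ↦ ℓ₁ x ^ n) (mom ℓ₀ a b c e)) = 0 := by
    intro n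
    induction n with
    | zero =>
      intro a b c e
      simpa using hS.mom_eq_zero hℓ a b c e
    | succ n ih =>
      intro a b c e
      simp only [smulLeftCLM_mom_succ h, map_add, map_smul, ih, smul_zero, add_zero]
  have h0 : mom ℓ₀ 0 0 0 0 = (matWeight 𝕂).gauss ℓ₀ := by
    ext x
    simp [mom_apply, mono]
  have := (matWeight 𝕂).eq_zero_of_moments S ℓ₀ ℓ₁ (fun n ↦ by rw [← h0]; exact key n 0 0 0 0) 1
  simpa using this

theorem clm_eq_of_offDiagonal (L : (Fin 3 → Fin 3 → 𝕂) →L[ℝ] ℝ) :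
    ∃ α α' β β' : ℂ, ∀ x, ((L (![![0, 1, 0], ![1, 0, 0], ![0, 0, 0]] * x) : ℝ) : ℂ) =
      α * RCLike.map 𝕂 ℂ (x 0 1) + α' * (starRingEnd ℂ) (RCLike.map 𝕂 ℂ (x 0 1)) + β * RCLike.map 𝕂 ℂ (x 1 0) +
      β' * (starRingEnd ℂ) (RCLike.map 𝕂 ℂ (x 1 0)) := by
  have key : ∀ (p r : ℝ) (z : 𝕂), ((RCLike.re z * p + RCLike.im z * r : ℝ) : ℂ) =
      (p - r * Complex.I) / 2 * RCLike.map 𝕂 ℂ z + (p + r * Complex.I) / 2 * (starRingEnd ℂ) (RCLike.map 𝕂 ℂ z) := by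
    intro p r z
    apply Complex.ext <;> simp <;> ring
  let t : Fin 3 → Fin 3 → 𝕂 → ℝ := fun i j z ↦ L (Pi.single i (Pi.single j z))
  refine ⟨(t 0 1 1 - t 0 1 RCLike.I * Complex.I) / 2, (t 0 1 1 + t 0 1 RCLike.I * Complex.I) / 2,
    (t 1 0 1 - t 1 0 RCLike.I * Complex.I) / 2, (t 1 0 1 + t 1 0 RCLike.I * Complex.I) / 2,
    fun x ↦ ?_⟩
  rw [clm_expand]
  have h1 := key (t 0 1 1) (t 0 1 RCLike.I) (x 0 1)
  have h2 := key (t 1 0 1) (t 1 0 RCLike.I) (x 1 0)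
  rw [add_assoc, ← h1, ← h2, ← Complex.ofReal_add]
  congr 1
  simp [Fin.sum_univ_three, t]

theorem exists_matInner_eq (L : (Fin 3 → Fin 3 → 𝕂) →L[ℝ] ℝ) :
    ∃ u : Fin 3 → Fin 3 → 𝕂, u 0 0 = 0 ∧ u 0 1 = 0 ∧ u 1 0 = 0 ∧ u 1 1 = 0 ∧ u 2 2 = 0 ∧
      ∀ x, L (![![0, 0, 1], ![0, 0, 1], ![1, 1, 0]] * x) = 2 * matInner x u := by
  obtain ⟨p, hp⟩ : ∃ p : Fin 3 → Fin 3 → ℝ, ∀ i j, L (Pi.single i (Pi.single j 1)) = 2 * p i j :=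
    ⟨fun i j ↦ L (Pi.single i (Pi.single j 1)) / 2, fun i j ↦ by ring⟩
  obtain ⟨r, hr⟩ : ∃ r : Fin 3 → Fin 3 → ℝ, ∀ i j,
      L (Pi.single i (Pi.single j RCLike.I)) = 2 * r i j :=
    ⟨fun i j ↦ L (Pi.single i (Pi.single j RCLike.I)) / 2, fun i j ↦ by ring⟩
  refine ⟨![![0, 0, 1], ![0, 0, 1], ![1, 1, 0]] * fun i j ↦ (p i j : 𝕂) + (r i j : 𝕂) * RCLike.I,
    by simp, by simp, by simp, by simp, by simp, fun x ↦ ?_⟩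
  have h : ∀ (z : 𝕂) (r : ℝ), RCLike.im z * r = RCLike.im z * (r * RCLike.im (RCLike.I : 𝕂)) := by
    intro z r
    linear_combination -r * RCLike.mul_im_I_ax z
  rw [clm_expand]
  simp only [hp, hr, h _ (2 * r _ _)]
  simp [Fin.sum_univ_three, matInner]
  ring

theorem IsSkewInvariant.map_gauss {S : 𝓢((Fin 3 → Fin 3 → 𝕂), ℂ) →L[ℂ] ℂ}
    (hS : IsSkewInvariant S) (L : (Fin 3 → Fin 3 → 𝕂) →L[ℝ] ℝ) :
    S ((matWeight 𝕂).gauss (Complex.ofRealCLM ∘L L)) = 0 := by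
  let m : (Fin 3 → Fin 3 → 𝕂) → (Fin 3 → Fin 3 → 𝕂) →L[ℝ] ℂ := fun v ↦
    Complex.ofRealCLM ∘L L ∘L ContinuousLinearMap.mul ℝ (Fin 3 → Fin 3 → 𝕂) v
  let ℓ₀ := m ![![1, 0, 0], ![0, 1, 0], ![0, 0, 1]]
  let ℓ₁ := m ![![0, 1, 0], ![1, 0, 0], ![0, 0, 0]]
  let ℓ₂ := m ![![0, 0, 1], ![0, 0, 1], ![1, 1, 0]]
  have hsplit : Complex.ofRealCLM ∘L L = (ℓ₀ + ℓ₁) + (1 : ℂ) • ℓ₂ := by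
    ext x
    simp only [ℓ₀, ℓ₁, ℓ₂, m, _root_.add_apply, ContinuousLinearMap.comp_apply,
      Complex.ofRealCLM_apply, ContinuousLinearMap.mul_apply', one_smul]
    rw [← Complex.ofReal_add, ← Complex.ofReal_add, ← map_add, ← map_add, ← add_mul, ← add_mul]
    congr 2
    ext i j
    fin_cases i <;> fin_cases j <;> simp
  have h0 : IsDiagonalFunctional ℓ₀ := by
    intro v h1 h2 h3
    have : (![![1, 0, 0], ![0, 1, 0], ![0, 0, 1]] * v : Fin 3 → Fin 3 → 𝕂) = 0 := by
      ext i j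
      fin_cases i <;> fin_cases j <;> simp [h1, h2, h3]
    simp only [ℓ₀, m, ContinuousLinearMap.comp_apply, ContinuousLinearMap.mul_apply', this, map_zero]
  obtain ⟨α, α', β, β', hα⟩ := clm_eq_of_offDiagonal L
  have h1 : S ((matWeight 𝕂).gauss (ℓ₀ + ℓ₁)) = 0 := hS.map_gauss_add h0 hα
  obtain ⟨u, h00, h01, h10, h11, h22, hu⟩ := exists_matInner_eq L
  have h2u : ∀ x, ℓ₂ x = ((2 * matInner x u : ℝ) : ℂ) := fun x ↦
    congrArg (fun t : ℝ ↦ (t : ℂ)) (hu x)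
  have hu0 : (ℓ₀ + ℓ₁) u = 0 := by
    rw [_root_.add_apply, h0 u h00 h11 h22]
    refine (congrArg _ (hα u)).trans ?_
    simp [h01, h10]
  set F : ℂ → ℂ := fun s ↦ S ((matWeight 𝕂).gauss (ℓ₀ + ℓ₁ + s • ℓ₂)) with hF
  have hder : ∀ s, HasDerivAt F (s * ℓ₂ u * F s) s := by
    intro s
    refine ((matWeight 𝕂).hasDerivAt S (ℓ₀ + ℓ₁) ℓ₂ s).congr_deriv ?_
    have := hS.trans u h00 h01 h10 h11 h22 ((matWeight 𝕂).gauss (ℓ₀ + ℓ₁ + s • ℓ₂))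
      ((s * ℓ₂ u) • (matWeight 𝕂).gauss (ℓ₀ + ℓ₁ + s • ℓ₂) -
        smulLeftCLM ℂ ℓ₂ ((matWeight 𝕂).gauss (ℓ₀ + ℓ₁ + s • ℓ₂))) fun x ↦ ?_
    · rw [map_sub, map_smul, sub_eq_zero] at this
      rw [← this, smul_eq_mul]
    · refine (hasDerivAt_matGauss (ℓ₀ + ℓ₁ + s • ℓ₂) x u).congr_deriv ?_
      rw [_root_.sub_apply, smulLeftCLM_apply_apply ℓ₂.hasTemperateGrowth, _root_.add_apply (ℓ₀ + ℓ₁), hu0, h2u x]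
      simp only [_root_.smul_apply, smul_eq_mul]
      push_cast
      ring
  have hconst : ∀ s, HasDerivAt (fun s ↦ Complex.exp (-(ℓ₂ u) / 2 * s ^ 2) * F s) 0 s := by
    intro s
    have e1 : HasDerivAt (fun s : ℂ ↦ Complex.exp (-(ℓ₂ u) / 2 * s ^ 2))
        (Complex.exp (-(ℓ₂ u) / 2 * s ^ 2) * (-(ℓ₂ u) * s)) s := by
      convert! ((hasDerivAt_pow 2 s).const_mul (-(ℓ₂ u) / 2)).cexp using 2
      simp
      ring
    refine (e1.mul (hder s)).congr_deriv ?_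
    ring
  have := is_const_of_deriv_eq_zero (fun s ↦ (hconst s).differentiableAt)
    (fun s ↦ (hconst s).deriv) 1 0
  have h3 : F 0 = 0 := by
    have e : ℓ₀ + ℓ₁ + (0 : ℂ) • ℓ₂ = ℓ₀ + ℓ₁ := by
      ext x
      simp
    rw [hF]
    simp only [e]
    exact h1
  rw [h3, mul_zero, mul_eq_zero] at this
  rw [hsplit]
  exact this.resolve_left (Complex.exp_ne_zero _)

/-- Skew-invariant distributions vanish. -/
theorem IsSkewInvariant.map_eq_zero {S : 𝓢((Fin 3 → Fin 3 → 𝕂), ℂ) →L[ℂ] ℂ}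
    (hS : IsSkewInvariant S) (φ : 𝓢((Fin 3 → Fin 3 → 𝕂), ℂ)) (hφ : HasCompactSupport φ) :
    S φ = 0 :=
  (matWeight 𝕂).map_eq_zero_of_hasCompactSupport S hS.map_gauss φ hφ

end Core

section Tools

variable {V : Type*} [NormedAddCommGroup V] [NormedSpace ℝ V]

/-- The derivative of a Schwartz function along a linear vector field. -/
noncomputable def SchwartzMap.derivAlong (B : V →L[ℝ] V) (φ : 𝓢(V, ℂ)) : 𝓢(V, ℂ) :=
  bilinLeftCLM (ContinuousLinearMap.id ℝ (V →L[ℝ] ℂ)) B.hasTemperateGrowth (fderivCLM ℝ V ℂ φ)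

theorem SchwartzMap.derivAlong_apply (B : V →L[ℝ] V) (φ : 𝓢(V, ℂ)) (x : V) :
    derivAlong B φ x = fderiv ℝ φ x (B x) := rfl

theorem SchwartzMap.hasDerivAt_fderiv (φ : 𝓢(V, ℂ)) (x v : V) :
    HasDerivAt (fun s : ℝ ↦ φ (x + s • v)) (fderiv ℝ φ x v) 0 := by
  have h3 : HasDerivAt (fun t : ℝ ↦ x + t • v) v 0 := by
    simpa using ((hasDerivAt_id (0 : ℝ)).smul_const v).const_add x
  have h4 := (φ.differentiableAt (x := x + (0 : ℝ) • v)).hasFDerivAt.comp_hasDerivAt 0 h3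
  simpa [Function.comp_def] using h4

theorem SchwartzMap.tsupport_derivAlong_subset (B : V →L[ℝ] V) (φ : 𝓢(V, ℂ)) :
    tsupport (derivAlong B φ) ⊆ tsupport φ := by
  refine closure_minimal (fun x hx ↦ ?_) (isClosed_tsupport _)
  refine support_fderiv_subset ℝ fun h ↦ hx ?_
  rw [derivAlong_apply, h, _root_.zero_apply]

theorem SchwartzMap.exists_mul_of_tsupport_subset (φ : 𝓢(V, ℂ)) (hφ : HasCompactSupport φ)
    {U : Set V} (hU : IsOpen U) (hs : tsupport φ ⊆ U) {g : V → ℂ} (hg : ContDiffOn ℝ ∞ g U) :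
    ∃ φ' : 𝓢(V, ℂ), (∀ x, φ' x = g x * φ x) ∧ HasCompactSupport φ' ∧ tsupport φ' ⊆ tsupport φ := by
  have hsub : tsupport (fun x ↦ g x * φ x) ⊆ tsupport φ := tsupport_mul_subset_right
  have hc : HasCompactSupport (fun x ↦ g x * φ x) := hφ.mul_left
  have hd : ContDiff ℝ ∞ (fun x ↦ g x * φ x) := by
    refine contDiff_iff_contDiffAt.2 fun x ↦ ?_
    by_cases hx : x ∈ tsupport (fun x ↦ g x * φ x)
    · exact (hg.contDiffAt (hU.mem_nhds (hs (hsub hx)))).mul (φ.smooth ⊤).contDiffAt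
    · exact contDiffAt_const.congr_of_eventuallyEq (notMem_tsupport_iff_eventuallyEq.1 hx)
  exact ⟨hc.toSchwartzMap hd, fun x ↦ rfl, hc, hsub⟩

theorem exists_cutoff {E : Type*} [NormedAddCommGroup E] [NormedSpace ℝ E] [FiniteDimensional ℝ E]
    {K U : Set E} (hK : IsCompact K) (hU : IsOpen U) (hKU : K ⊆ U) :
    ∃ χ : E → ℝ, ContDiff ℝ ∞ χ ∧ HasCompactSupport χ ∧ tsupport χ ⊆ U ∧
      ∀ x ∈ K, ∀ᶠ y in nhds x, χ y = 1 := by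
  obtain ⟨R, hR⟩ := hK.isBounded.subset_ball 0
  have hcl : IsClosed (U ∩ Metric.ball 0 R)ᶜ := (hU.inter Metric.isOpen_ball).isClosed_compl
  have hdis : Disjoint (U ∩ Metric.ball 0 R)ᶜ K :=
    Set.disjoint_compl_left_iff_subset.2 (Set.subset_inter hKU hR)
  obtain ⟨f, hf0, hf1, -⟩ := exists_contMDiffMap_zero_one_nhds_of_isClosed (modelWithCornersSelf ℝ E)
    (n := ⊤) hcl hK.isClosed hdis
  have hsub : tsupport f ⊆ U ∩ Metric.ball 0 R := by
    intro x hx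
    by_contra h
    have := hf0.filter_mono (nhds_le_nhdsSet (Set.mem_compl h))
    exact (notMem_tsupport_iff_eventuallyEq.2 this) hx
  refine ⟨f, f.contMDiff.contDiff, ?_, hsub.trans Set.inter_subset_left, fun x hx ↦
    hf1.filter_mono (nhds_le_nhdsSet hx)⟩
  exact Metric.isCompact_of_isClosed_isBounded (isClosed_tsupport _)
    (Metric.isBounded_ball.subset (hsub.trans Set.inter_subset_right))

end Tools

theorem SchwartzMap.exists_comp_clm {V : Type*} [NormedAddCommGroup V] [NormedSpace ℝ V]
    (B B' : V →L[ℝ] V) (h : ∀ x, B' (B x) = x) (φ : 𝓢(V, ℂ)) :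
    ∃ φ' : 𝓢(V, ℂ), ∀ x, φ' x = φ (B x) := by
  refine ⟨compCLM ℂ (g := B) B.hasTemperateGrowth ⟨1, ‖B'‖, fun x ↦ ?_⟩ φ, fun x ↦ rfl⟩
  calc ‖x‖ = ‖B' (B x)‖ := by rw [h]
    _ ≤ ‖B'‖ * ‖B x‖ := B'.le_opNorm _
    _ ≤ _ := by rw [pow_one]; gcongr; linarith

section Shear

variable {𝕂 : Type*} [RCLike 𝕂]

/-- The vector field `x ↦ p · (last row of x)`. -/
noncomputable def rowField (p : Fin 3 → 𝕂) : (Fin 3 → Fin 3 → 𝕂) →L[ℝ] (Fin 3 → Fin 3 → 𝕂) :=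
  ContinuousLinearMap.pi fun i ↦ ContinuousLinearMap.pi fun j ↦
    ContinuousLinearMap.mul ℝ 𝕂 (p i) ∘L entryCLM 2 j

/-- The vector field `x ↦ (last column of x) · p`. -/
noncomputable def colField (p : Fin 3 → 𝕂) : (Fin 3 → Fin 3 → 𝕂) →L[ℝ] (Fin 3 → Fin 3 → 𝕂) :=
  ContinuousLinearMap.pi fun i ↦ ContinuousLinearMap.pi fun j ↦
    ContinuousLinearMap.mul ℝ 𝕂 (p j) ∘L entryCLM i 2

/-- The vector field `x ↦ x₃₃ u`. -/
noncomputable def cornerField (u : Fin 3 → Fin 3 → 𝕂) :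
    (Fin 3 → Fin 3 → 𝕂) →L[ℝ] (Fin 3 → Fin 3 → 𝕂) :=
  ContinuousLinearMap.pi fun i ↦ ContinuousLinearMap.pi fun j ↦
    ContinuousLinearMap.mul ℝ 𝕂 (u i j) ∘L entryCLM 2 2

@[simp]
theorem rowField_apply (p : Fin 3 → 𝕂) (x : Fin 3 → Fin 3 → 𝕂) (i j : Fin 3) :
    rowField p x i j = p i * x 2 j := rfl

@[simp]
theorem colField_apply (p : Fin 3 → 𝕂) (x : Fin 3 → Fin 3 → 𝕂) (i j : Fin 3) :
    colField p x i j = p j * x i 2 := rfl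

@[simp]
theorem cornerField_apply (u x : Fin 3 → Fin 3 → 𝕂) (i j : Fin 3) :
    cornerField u x i j = u i j * x 2 2 := rfl

/-- A distribution equivariant under the two unipotent groups and the torus, and skew under
transposition. -/
structure IsEquivariantSkew (ℓ : 𝕂 →L[ℝ] ℝ) (f : 𝓢((Fin 3 → Fin 3 → 𝕂), ℂ) →L[ℂ] ℂ) : Prop where
  left : ∀ p : Fin 3 → 𝕂, p 2 = 0 → ∀ φ φ' : 𝓢((Fin 3 → Fin 3 → 𝕂), ℂ),
    (∀ x, φ' x = φ (x + rowField p x)) → f φ' = Complex.exp (-(ℓ (p 0) : ℂ) * Complex.I) * f φ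
  right : ∀ p : Fin 3 → 𝕂, p 2 = 0 → ∀ φ φ' : 𝓢((Fin 3 → Fin 3 → 𝕂), ℂ),
    (∀ x, φ' x = φ (x + colField p x)) → f φ' = Complex.exp (-(ℓ (p 0) : ℂ) * Complex.I) * f φ
  torus : ∀ a : 𝕂, a ≠ 0 → ∀ φ φ' : 𝓢((Fin 3 → Fin 3 → 𝕂), ℂ),
    (∀ x, φ' x = φ (torusConj a x)) → f φ' = f φ
  skew : ∀ φ φ' : 𝓢((Fin 3 → Fin 3 → 𝕂), ℂ), (∀ x, φ' x = φ (fun i j ↦ x j i)) → f φ' = -f φ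

theorem exists_comp_rowField (p : Fin 3 → 𝕂) (hp : p 2 = 0) (φ : 𝓢((Fin 3 → Fin 3 → 𝕂), ℂ)) :
    ∃ φ' : 𝓢((Fin 3 → Fin 3 → 𝕂), ℂ), ∀ x, φ' x = φ (x + rowField p x) :=
  exists_comp_clm (ContinuousLinearMap.id ℝ _ + rowField p)
    (ContinuousLinearMap.id ℝ _ - rowField p) (fun x ↦ by ext i j; simp [hp]) φ

theorem exists_comp_colField (p : Fin 3 → 𝕂) (hp : p 2 = 0) (φ : 𝓢((Fin 3 → Fin 3 → 𝕂), ℂ)) :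
    ∃ φ' : 𝓢((Fin 3 → Fin 3 → 𝕂), ℂ), ∀ x, φ' x = φ (x + colField p x) :=
  exists_comp_clm (ContinuousLinearMap.id ℝ _ + colField p)
    (ContinuousLinearMap.id ℝ _ - colField p) (fun x ↦ by ext i j; simp [hp]) φ

theorem exists_comp_cornerField (u : Fin 3 → Fin 3 → 𝕂) (hu : u 2 2 = 0)
    (φ : 𝓢((Fin 3 → Fin 3 → 𝕂), ℂ)) :
    ∃ φ' : 𝓢((Fin 3 → Fin 3 → 𝕂), ℂ), ∀ x, φ' x = φ (x + cornerField u x) :=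
  exists_comp_clm (ContinuousLinearMap.id ℝ _ + cornerField u)
    (ContinuousLinearMap.id ℝ _ - cornerField u) (fun x ↦ by ext i j; simp [hu]) φ

theorem hasTemperateGrowth_matrix {E : Type*} [NormedAddCommGroup E] [NormedSpace ℝ E]
    {F : E → Fin 3 → Fin 3 → 𝕂} (h : ∀ i j, (fun x ↦ F x i j).HasTemperateGrowth) :
    F.HasTemperateGrowth := by
  have e : F = fun x ↦ ∑ i, ∑ j, (ContinuousLinearMap.single ℝ (fun _ : Fin 3 ↦ Fin 3 → 𝕂) i ∘L
      ContinuousLinearMap.single ℝ (fun _ : Fin 3 ↦ 𝕂) j) (F x i j) := by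
    ext x k l
    simp [Finset.sum_apply, Pi.single_apply, ite_apply]
  rw [e]
  exact Function.HasTemperateGrowth.sum fun i _ ↦ Function.HasTemperateGrowth.sum fun j _ ↦
    (ContinuousLinearMap.hasTemperateGrowth _).comp (h i j)

/-- The shear adding `k(x₃₃) xᵢ₃ x₃ⱼ` to the entries of the upper left block. -/
def shear (k : 𝕂 → 𝕂) (x : Fin 3 → Fin 3 → 𝕂) : Fin 3 → Fin 3 → 𝕂 := fun i j ↦
  x i j + (![1, 1, 0] : Fin 3 → 𝕂) i * (![1, 1, 0] : Fin 3 → 𝕂) j * (k (x 2 2) * x i 2 * x 2 j)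

theorem shear_apply_two (k : 𝕂 → 𝕂) (x : Fin 3 → Fin 3 → 𝕂) (i : Fin 3) :
    shear k x i 2 = x i 2 := by simp [shear]

theorem shear_two_apply (k : 𝕂 → 𝕂) (x : Fin 3 → Fin 3 → 𝕂) (j : Fin 3) :
    shear k x 2 j = x 2 j := by simp [shear]

theorem shear_neg_shear (k : 𝕂 → 𝕂) (x : Fin 3 → Fin 3 → 𝕂) : shear (-k) (shear k x) = x := by
  ext i j
  rw [shear, shear_apply_two, shear_apply_two, shear_two_apply, Pi.neg_apply, shear]
  ring

theorem hasTemperateGrowth_shear {k : 𝕂 → 𝕂} (hk : k.HasTemperateGrowth) :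
    (shear k).HasTemperateGrowth := by
  refine hasTemperateGrowth_matrix fun i j ↦ ?_
  have h : ∀ i j, (fun x : Fin 3 → Fin 3 → 𝕂 ↦ x i j).HasTemperateGrowth := fun i j ↦
    (entryCLM i j : (Fin 3 → Fin 3 → 𝕂) →L[ℝ] 𝕂).hasTemperateGrowth
  exact (h i j).add ((Function.HasTemperateGrowth.const _).mul
    (((hk.comp (h 2 2)).mul (h i 2)).mul (h 2 j)))

/-- Composition with a shear. -/
noncomputable def compShear {k : 𝕂 → 𝕂} (hk : k.HasTemperateGrowth) :
    𝓢((Fin 3 → Fin 3 → 𝕂), ℂ) →L[ℂ] 𝓢((Fin 3 → Fin 3 → 𝕂), ℂ) :=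
  compCLM ℂ (hasTemperateGrowth_shear hk) (by
    obtain ⟨n, C, h⟩ := (hasTemperateGrowth_shear hk.neg).2 0
    refine ⟨n, C, fun x ↦ ?_⟩
    have := h (shear k x)
    rwa [norm_iteratedFDeriv_zero, shear_neg_shear] at this)

theorem compShear_apply {k : 𝕂 → 𝕂} (hk : k.HasTemperateGrowth) (φ : 𝓢((Fin 3 → Fin 3 → 𝕂), ℂ))
    (x : Fin 3 → Fin 3 → 𝕂) : compShear hk φ x = φ (shear k x) := rfl

/-- The phase `κ(x₃₃) ψ(k(x₃₃) (x₁₃ + x₃₁))`. -/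
noncomputable def phase (ℓ : 𝕂 →L[ℝ] ℝ) (κ : 𝕂 → ℂ) (k : 𝕂 → 𝕂) (x : Fin 3 → Fin 3 → 𝕂) : ℂ :=
  κ (x 2 2) * Complex.exp ((ℓ (k (x 2 2) * (x 0 2 + x 2 0)) : ℂ) * Complex.I)

theorem hasTemperateGrowth_phase (ℓ : 𝕂 →L[ℝ] ℝ) {κ : 𝕂 → ℂ} {k : 𝕂 → 𝕂}
    (hκ : κ.HasTemperateGrowth) (hk : k.HasTemperateGrowth) :
    (phase ℓ κ k).HasTemperateGrowth := by
  have h : ∀ i j, (fun x : Fin 3 → Fin 3 → 𝕂 ↦ x i j).HasTemperateGrowth := fun i j ↦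
    (entryCLM i j : (Fin 3 → Fin 3 → 𝕂) →L[ℝ] 𝕂).hasTemperateGrowth
  exact (hκ.comp (h 2 2)).mul (ℓ.hasTemperateGrowth.comp
    ((hk.comp (h 2 2)).mul ((h 0 2).add (h 2 0)))).cexp_mul_I

/-- The straightening operator. -/
noncomputable def straighten (ℓ : 𝕂 →L[ℝ] ℝ) (κ : 𝕂 → ℂ) {k : 𝕂 → 𝕂} (hk : k.HasTemperateGrowth) :
    𝓢((Fin 3 → Fin 3 → 𝕂), ℂ) →L[ℂ] 𝓢((Fin 3 → Fin 3 → 𝕂), ℂ) :=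
  smulLeftCLM ℂ (phase ℓ κ k) ∘L compShear hk

theorem straighten_apply (ℓ : 𝕂 →L[ℝ] ℝ) {κ : 𝕂 → ℂ} {k : 𝕂 → 𝕂} (hκ : κ.HasTemperateGrowth)
    (hk : k.HasTemperateGrowth) (φ : 𝓢((Fin 3 → Fin 3 → 𝕂), ℂ)) (x : Fin 3 → Fin 3 → 𝕂) :
    straighten ℓ κ hk φ x = phase ℓ κ k x * φ (shear k x) := by
  rw [straighten, ContinuousLinearMap.comp_apply,
    smulLeftCLM_apply_apply (hasTemperateGrowth_phase ℓ hκ hk), compShear_apply, smul_eq_mul]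

end Shear

section Straighten

variable {𝕂 : Type*} [RCLike 𝕂]

theorem IsEquivariantSkew.straighten_corner {ℓ : 𝕂 →L[ℝ] ℝ}
    {f : 𝓢((Fin 3 → Fin 3 → 𝕂), ℂ) →L[ℂ] ℂ} (hf : IsEquivariantSkew ℓ f) {κ : 𝕂 → ℂ} {k : 𝕂 → 𝕂}
    (hκ : κ.HasTemperateGrowth) (hk : k.HasTemperateGrowth) (hκk : ∀ t, κ t ≠ 0 → k t * t = 1)
    (u : Fin 3 → Fin 3 → 𝕂) (h00 : u 0 0 = 0) (h01 : u 0 1 = 0) (h10 : u 1 0 = 0)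
    (h11 : u 1 1 = 0) (h22 : u 2 2 = 0) (G G' : 𝓢((Fin 3 → Fin 3 → 𝕂), ℂ))
    (hG : ∀ x, G' x = G (x + cornerField u x)) :
    f (straighten ℓ κ hk.neg G') = f (straighten ℓ κ hk.neg G) := by
  obtain ⟨φ₁, h₁⟩ := exists_comp_rowField (fun i ↦ u i 2) h22 (straighten ℓ κ hk.neg G)
  obtain ⟨φ₂, h₂⟩ := exists_comp_colField (fun j ↦ u 2 j) h22 φ₁
  have e : straighten ℓ κ hk.neg G' =
      Complex.exp (((ℓ (u 0 2) : ℂ) + ℓ (u 2 0)) * Complex.I) • φ₂ := by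
    ext x
    rw [_root_.smul_apply, h₂, h₁, straighten_apply ℓ hκ, straighten_apply ℓ hκ, smul_eq_mul, ← mul_assoc,
      hG]
    set z := x + colField (fun j ↦ u 2 j) x +
      rowField (fun i ↦ u i 2) (x + colField (fun j ↦ u 2 j) x) with hz
    have z22 : z 2 2 = x 2 2 := by simp [hz, h22]
    by_cases h0 : κ (x 2 2) = 0
    · simp [phase, h0, z22]
    have hkx := hκk _ h0
    congr 1
    · have e1 : (-k) (x 2 2) * (x 0 2 + x 2 0) = u 0 2 + u 2 0 + (-k) (z 2 2) * (z 0 2 + z 2 0) := by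
        rw [z22, Pi.neg_apply]
        simp only [hz, Pi.add_apply, colField_apply, rowField_apply, h22]
        linear_combination (u 0 2 + u 2 0) * hkx
      rw [phase, phase, e1, map_add, map_add, z22, mul_left_comm, ← Complex.exp_add]
      congr 2
      push_cast
      ring
    · congr 1
      ext i j
      simp only [shear, Pi.add_apply, cornerField_apply, Pi.neg_apply, hz, colField_apply,
        rowField_apply, h22]
      fin_cases i <;> fin_cases j <;> simp [h00, h01, h10, h11, h22]
      · linear_combination (u 0 2 * x 2 0 + u 2 0 * x 0 2 + u 0 2 * u 2 0 * x 2 2) * hkx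
      · linear_combination (u 0 2 * x 2 1 + u 2 1 * x 0 2 + u 0 2 * u 2 1 * x 2 2) * hkx
      · linear_combination (u 1 2 * x 2 0 + u 2 0 * x 1 2 + u 1 2 * u 2 0 * x 2 2) * hkx
      · linear_combination (u 1 2 * x 2 1 + u 2 1 * x 1 2 + u 1 2 * u 2 1 * x 2 2) * hkx
  have e₁ := hf.left (fun i ↦ u i 2) h22 _ φ₁ h₁
  have e₂ := hf.right (fun j ↦ u 2 j) h22 φ₁ φ₂ h₂
  rw [e, map_smul, e₂, e₁, smul_eq_mul, ← mul_assoc,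
    ← mul_assoc, ← Complex.exp_add, ← Complex.exp_add]
  have : ((ℓ (u 0 2) : ℂ) + ℓ (u 2 0)) * Complex.I + -(ℓ (u 2 0) : ℂ) * Complex.I +
    -(ℓ (u 0 2) : ℂ) * Complex.I = 0 := by ring
  rw [this, Complex.exp_zero, one_mul]

theorem IsEquivariantSkew.straighten_torus {ℓ : 𝕂 →L[ℝ] ℝ}
    {f : 𝓢((Fin 3 → Fin 3 → 𝕂), ℂ) →L[ℂ] ℂ} (hf : IsEquivariantSkew ℓ f) {κ : 𝕂 → ℂ} {k : 𝕂 → 𝕂}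
    (hκ : κ.HasTemperateGrowth) (hk : k.HasTemperateGrowth) (a : 𝕂) (ha : a ≠ 0)
    (G G' : 𝓢((Fin 3 → Fin 3 → 𝕂), ℂ)) (hG : ∀ x, G' x = G (torusConj a x)) :
    f (straighten ℓ κ hk G') = f (straighten ℓ κ hk G) := by
  refine hf.torus a ha _ _ fun x ↦ ?_
  rw [straighten_apply ℓ hκ, straighten_apply ℓ hκ, hG]
  congr 1
  · simp [phase, torusConj, ha, mul_right_comm]
  · congr 1
    ext i j
    simp only [shear, torusConj]
    fin_cases i <;> fin_cases j <;> simp <;> field_simp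

theorem IsEquivariantSkew.straighten_skew {ℓ : 𝕂 →L[ℝ] ℝ}
    {f : 𝓢((Fin 3 → Fin 3 → 𝕂), ℂ) →L[ℂ] ℂ} (hf : IsEquivariantSkew ℓ f) {κ : 𝕂 → ℂ} {k : 𝕂 → 𝕂}
    (hκ : κ.HasTemperateGrowth) (hk : k.HasTemperateGrowth)
    (G G' : 𝓢((Fin 3 → Fin 3 → 𝕂), ℂ)) (hG : ∀ x, G' x = G (fun i j ↦ x j i)) :
    f (straighten ℓ κ hk G') = -f (straighten ℓ κ hk G) := by
  refine hf.skew _ _ fun x ↦ ?_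
  rw [straighten_apply ℓ hκ, straighten_apply ℓ hκ, hG]
  congr 1
  · simp only [phase, add_comm]
  · congr 1
    ext i j
    simp only [shear]
    ring

theorem IsEquivariantSkew.straighten_cornerField {ℓ : 𝕂 →L[ℝ] ℝ}
    {f : 𝓢((Fin 3 → Fin 3 → 𝕂), ℂ) →L[ℂ] ℂ} (hf : IsEquivariantSkew ℓ f) {κ : 𝕂 → ℂ} {k : 𝕂 → 𝕂}
    (hκ : κ.HasTemperateGrowth) (hk : k.HasTemperateGrowth) (hκk : ∀ t, κ t ≠ 0 → k t * t = 1)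
    (u : Fin 3 → Fin 3 → 𝕂) (h00 : u 0 0 = 0) (h01 : u 0 1 = 0) (h10 : u 1 0 = 0)
    (h11 : u 1 1 = 0) (h22 : u 2 2 = 0) (G : 𝓢((Fin 3 → Fin 3 → 𝕂), ℂ)) :
    f (straighten ℓ κ hk.neg (derivAlong (cornerField u) G)) = 0 := by
  choose Ψ hΨ using fun s : ℝ ↦ exists_comp_cornerField (s • u) (by simp [h22]) G
  have h1 := map_derivAlong (f ∘L straighten ℓ κ hk.neg) G (cornerField u) Ψ
    (Filter.Eventually.of_forall fun s x ↦ by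
      rw [hΨ]
      congr 2
      ext i j
      simp) (derivAlong (cornerField u) G) (fun x ↦ G.hasDerivAt_fderiv x _)
  refine h1.unique ((hasDerivAt_const (0 : ℝ) ((f ∘L straighten ℓ κ hk.neg) G)).congr_of_eventuallyEq
    (Filter.Eventually.of_forall fun s ↦ ?_))
  exact hf.straighten_corner hκ hk hκk (s • u) (by simp [h00]) (by simp [h01]) (by simp [h10])
    (by simp [h11]) (by simp [h22]) G (Ψ s) (hΨ s)

theorem fderiv_mul_of_const (c : (Fin 3 → Fin 3 → 𝕂) → ℂ) (G G' : 𝓢((Fin 3 → Fin 3 → 𝕂), ℂ))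
    (hG : ∀ x, G' x = c x * G x) (x v : Fin 3 → Fin 3 → 𝕂) (hc : ∀ s : ℝ, c (x + s • v) = c x) :
    fderiv ℝ G' x v = c x * fderiv ℝ G x v := by
  refine (G'.hasDerivAt_fderiv x v).unique ?_
  simp only [hG, hc]
  exact (G.hasDerivAt_fderiv x v).const_mul (c x)

theorem IsEquivariantSkew.straighten_trans {ℓ : 𝕂 →L[ℝ] ℝ}
    {f : 𝓢((Fin 3 → Fin 3 → 𝕂), ℂ) →L[ℂ] ℂ} (hf : IsEquivariantSkew ℓ f) {κ : 𝕂 → ℂ} {k : 𝕂 → 𝕂}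
    (hκ : κ.HasTemperateGrowth) (hk : k.HasTemperateGrowth) (hκk : ∀ t, κ t ≠ 0 → k t * t = 1)
    (u : Fin 3 → Fin 3 → 𝕂) (h00 : u 0 0 = 0) (h01 : u 0 1 = 0) (h10 : u 1 0 = 0)
    (h11 : u 1 1 = 0) (h22 : u 2 2 = 0) (G D : 𝓢((Fin 3 → Fin 3 → 𝕂), ℂ))
    (hD : ∀ x, HasDerivAt (fun s : ℝ ↦ G (x + s • u)) (D x) 0) :
    f (straighten ℓ κ hk.neg D) = 0 := by
  have h2 : (fun x : Fin 3 → Fin 3 → 𝕂 ↦ k (x 2 2)).HasTemperateGrowth :=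
    hk.comp (entryCLM 2 2 : (Fin 3 → Fin 3 → 𝕂) →L[ℝ] 𝕂).hasTemperateGrowth
  let a : (Fin 3 → Fin 3 → 𝕂) → ℂ := fun x ↦ (RCLike.re (k (x 2 2)) : ℂ)
  let b : (Fin 3 → Fin 3 → 𝕂) → ℂ := fun x ↦ (RCLike.im (k (x 2 2)) : ℂ)
  have ha : a.HasTemperateGrowth := Function.HasTemperateGrowth.comp
    Function.Complex.hasTemperateGrowth_ofReal ((RCLike.reCLM : 𝕂 →L[ℝ] ℝ).hasTemperateGrowth.comp h2)
  have hb : b.HasTemperateGrowth := Function.HasTemperateGrowth.comp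
    Function.Complex.hasTemperateGrowth_ofReal ((RCLike.imCLM : 𝕂 →L[ℝ] ℝ).hasTemperateGrowth.comp h2)
  let u' : Fin 3 → Fin 3 → 𝕂 := fun i j ↦ RCLike.I * u i j
  let D₁ := derivAlong (cornerField u) (smulLeftCLM ℂ a G)
  let D₂ := derivAlong (cornerField u') (smulLeftCLM ℂ b G)
  have e₁ : f (straighten ℓ κ hk.neg D₁) = 0 :=
    hf.straighten_cornerField hκ hk hκk u h00 h01 h10 h11 h22 _
  have e₂ : f (straighten ℓ κ hk.neg D₂) = 0 :=
    hf.straighten_cornerField hκ hk hκk u' (by simp [u', h00]) (by simp [u', h01]) (by simp [u', h10])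
      (by simp [u', h11]) (by simp [u', h22]) _
  have key : straighten ℓ κ hk.neg D = straighten ℓ κ hk.neg D₁ + straighten ℓ κ hk.neg D₂ := by
    ext x
    rw [← map_add, straighten_apply ℓ hκ, straighten_apply ℓ hκ]
    by_cases h0 : κ (x 2 2) = 0
    · simp [phase, h0]
    congr 1
    have hkx := hκk _ h0
    set y := shear (-k) x with hy
    have hy2 : y 2 2 = x 2 2 := by rw [hy, shear_apply_two]
    rw [_root_.add_apply, derivAlong_apply, derivAlong_apply,
      fderiv_mul_of_const a G _ (fun x ↦ smulLeftCLM_apply_apply ha _ _) y _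
        (fun s ↦ by simp [a, h22]),
      fderiv_mul_of_const b G _ (fun x ↦ smulLeftCLM_apply_apply hb _ _) y _
        (fun s ↦ by simp [b, u', h22]), (hD y).unique (G.hasDerivAt_fderiv y u)]
    simp only [a, b, ← Complex.real_smul, ← map_smul, ← map_add]
    congr 1
    ext i j
    simp only [Pi.add_apply, Pi.smul_apply, cornerField_apply, RCLike.real_smul_eq_coe_mul, hy2, u']
    have h3 := RCLike.re_add_im (k (x 2 2))
    linear_combination -(u i j * x 2 2) * h3 - u i j * hkx
  rw [key, map_add, e₁, e₂, add_zero]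

theorem IsEquivariantSkew.isSkewInvariant {ℓ : 𝕂 →L[ℝ] ℝ}
    {f : 𝓢((Fin 3 → Fin 3 → 𝕂), ℂ) →L[ℂ] ℂ} (hf : IsEquivariantSkew ℓ f) {κ : 𝕂 → ℂ} {k : 𝕂 → 𝕂}
    (hκ : κ.HasTemperateGrowth) (hk : k.HasTemperateGrowth) (hκk : ∀ t, κ t ≠ 0 → k t * t = 1) :
    IsSkewInvariant (f ∘L straighten ℓ κ hk.neg) where
  trans := hf.straighten_trans hκ hk hκk
  torus := hf.straighten_torus hκ hk.neg
  skew := hf.straighten_skew hκ hk.neg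

/-- An equivariant skew distribution vanishes where the corner entry does not. -/
theorem IsEquivariantSkew.map_eq_zero_of_corner_ne_zero {ℓ : 𝕂 →L[ℝ] ℝ}
    {f : 𝓢((Fin 3 → Fin 3 → 𝕂), ℂ) →L[ℂ] ℂ} (hf : IsEquivariantSkew ℓ f)
    (φ : 𝓢((Fin 3 → Fin 3 → 𝕂), ℂ)) (hφ : HasCompactSupport φ)
    (hs : tsupport φ ⊆ {x | x 2 2 ≠ 0}) : f φ = 0 := by
  have hK : IsCompact ((fun x : Fin 3 → Fin 3 → 𝕂 ↦ x 2 2) '' tsupport φ) :=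
    hφ.isCompact.image (by fun_prop)
  obtain ⟨χ, hχ, hχc, hχs, hχ1⟩ := exists_cutoff hK (isOpen_ne (x := (0 : 𝕂))) (by
    rintro _ ⟨x, hx, rfl⟩
    exact hs hx)
  obtain ⟨χ', hχ', hχc', hχs', hχ1'⟩ := exists_cutoff hχc.isCompact (isOpen_ne (x := (0 : 𝕂))) hχs
  let κ : 𝕂 → ℂ := fun t ↦ (χ t : ℂ)
  let k : 𝕂 → 𝕂 := fun t ↦ χ' t • t⁻¹
  have hκ : κ.HasTemperateGrowth := Function.HasTemperateGrowth.comp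
    Function.Complex.hasTemperateGrowth_ofReal (hχc.hasTemperateGrowth hχ)
  have hk : k.HasTemperateGrowth := by
    have hc : HasCompactSupport k := hχc'.smul_right
    refine hc.hasTemperateGrowth (contDiff_iff_contDiffAt.2 fun t ↦ ?_)
    by_cases ht : t ∈ tsupport χ'
    · exact hχ'.contDiffAt.smul (contDiffAt_id.inv (hχs' ht))
    · refine contDiffAt_const (c := (0 : 𝕂)) |>.congr_of_eventuallyEq ?_
      filter_upwards [notMem_tsupport_iff_eventuallyEq.1 ht] with s hs
      simp [k, hs]
  have hκk : ∀ t, κ t ≠ 0 → k t * t = 1 := by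
    intro t ht
    have hts : t ∈ tsupport χ := subset_tsupport _ fun h ↦ ht (by simp [κ, h])
    have : χ' t = 1 := (hχ1' t hts).self_of_nhds
    simp [k, this, inv_mul_cancel₀ (hχs hts)]
  have h1 : (fun _ : 𝕂 ↦ (1 : ℂ)).HasTemperateGrowth := Function.HasTemperateGrowth.const 1
  let G := smulLeftCLM ℂ (phase ℓ (fun _ ↦ 1) k) (compShear hk φ)
  have hG : ∀ x, G x = phase ℓ (fun _ ↦ 1) k x * φ (shear k x) := fun x ↦ by
    rw [smulLeftCLM_apply_apply (hasTemperateGrowth_phase ℓ h1 hk), compShear_apply, smul_eq_mul]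
  have hGc : HasCompactSupport G := by
    refine HasCompactSupport.intro
      (hφ.isCompact.image (hasTemperateGrowth_shear hk.neg).1.continuous) fun x hx ↦ ?_
    rw [hG, image_eq_zero_of_notMem_tsupport (f := φ), mul_zero]
    exact fun h ↦ hx ⟨_, h, shear_neg_shear k x⟩
  have h0 := (hf.isSkewInvariant hκ hk hκk).map_eq_zero G hGc
  have e : straighten ℓ κ hk.neg G = φ := by
    ext x
    rw [straighten_apply ℓ hκ, hG]
    have e2 : shear k (shear (-k) x) = x := by simpa using shear_neg_shear (-k) x
    rw [e2]
    by_cases hx : φ x = 0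
    · simp [hx]
    have hκx : κ (x 2 2) = 1 := by
      have : χ (x 2 2) = 1 := (hχ1 _ ⟨x, subset_tsupport _ hx, rfl⟩).self_of_nhds
      simp [κ, this]
    rw [phase, phase, shear_apply_two, shear_apply_two, shear_two_apply, hκx, one_mul, one_mul,
      ← mul_assoc, ← Complex.exp_add]
    simp
  rwa [ContinuousLinearMap.comp_apply, e] at h0

end Straighten

section Dilation

variable {V W : Type*} [NormedAddCommGroup V] [NormedSpace ℝ V] [NormedAddCommGroup W]
  [NormedSpace ℝ W]

theorem SchwartzMap.exists_seminorm_mul_dilation_le (h : 𝓢(W, ℂ)) (L : V →L[ℝ] W) (φ : 𝓢(V, ℂ))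
    (k n : ℕ) : ∃ M, 0 ≤ M ∧ ∀ ε : ℝ, 0 < ε → ε ≤ 1 → ∀ Φ : 𝓢(V, ℂ),
      (∀ x, Φ x = h (ε⁻¹ • L x) * φ x) → ε ^ n * SchwartzMap.seminorm ℂ k n Φ ≤ M := by
  set M := ∑ i ∈ Finset.range (n + 1), (n.choose i : ℝ) *
    (SchwartzMap.seminorm ℝ 0 i h * ‖L‖ ^ i) * SchwartzMap.seminorm ℝ k (n - i) φ with hM
  refine ⟨M, by positivity, fun ε hε hε1 Φ hΦ ↦ ?_⟩
  rw [mul_comm, ← le_div_iff₀ (by positivity)]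
  refine seminorm_le_bound _ _ _ _ (by positivity) fun x ↦ ?_
  have e : (Φ : V → ℂ) = fun x ↦ (h ∘ (ε⁻¹ • L)) x * φ x := funext fun x ↦ by simp [hΦ]
  have h1 := norm_iteratedFDeriv_mul_le (𝕜 := ℝ) (N := ∞)
    ((h.smooth ⊤).comp (ε⁻¹ • L).contDiff) (φ.smooth ⊤) x (n := n) (by exact_mod_cast le_top)
  rw [e]
  calc ‖x‖ ^ k * ‖iteratedFDeriv ℝ n (fun x ↦ (h ∘ (ε⁻¹ • L)) x * φ x) x‖
      ≤ ‖x‖ ^ k * ∑ i ∈ Finset.range (n + 1), (n.choose i : ℝ) *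
        ‖iteratedFDeriv ℝ i (h ∘ (ε⁻¹ • L)) x‖ * ‖iteratedFDeriv ℝ (n - i) φ x‖ := by gcongr
    _ ≤ M / ε ^ n := by
      rw [hM, Finset.mul_sum, Finset.sum_div]
      refine Finset.sum_le_sum fun i hi ↦ ?_
      have hin : i ≤ n := by simpa [Nat.lt_succ_iff] using hi
      have h2 : ‖iteratedFDeriv ℝ i (h ∘ (ε⁻¹ • L)) x‖ ≤
          SchwartzMap.seminorm ℝ 0 i h * ‖L‖ ^ i / ε ^ n := by
        rw [(ε⁻¹ • L).iteratedFDeriv_comp_right (h.smooth ⊤) x (i := i) (by exact_mod_cast le_top)]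
        refine (ContinuousMultilinearMap.norm_compContinuousLinearMap_le _ _).trans ?_
        rw [Finset.prod_const, Finset.card_univ, Fintype.card_fin, norm_smul, mul_pow,
          Real.norm_of_nonneg (inv_nonneg.2 hε.le), mul_div_assoc, div_eq_inv_mul]
        gcongr
        · simpa using SchwartzMap.le_seminorm ℝ 0 i h ((ε⁻¹ • L) x)
        · rw [inv_pow]
          exact inv_anti₀ (by positivity) (pow_le_pow_of_le_one hε.le hε1 hin)
      calc ‖x‖ ^ k * ((n.choose i : ℝ) * ‖iteratedFDeriv ℝ i (h ∘ (ε⁻¹ • L)) x‖ *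
            ‖iteratedFDeriv ℝ (n - i) φ x‖)
          = (n.choose i : ℝ) * ‖iteratedFDeriv ℝ i (h ∘ (ε⁻¹ • L)) x‖ *
            (‖x‖ ^ k * ‖iteratedFDeriv ℝ (n - i) φ x‖) := by ring
        _ ≤ (n.choose i : ℝ) * (SchwartzMap.seminorm ℝ 0 i h * ‖L‖ ^ i / ε ^ n) *
            SchwartzMap.seminorm ℝ k (n - i) φ := by
          gcongr
          exact SchwartzMap.le_seminorm ℝ k (n - i) φ x
        _ = _ := by ring

end Dilation

section Twist

variable {𝕂 : Type*} [RCLike 𝕂] {V : Type*} [NormedAddCommGroup V] [NormedSpace ℝ V]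

theorem hasTemperateGrowth_re_clm (L : V →L[ℝ] 𝕂) :
    (fun x ↦ ((RCLike.re (L x) : ℝ) : ℂ)).HasTemperateGrowth :=
  Function.HasTemperateGrowth.comp Function.Complex.hasTemperateGrowth_ofReal
    ((RCLike.reCLM : 𝕂 →L[ℝ] ℝ) ∘L L).hasTemperateGrowth

theorem hasTemperateGrowth_im_clm (L : V →L[ℝ] 𝕂) :
    (fun x ↦ ((RCLike.im (L x) : ℝ) : ℂ)).HasTemperateGrowth :=
  Function.HasTemperateGrowth.comp Function.Complex.hasTemperateGrowth_ofReal
    ((RCLike.imCLM : 𝕂 →L[ℝ] ℝ) ∘L L).hasTemperateGrowth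

/-- The derivative of `φ` along `B` and `B'` with weights the real and imaginary part of `L`. -/
noncomputable def SchwartzMap.twist (B B' : V →L[ℝ] V) (L : V →L[ℝ] 𝕂) (φ : 𝓢(V, ℂ)) : 𝓢(V, ℂ) :=
  derivAlong B (smulLeftCLM ℂ (fun x ↦ ((RCLike.re (L x) : ℝ) : ℂ)) φ) +
    derivAlong B' (smulLeftCLM ℂ (fun x ↦ ((RCLike.im (L x) : ℝ) : ℂ)) φ)

theorem SchwartzMap.fderiv_clm_mul (R : V →L[ℝ] ℝ) (φ φ' : 𝓢(V, ℂ))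
    (h : ∀ x, φ' x = (R x : ℂ) * φ x) (x v : V) :
    fderiv ℝ φ' x v = R v * φ x + fderiv ℝ φ x (R x • v) := by
  have e : (φ' : V → ℂ) = ⇑R • ⇑φ := funext fun x ↦ by simp [h, Complex.real_smul]
  have h1 := (R.hasFDerivAt (x := x)).smul (φ.differentiableAt (x := x)).hasFDerivAt
  rw [e, h1.fderiv]
  simp [add_comm]

theorem SchwartzMap.twist_apply (B B' : V →L[ℝ] V) (L : V →L[ℝ] 𝕂) (φ : 𝓢(V, ℂ)) (x : V) :
    twist B B' L φ x = ((RCLike.re (L (B x)) : ℝ) + (RCLike.im (L (B' x)) : ℝ) : ℂ) * φ x +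
      fderiv ℝ φ x (RCLike.re (L x) • B x + RCLike.im (L x) • B' x) := by
  rw [twist, _root_.add_apply, derivAlong_apply, derivAlong_apply,
    fderiv_clm_mul ((RCLike.reCLM : 𝕂 →L[ℝ] ℝ) ∘L L) φ _ (fun x ↦
      smulLeftCLM_apply_apply (hasTemperateGrowth_re_clm L) _ _),
    fderiv_clm_mul ((RCLike.imCLM : 𝕂 →L[ℝ] ℝ) ∘L L) φ _ (fun x ↦
      smulLeftCLM_apply_apply (hasTemperateGrowth_im_clm L) _ _), map_add]
  simp
  ring

theorem SchwartzMap.map_twist (f : 𝓢(V, ℂ) →L[ℂ] ℂ) (B B' : V →L[ℝ] V) (c c' : ℂ)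
    (hB : ∀ φ, f (derivAlong B φ) = c * f φ) (hB' : ∀ φ, f (derivAlong B' φ) = c' * f φ)
    (L : V →L[ℝ] 𝕂) (φ G : 𝓢(V, ℂ))
    (hG : ∀ x, G x = (c * (RCLike.re (L x) : ℝ) + c' * (RCLike.im (L x) : ℝ)) * φ x) :
    f (twist B B' L φ) = f G := by
  have e : G = c • smulLeftCLM ℂ (fun x ↦ ((RCLike.re (L x) : ℝ) : ℂ)) φ +
      c' • smulLeftCLM ℂ (fun x ↦ ((RCLike.im (L x) : ℝ) : ℂ)) φ := by
    ext x
    rw [_root_.add_apply, _root_.smul_apply, _root_.smul_apply, smulLeftCLM_apply_apply (hasTemperateGrowth_re_clm L),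
      smulLeftCLM_apply_apply (hasTemperateGrowth_im_clm L), hG]
    simp only [smul_eq_mul]
    ring
  rw [twist, map_add, hB, hB', e, map_add f, map_smul f, map_smul f, smul_eq_mul, smul_eq_mul]

end Twist

section CornerZero

variable {𝕂 : Type*} [RCLike 𝕂]

theorem IsEquivariantSkew.map_derivAlong_rowField {ℓ : 𝕂 →L[ℝ] ℝ}
    {f : 𝓢((Fin 3 → Fin 3 → 𝕂), ℂ) →L[ℂ] ℂ} (hf : IsEquivariantSkew ℓ f) (p : Fin 3 → 𝕂)
    (hp : p 2 = 0) (φ : 𝓢((Fin 3 → Fin 3 → 𝕂), ℂ)) :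
    f (derivAlong (rowField p) φ) = -(ℓ (p 0) : ℂ) * Complex.I * f φ := by
  choose Ψ hΨ using fun s : ℝ ↦ exists_comp_rowField (s • p) (by simp [hp]) φ
  have h1 := map_derivAlong f φ (rowField p) Ψ (Filter.Eventually.of_forall fun s x ↦ by
    rw [hΨ]
    congr 2
    ext i j
    simp) (derivAlong (rowField p) φ) (fun x ↦ φ.hasDerivAt_fderiv x _)
  have h2 : (fun s ↦ f (Ψ s)) =
      fun s : ℝ ↦ Complex.exp (s * (-(ℓ (p 0) : ℂ) * Complex.I)) * f φ := funext fun s ↦ by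
    rw [hf.left (s • p) (by simp [hp]) φ _ (hΨ s)]
    congr 2
    simp
    ring
  rw [h2] at h1
  refine h1.unique ?_
  have h3 := ((hasDerivAt_id (0 : ℝ)).ofReal_comp.mul_const
    (-(ℓ (p 0) : ℂ) * Complex.I)).cexp.mul_const (f φ)
  simpa using h3

theorem IsEquivariantSkew.map_derivAlong_colField {ℓ : 𝕂 →L[ℝ] ℝ}
    {f : 𝓢((Fin 3 → Fin 3 → 𝕂), ℂ) →L[ℂ] ℂ} (hf : IsEquivariantSkew ℓ f) (p : Fin 3 → 𝕂)
    (hp : p 2 = 0) (φ : 𝓢((Fin 3 → Fin 3 → 𝕂), ℂ)) :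
    f (derivAlong (colField p) φ) = -(ℓ (p 0) : ℂ) * Complex.I * f φ := by
  choose Ψ hΨ using fun s : ℝ ↦ exists_comp_colField (s • p) (by simp [hp]) φ
  have h1 := map_derivAlong f φ (colField p) Ψ (Filter.Eventually.of_forall fun s x ↦ by
    rw [hΨ]
    congr 2
    ext i j
    simp) (derivAlong (colField p) φ) (fun x ↦ φ.hasDerivAt_fderiv x _)
  have h2 : (fun s ↦ f (Ψ s)) =
      fun s : ℝ ↦ Complex.exp (s * (-(ℓ (p 0) : ℂ) * Complex.I)) * f φ := funext fun s ↦ by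
    rw [hf.right (s • p) (by simp [hp]) φ _ (hΨ s)]
    congr 2
    simp
    ring
  rw [h2] at h1
  refine h1.unique ?_
  have h3 := ((hasDerivAt_id (0 : ℝ)).ofReal_comp.mul_const
    (-(ℓ (p 0) : ℂ) * Complex.I)).cexp.mul_const (f φ)
  simpa using h3

/-- The vector field `c · (x₁₃ ∂₁₃ + x₂₃ ∂₂₃ - x₃₁ ∂₃₁ - x₃₂ ∂₃₂)`. -/
noncomputable def weightField (c : 𝕂) : (Fin 3 → Fin 3 → 𝕂) →L[ℝ] (Fin 3 → Fin 3 → 𝕂) :=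
  ContinuousLinearMap.pi fun i ↦ ContinuousLinearMap.pi fun j ↦
    ContinuousLinearMap.mul ℝ 𝕂
      (c * (![![0, 0, 1], ![0, 0, 1], ![-1, -1, 0]] : Fin 3 → Fin 3 → 𝕂) i j) ∘L entryCLM i j

theorem weightField_apply (c : 𝕂) (x : Fin 3 → Fin 3 → 𝕂) (i j : Fin 3) :
    weightField c x i j =
      c * (![![0, 0, 1], ![0, 0, 1], ![-1, -1, 0]] : Fin 3 → Fin 3 → 𝕂) i j * x i j := rfl

/-- The key identity relating the corner entry to the antisymmetric coordinate. -/
theorem IsEquivariantSkew.map_mul_antisymm {ℓ : 𝕂 →L[ℝ] ℝ}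
    {f : 𝓢((Fin 3 → Fin 3 → 𝕂), ℂ) →L[ℂ] ℂ} (hf : IsEquivariantSkew ℓ f) (e : 𝕂)
    (φ G D : 𝓢((Fin 3 → Fin 3 → 𝕂), ℂ)) (hG : ∀ x, G x = (ℓ (e * (x 0 2 - x 2 0)) : ℂ) * φ x)
    (hD : ∀ x, D x = (RCLike.re (x 2 2) : ℝ) * fderiv ℝ φ x (weightField e x) +
      (RCLike.im (x 2 2) : ℝ) * fderiv ℝ φ x (weightField (e * RCLike.I) x)) :
    f D = -Complex.I * f G := by
  let p : 𝕂 → Fin 3 → 𝕂 := fun t ↦ ![t, 0, 0]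
  let q : 𝕂 → Fin 3 → 𝕂 := fun t ↦ ![0, t, 0]
  let L : 𝕂 → Fin 3 → Fin 3 → (Fin 3 → Fin 3 → 𝕂) →L[ℝ] 𝕂 := fun c i j ↦
    ContinuousLinearMap.mul ℝ 𝕂 c ∘L entryCLM i j
  have hL : ∀ c i j x, L c i j x = c * x i j := fun c i j x ↦ rfl
  let T₁ := twist (rowField (p 1)) (rowField (p RCLike.I)) (L e 0 2) φ
  let T₂ := twist (colField (p 1)) (colField (p RCLike.I)) (L (-e) 2 0) φ
  let T₃ := twist (colField (q 1)) (colField (q RCLike.I)) (L (-e) 2 1) φ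
  let T₄ := twist (rowField (q 1)) (rowField (q RCLike.I)) (L e 1 2) φ
  have hℓ : ∀ t : 𝕂, (ℓ t : ℂ) = (RCLike.re t : ℝ) * ℓ 1 + (RCLike.im t : ℝ) * ℓ RCLike.I := by
    intro t
    have : t = (RCLike.re t : ℝ) • (1 : 𝕂) + (RCLike.im t : ℝ) • (RCLike.I : 𝕂) := by
      simp [RCLike.real_smul_eq_coe_mul]
    conv_lhs => rw [this]
    rw [map_add, map_smul, map_smul]
    simp
  have hR : ∀ c i j, (fun x ↦ (ℓ (L c i j x) : ℂ)).HasTemperateGrowth := fun c i j ↦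
    Function.HasTemperateGrowth.comp Function.Complex.hasTemperateGrowth_ofReal
      (ℓ ∘L L c i j).hasTemperateGrowth
  let R : 𝕂 → Fin 3 → Fin 3 → 𝓢((Fin 3 → Fin 3 → 𝕂), ℂ) := fun c i j ↦
    smulLeftCLM ℂ (fun x ↦ (ℓ (L c i j x) : ℂ)) φ
  have hRx : ∀ c i j x, R c i j x = ℓ (L c i j x) * φ x := fun c i j x ↦
    smulLeftCLM_apply_apply (hR c i j) _ _
  have h₁ : f T₁ = f (-Complex.I • R e 0 2) := by
    refine map_twist f _ _ _ _ (hf.map_derivAlong_rowField _ rfl)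
      (hf.map_derivAlong_rowField _ rfl) _ φ _ fun x ↦ ?_
    rw [_root_.smul_apply, hRx, hℓ (L e 0 2 x), smul_eq_mul]
    simp only [p, Matrix.cons_val_zero]
    ring
  have h₂ : f T₂ = f (-Complex.I • R (-e) 2 0) := by
    refine map_twist f _ _ _ _ (hf.map_derivAlong_colField _ rfl)
      (hf.map_derivAlong_colField _ rfl) _ φ _ fun x ↦ ?_
    rw [_root_.smul_apply, hRx, hℓ (L (-e) 2 0 x), smul_eq_mul]
    simp only [p, Matrix.cons_val_zero]
    ring
  have h₃ : f T₃ = f 0 :=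
    map_twist f _ _ _ _ (hf.map_derivAlong_colField _ rfl)
      (hf.map_derivAlong_colField _ rfl) _ φ _ fun x ↦ by simp [q]
  have h₄ : f T₄ = f 0 :=
    map_twist f _ _ _ _ (hf.map_derivAlong_rowField _ rfl)
      (hf.map_derivAlong_rowField _ rfl) _ φ _ fun x ↦ by simp [q]
  have hG' : G = R e 0 2 + R (-e) 2 0 := by
    ext x
    rw [_root_.add_apply, hRx, hRx, hL, hL, hG, mul_sub, map_sub, neg_mul, map_neg]
    push_cast
    ring
  have hD' : D = T₁ + T₂ + T₃ + T₄ := by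
    ext x
    simp only [T₁, T₂, T₃, T₄, _root_.add_apply, twist_apply]
    have hsum : ∀ (a b c d z : ℂ) (v₁ v₂ v₃ v₄ w : Fin 3 → Fin 3 → 𝕂), a + b + c + d = 0 →
        w = v₁ + v₂ + v₃ + v₄ → fderiv ℝ φ x w = a * z + fderiv ℝ φ x v₁ +
          (b * z + fderiv ℝ φ x v₂) + (c * z + fderiv ℝ φ x v₃) + (d * z + fderiv ℝ φ x v₄) := by
      rintro a b c d z v₁ v₂ v₃ v₄ _ h rfl
      simp only [map_add]
      linear_combination -z * h
    rw [hD, ← Complex.real_smul, ← Complex.real_smul, ← map_smul (fderiv ℝ φ x),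
      ← map_smul (fderiv ℝ φ x), ← map_add]
    refine hsum _ _ _ _ _ _ _ _ _ _ ?_ ?_
    · simp [hL, p, q]
      ring
    · have hc : ∀ a u z : 𝕂, (RCLike.re a : 𝕂) * (u * z) + (RCLike.im a : 𝕂) * (RCLike.I * u * z) =
          a * u * z := fun a u z ↦ by linear_combination u * z * RCLike.re_add_im a
      have hp : ∀ i, p RCLike.I i = RCLike.I * p 1 i := fun i ↦ by fin_cases i <;> simp [p]
      have hq : ∀ i, q RCLike.I i = RCLike.I * q 1 i := fun i ↦ by fin_cases i <;> simp [q]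
      ext i j
      simp only [Pi.add_apply, Pi.smul_apply, RCLike.real_smul_eq_coe_mul, weightField_apply,
        rowField_apply, colField_apply, hL, hp, hq, mul_comm e RCLike.I, mul_assoc RCLike.I e, hc]
      fin_cases i <;> fin_cases j <;> simp [p, q] <;> ring
  rw [hD', map_add, map_add, map_add, h₁, h₂, h₃, h₄, hG', map_zero, map_smul, map_smul, map_add]
  simp only [smul_eq_mul]
  ring

end CornerZero

section CornerMoments

variable {𝕂 : Type*} [RCLike 𝕂]

/-- A monomial in the real and imaginary parts of the corner entry. -/
noncomputable def cornerMonomial (a b : ℕ) (x : Fin 3 → Fin 3 → 𝕂) : ℂ :=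
  ((RCLike.re (x 2 2) : ℝ) : ℂ) ^ a * ((RCLike.im (x 2 2) : ℝ) : ℂ) ^ b

theorem hasTemperateGrowth_cornerMonomial (a b : ℕ) :
    (cornerMonomial a b : (Fin 3 → Fin 3 → 𝕂) → ℂ).HasTemperateGrowth :=
  ((hasTemperateGrowth_re_clm (entryCLM 2 2 : (Fin 3 → Fin 3 → 𝕂) →L[ℝ] 𝕂)).pow a).mul
    ((hasTemperateGrowth_im_clm (entryCLM 2 2 : (Fin 3 → Fin 3 → 𝕂) →L[ℝ] 𝕂)).pow b)

/-- Multiplication by a monomial in the corner entry. -/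
noncomputable def mulCorner (a b : ℕ) :
    𝓢((Fin 3 → Fin 3 → 𝕂), ℂ) →L[ℂ] 𝓢((Fin 3 → Fin 3 → 𝕂), ℂ) :=
  smulLeftCLM ℂ (cornerMonomial a b)

theorem mulCorner_apply (a b : ℕ) (φ : 𝓢((Fin 3 → Fin 3 → 𝕂), ℂ)) (x : Fin 3 → Fin 3 → 𝕂) :
    mulCorner a b φ x = cornerMonomial a b x * φ x :=
  smulLeftCLM_apply_apply (hasTemperateGrowth_cornerMonomial a b) _ _

theorem fderiv_mulCorner_weightField (a b : ℕ) (c : 𝕂) (φ : 𝓢((Fin 3 → Fin 3 → 𝕂), ℂ))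
    (x : Fin 3 → Fin 3 → 𝕂) :
    fderiv ℝ (mulCorner a b φ) x (weightField c x) =
      cornerMonomial a b x * fderiv ℝ φ x (weightField c x) :=
  fderiv_mul_of_const _ _ _ (mulCorner_apply a b φ) _ _ fun s ↦ by
    simp [cornerMonomial, weightField_apply]

theorem IsEquivariantSkew.map_mul_mulCorner_eq_zero {ℓ : 𝕂 →L[ℝ] ℝ}
    {f : 𝓢((Fin 3 → Fin 3 → 𝕂), ℂ) →L[ℂ] ℂ} (hf : IsEquivariantSkew ℓ f) {U : Set _} (a b : ℕ)
    (h₁ : ∀ φ : 𝓢((Fin 3 → Fin 3 → 𝕂), ℂ), HasCompactSupport φ → tsupport φ ⊆ U →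
      f (mulCorner (a + 1) b φ) = 0)
    (h₂ : ∀ φ : 𝓢((Fin 3 → Fin 3 → 𝕂), ℂ), HasCompactSupport φ → tsupport φ ⊆ U →
      f (mulCorner a (b + 1) φ) = 0)
    (φ : 𝓢((Fin 3 → Fin 3 → 𝕂), ℂ)) (hφ : HasCompactSupport φ) (hs : tsupport φ ⊆ U) (e : 𝕂)
    (G : 𝓢((Fin 3 → Fin 3 → 𝕂), ℂ))
    (hG : ∀ x, G x = (ℓ (e * (x 0 2 - x 2 0)) : ℂ) * (cornerMonomial a b x * φ x)) : f G = 0 := by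
  have hd : ∀ c : 𝕂, HasCompactSupport (derivAlong (weightField c) φ) ∧
      tsupport (derivAlong (weightField c) φ) ⊆ U := fun c ↦
    ⟨hφ.of_isClosed_subset (isClosed_tsupport _) (tsupport_derivAlong_subset _ _),
      (tsupport_derivAlong_subset _ _).trans hs⟩
  have h := hf.map_mul_antisymm e (mulCorner a b φ) G
    (mulCorner (a + 1) b (derivAlong (weightField e) φ) +
      mulCorner a (b + 1) (derivAlong (weightField (e * RCLike.I)) φ))
    (fun x ↦ by rw [hG, mulCorner_apply]) (fun x ↦ by
      rw [fderiv_mulCorner_weightField, fderiv_mulCorner_weightField, _root_.add_apply, mulCorner_apply,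
        mulCorner_apply, derivAlong_apply, derivAlong_apply]
      simp only [cornerMonomial]
      ring)
  rw [map_add, h₁ _ (hd _).1 (hd _).2, h₂ _ (hd _).1 (hd _).2, add_zero] at h
  simpa using h.symm

theorem sq_add_sq_ne_zero_of_clm {ℓ : 𝕂 →L[ℝ] ℝ} (hℓ : ℓ ≠ 0) {y : 𝕂} (hy : y ≠ 0) :
    ℓ y ^ 2 + ℓ (RCLike.I * y) ^ 2 ≠ 0 := by
  intro h
  have h1 : ℓ y = 0 := by nlinarith [sq_nonneg (ℓ y), sq_nonneg (ℓ (RCLike.I * y))]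
  have h2 : ℓ (RCLike.I * y) = 0 := by nlinarith [sq_nonneg (ℓ y), sq_nonneg (ℓ (RCLike.I * y))]
  refine hℓ (ContinuousLinearMap.ext fun t ↦ ?_)
  have e : t = (RCLike.re (t / y) : ℝ) • y + (RCLike.im (t / y) : ℝ) • (RCLike.I * y) := by
    rw [RCLike.real_smul_eq_coe_mul, RCLike.real_smul_eq_coe_mul, ← mul_assoc, ← add_mul,
      RCLike.re_add_im, div_mul_cancel₀ _ hy]
  rw [e, map_add, map_smul, map_smul, h1, h2]
  simp

theorem IsEquivariantSkew.map_mulCorner_eq_zero_of_succ {ℓ : 𝕂 →L[ℝ] ℝ} (hℓ : ℓ ≠ 0)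
    {f : 𝓢((Fin 3 → Fin 3 → 𝕂), ℂ) →L[ℂ] ℂ} (hf : IsEquivariantSkew ℓ f) (a b : ℕ)
    (h₁ : ∀ φ : 𝓢((Fin 3 → Fin 3 → 𝕂), ℂ), HasCompactSupport φ →
      tsupport φ ⊆ {x | x 0 2 ≠ x 2 0} → f (mulCorner (a + 1) b φ) = 0)
    (h₂ : ∀ φ : 𝓢((Fin 3 → Fin 3 → 𝕂), ℂ), HasCompactSupport φ →
      tsupport φ ⊆ {x | x 0 2 ≠ x 2 0} → f (mulCorner a (b + 1) φ) = 0)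
    (φ : 𝓢((Fin 3 → Fin 3 → 𝕂), ℂ)) (hφ : HasCompactSupport φ)
    (hs : tsupport φ ⊆ {x | x 0 2 ≠ x 2 0}) : f (mulCorner a b φ) = 0 := by
  have hU : IsOpen {x : Fin 3 → Fin 3 → 𝕂 | x 0 2 ≠ x 2 0} :=
    isOpen_ne_fun (by fun_prop) (by fun_prop)
  let L : 𝕂 → (Fin 3 → Fin 3 → 𝕂) →L[ℝ] ℝ := fun e ↦
    ℓ ∘L ContinuousLinearMap.mul ℝ 𝕂 e ∘L (entryCLM 0 2 - entryCLM 2 0)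
  have hL : ∀ e x, L e x = ℓ (e * (x 0 2 - x 2 0)) := fun e x ↦ rfl
  have h0 : ∀ x : Fin 3 → Fin 3 → 𝕂, x 0 2 ≠ x 2 0 → L 1 x ^ 2 + L RCLike.I x ^ 2 ≠ 0 := by
    intro x hx
    rw [hL, hL, one_mul]
    exact sq_add_sq_ne_zero_of_clm hℓ (sub_ne_zero.2 hx)
  have hg : ∀ e, ContDiffOn ℝ ∞ (fun x ↦ ((L e x / (L 1 x ^ 2 + L RCLike.I x ^ 2) : ℝ) : ℂ))
      {x : Fin 3 → Fin 3 → 𝕂 | x 0 2 ≠ x 2 0} := fun e ↦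
    Complex.ofRealCLM.contDiff.comp_contDiffOn
      ((L e).contDiff.contDiffOn.div
        (((L 1).contDiff.pow 2).add ((L RCLike.I).contDiff.pow 2)).contDiffOn h0)
  obtain ⟨φ₁, hφ₁, hc₁, hs₁⟩ := φ.exists_mul_of_tsupport_subset hφ hU hs (hg 1)
  obtain ⟨φ₂, hφ₂, hc₂, hs₂⟩ := φ.exists_mul_of_tsupport_subset hφ hU hs (hg RCLike.I)
  have hR : ∀ e, (fun x ↦ (L e x : ℂ)).HasTemperateGrowth := fun e ↦
    Function.HasTemperateGrowth.comp Function.Complex.hasTemperateGrowth_ofReal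
      (L e).hasTemperateGrowth
  have e₁ := hf.map_mul_mulCorner_eq_zero a b h₁ h₂ φ₁ hc₁ (hs₁.trans hs) 1
    (smulLeftCLM ℂ (fun x ↦ (L 1 x : ℂ)) (mulCorner a b φ₁)) (fun x ↦ by
      rw [smulLeftCLM_apply_apply (hR 1), mulCorner_apply, hL, smul_eq_mul])
  have e₂ := hf.map_mul_mulCorner_eq_zero a b h₁ h₂ φ₂ hc₂ (hs₂.trans hs) RCLike.I
    (smulLeftCLM ℂ (fun x ↦ (L RCLike.I x : ℂ)) (mulCorner a b φ₂)) (fun x ↦ by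
      rw [smulLeftCLM_apply_apply (hR RCLike.I), mulCorner_apply, hL, smul_eq_mul])
  have key : mulCorner a b φ = smulLeftCLM ℂ (fun x ↦ (L 1 x : ℂ)) (mulCorner a b φ₁) +
      smulLeftCLM ℂ (fun x ↦ (L RCLike.I x : ℂ)) (mulCorner a b φ₂) := by
    ext x
    rw [_root_.add_apply, smulLeftCLM_apply_apply (hR 1), smulLeftCLM_apply_apply (hR RCLike.I),
      mulCorner_apply, mulCorner_apply, mulCorner_apply, hφ₁, hφ₂]
    by_cases hx : φ x = 0
    · simp [hx]
    have h3 : (L 1 x : ℂ) ^ 2 + (L RCLike.I x : ℂ) ^ 2 ≠ 0 := by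
      exact_mod_cast h0 x (hs (subset_tsupport _ hx))
    simp only [smul_eq_mul]
    push_cast
    field_simp
  rw [key, map_add, e₁, e₂, add_zero]

/-- Cutting off near the vanishing locus of the corner entry does not change the pairing. -/
theorem IsEquivariantSkew.map_eq_of_eventuallyEq {ℓ : 𝕂 →L[ℝ] ℝ}
    {f : 𝓢((Fin 3 → Fin 3 → 𝕂), ℂ) →L[ℂ] ℂ} (hf : IsEquivariantSkew ℓ f)
    (φ φ' : 𝓢((Fin 3 → Fin 3 → 𝕂), ℂ)) (hφ : HasCompactSupport φ) (hφ' : HasCompactSupport φ')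
    (h : ∀ x : Fin 3 → Fin 3 → 𝕂, x 2 2 = 0 → φ =ᶠ[nhds x] φ') : f φ = f φ' := by
  rw [← sub_eq_zero, ← map_sub]
  have e : (φ - φ' : 𝓢((Fin 3 → Fin 3 → 𝕂), ℂ)) = (φ - φ' : (Fin 3 → Fin 3 → 𝕂) → ℂ) := rfl
  refine hf.map_eq_zero_of_corner_ne_zero _ (by rw [e]; exact hφ.sub hφ') fun x hx h0 ↦ ?_
  refine notMem_tsupport_iff_eventuallyEq.2 ?_ hx
  filter_upwards [h x h0] with y hy
  rw [_root_.sub_apply, hy, sub_self, Pi.zero_apply]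

theorem IsEquivariantSkew.exists_map_mulCorner_eq_zero {ℓ : 𝕂 →L[ℝ] ℝ}
    {f : 𝓢((Fin 3 → Fin 3 → 𝕂), ℂ) →L[ℂ] ℂ} (hf : IsEquivariantSkew ℓ f) :
    ∃ N, ∀ a b, a + b = N → ∀ φ : 𝓢((Fin 3 → Fin 3 → 𝕂), ℂ), HasCompactSupport φ →
      f (mulCorner a b φ) = 0 := by
  obtain ⟨s, C, hC, hb⟩ := exists_bound f
  refine ⟨∑ i ∈ s, i.2 + 1, fun a b hab φ hφ ↦ ?_⟩
  obtain ⟨χ, hχ, hχc, -, hχ1⟩ := exists_cutoff (isCompact_singleton (x := (0 : 𝕂))) isOpen_univ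
    (Set.subset_univ _)
  let h : 𝓢(𝕂, ℂ) := HasCompactSupport.toSchwartzMap
    (f := fun t ↦ (χ t : ℂ) * (((RCLike.re t : ℝ) : ℂ) ^ a * ((RCLike.im t : ℝ) : ℂ) ^ b))
    (HasCompactSupport.mul_right (hχc.comp_left Complex.ofReal_zero))
    ((Complex.ofRealCLM.contDiff.comp hχ).mul
      (((Complex.ofRealCLM ∘L RCLike.reCLM : 𝕂 →L[ℝ] ℂ).contDiff.pow a).mul
        ((Complex.ofRealCLM ∘L RCLike.imCLM : 𝕂 →L[ℝ] ℂ).contDiff.pow b)))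
  have hh : ∀ t, h t =
    (χ t : ℂ) * (((RCLike.re t : ℝ) : ℂ) ^ a * ((RCLike.im t : ℝ) : ℂ) ^ b) := fun t ↦ rfl
  let L : (Fin 3 → Fin 3 → 𝕂) →L[ℝ] 𝕂 := entryCLM 2 2
  choose M hM hM' using fun i : ℕ × ℕ ↦ exists_seminorm_mul_dilation_le h L φ i.1 i.2
  have hd : ∀ ε : ℝ, ∃ Φ : 𝓢((Fin 3 → Fin 3 → 𝕂), ℂ), (∀ x, Φ x = h (ε⁻¹ • L x) * φ x) ∧
      HasCompactSupport Φ := fun ε ↦ by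
    obtain ⟨Φ, h1, h2, -⟩ := φ.exists_mul_of_tsupport_subset hφ isOpen_univ (Set.subset_univ _)
      ((h.smooth ⊤).comp (ε⁻¹ • L).contDiff).contDiffOn
    exact ⟨Φ, h1, h2⟩
  have hmc : HasCompactSupport (mulCorner a b φ) := by
    have : (mulCorner a b φ : (Fin 3 → Fin 3 → 𝕂) → ℂ) = fun x ↦ cornerMonomial a b x * φ x :=
      funext (mulCorner_apply a b φ)
    rw [this]
    exact hφ.mul_left
  have key : ∀ ε : ℝ, 0 < ε → ε ≤ 1 → ‖f (mulCorner a b φ)‖ ≤ ε * (C * ∑ i ∈ s, M i) := by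
    intro ε hε hε1
    obtain ⟨Φ, hΦ, hΦc⟩ := hd ε
    have e : f (mulCorner a b φ) = f (((ε : ℂ) ^ (a + b)) • Φ) := by
      refine hf.map_eq_of_eventuallyEq _ _ hmc ?_ fun x hx ↦ ?_
      · exact hΦc.smul_left (f := fun _ ↦ (ε : ℂ) ^ (a + b))
      have ht : Filter.Tendsto (fun y ↦ ε⁻¹ • L y) (nhds x) (nhds 0) := by
        have : ContinuousAt (fun y ↦ ε⁻¹ • L y) x := by fun_prop
        have h0 : ε⁻¹ • L x = 0 := by
          have : L x = x 2 2 := rfl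
          rw [this, hx, smul_zero]
        rwa [ContinuousAt, h0] at this
      filter_upwards [ht.eventually (hχ1 0 rfl)] with y hy
      have hεc : (ε : ℂ) ≠ 0 := by exact_mod_cast hε.ne'
      rw [mulCorner_apply, _root_.smul_apply, hΦ, hh, hy, cornerMonomial, RCLike.smul_re, RCLike.smul_im]
      have : L y = y 2 2 := rfl
      rw [this, smul_eq_mul]
      push_cast
      simp only [mul_pow, inv_pow, pow_add]
      field_simp
    rw [e, map_smul, norm_smul, norm_pow, Complex.norm_real, Real.norm_of_nonneg hε.le, hab,
      pow_succ]
    calc ε ^ (∑ i ∈ s, i.2) * ε * ‖f Φ‖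
        ≤ ε ^ (∑ i ∈ s, i.2) * ε * (C * ∑ i ∈ s, SchwartzMap.seminorm ℂ i.1 i.2 Φ) := by
          gcongr
          exact hb Φ
      _ = ε * (C * ∑ i ∈ s, ε ^ (∑ i ∈ s, i.2) * SchwartzMap.seminorm ℂ i.1 i.2 Φ) := by
          rw [← Finset.mul_sum]
          ring
      _ ≤ ε * (C * ∑ i ∈ s, M i) := by
          gcongr with i hi
          refine le_trans ?_ (hM' i ε hε hε1 Φ hΦ)
          gcongr ?_ * _
          exact pow_le_pow_of_le_one hε.le hε1 (Finset.single_le_sum (f := fun i : ℕ × ℕ ↦ i.2)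
            (fun _ _ ↦ Nat.zero_le _) hi)
  have hlim : Filter.Tendsto (fun ε : ℝ ↦ ε * (C * ∑ i ∈ s, M i)) (nhdsWithin 0 (Set.Ioi 0))
      (nhds 0) := by
    have : ContinuousAt (fun ε : ℝ ↦ ε * (C * ∑ i ∈ s, M i)) 0 := by fun_prop
    rw [ContinuousAt, zero_mul] at this
    exact this.mono_left nhdsWithin_le_nhds
  refine norm_le_zero_iff.1 (ge_of_tendsto hlim ?_)
  filter_upwards [Ioc_mem_nhdsGT (zero_lt_one (α := ℝ))] with ε hε
  exact key ε hε.1 hε.2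

/-- An equivariant skew distribution vanishes where the antisymmetric coordinate does not. -/
theorem IsEquivariantSkew.map_eq_zero_of_antisymm_ne_zero {ℓ : 𝕂 →L[ℝ] ℝ} (hℓ : ℓ ≠ 0)
    {f : 𝓢((Fin 3 → Fin 3 → 𝕂), ℂ) →L[ℂ] ℂ} (hf : IsEquivariantSkew ℓ f)
    (φ : 𝓢((Fin 3 → Fin 3 → 𝕂), ℂ)) (hφ : HasCompactSupport φ)
    (hs : tsupport φ ⊆ {x | x 0 2 ≠ x 2 0}) : f φ = 0 := by
  obtain ⟨N, hN⟩ := hf.exists_map_mulCorner_eq_zero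
  have H : ∀ n ≤ N, ∀ a b, a + b = n → ∀ φ : 𝓢((Fin 3 → Fin 3 → 𝕂), ℂ), HasCompactSupport φ →
      tsupport φ ⊆ {x | x 0 2 ≠ x 2 0} → f (mulCorner a b φ) = 0 := by
    intro n hn
    induction hn using Nat.decreasingInduction with
    | self => exact fun a b hab φ hφ _ ↦ hN a b hab φ hφ
    | of_succ n _ ih =>
      intro a b hab
      exact hf.map_mulCorner_eq_zero_of_succ hℓ a b (ih (a + 1) b (by omega))
        (ih a (b + 1) (by omega))
  have e : mulCorner 0 0 φ = φ := by
    ext x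
    simp [mulCorner_apply, cornerMonomial]
  rw [← e]
  exact H 0 (Nat.zero_le _) 0 0 rfl φ hφ hs

theorem IsEquivariantSkew.map_eq_zero {ℓ : 𝕂 →L[ℝ] ℝ} (hℓ : ℓ ≠ 0)
    {f : 𝓢((Fin 3 → Fin 3 → 𝕂), ℂ) →L[ℂ] ℂ} (hf : IsEquivariantSkew ℓ f)
    (φ : 𝓢((Fin 3 → Fin 3 → 𝕂), ℂ)) (hφ : HasCompactSupport φ)
    (hs : Disjoint (tsupport φ) {x | x 2 2 = 0 ∧ x 0 2 = x 2 0}) : f φ = 0 := by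
  have hK : IsCompact (tsupport φ ∩ {x | x 2 2 = 0}) :=
    hφ.isCompact.inter_right (isClosed_eq (by fun_prop) continuous_const)
  have hU : IsOpen {x : Fin 3 → Fin 3 → 𝕂 | x 0 2 ≠ x 2 0} :=
    isOpen_ne_fun (by fun_prop) (by fun_prop)
  obtain ⟨χ, hχ, -, hχs, hχ1⟩ := exists_cutoff hK hU fun x hx h ↦
    Set.disjoint_left.1 hs hx.1 ⟨hx.2, h⟩
  obtain ⟨φ', h1, h2, -⟩ := φ.exists_mul_of_tsupport_subset hφ isOpen_univ (Set.subset_univ _)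
    (Complex.ofRealCLM.contDiff.comp hχ).contDiffOn
  have e : f φ = f φ' := by
    refine hf.map_eq_of_eventuallyEq _ _ hφ h2 fun x hx ↦ ?_
    by_cases hxs : x ∈ tsupport φ
    · filter_upwards [hχ1 x ⟨hxs, hx⟩] with y hy
      simp [h1, hy]
    · filter_upwards [notMem_tsupport_iff_eventuallyEq.1 hxs] with y hy
      simp [h1, hy]
  rw [e]
  refine hf.map_eq_zero_of_antisymm_ne_zero hℓ φ' h2 (subset_trans (closure_mono ?_) hχs)
  intro x hx h
  exact hx (by simp [h1, h])

end CornerMoments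

end Distributions

/-- Let `f` be a tempered distribution on `gl₃(𝕂)` such that
`f(x ↦ φ(l·g₁·x·g₂^τ·l⁻¹)) = χ_{N₃}(g₁)⁻¹·χ_{N₃}(g₂)⁻¹·f(φ)` for `l = diag(a,1,a)`,
`a ∈ 𝕂ˣ`, `g₁, g₂ ∈ N₃`, and such that `f(x ↦ φ(x^τ)) = −f(φ)`.  Then `f` is
supported in `Z₃,₂ = {x : x₃₃ = 0, x₁₃ = x₃₁}`: it kills every smooth compactly
supported test function whose support is disjoint from `Z₃,₂`. -/
theorem gl3_tempered_distribution_support {𝕂 : Type*} [RCLike 𝕂]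
    (ψ : 𝕂 → ℂ) (hψ_add : ∀ s t, ψ (s + t) = ψ s * ψ t) (hψ_unitary : ∀ t, ‖ψ t‖ = 1)
    (hψ_cont : Continuous ψ) (hψ_nontriv : ∃ t, ψ t ≠ 1)
    (f : SchwartzMap (Matrix (Fin 3) (Fin 3) 𝕂) ℂ →L[ℂ] ℂ)
    (hequiv : ∀ (a : 𝕂ˣ), ∀ g₁ ∈ N3 𝕂, ∀ g₂ ∈ N3 𝕂,
      ∀ φ φ' : SchwartzMap (Matrix (Fin 3) (Fin 3) 𝕂) ℂ,
      (∀ x, φ' x = φ (Matrix.diagonal ![(a : 𝕂), 1, (a : 𝕂)] * g₁ * x * g₂ᵀ *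
          Matrix.diagonal ![((a⁻¹ : 𝕂ˣ) : 𝕂), 1, ((a⁻¹ : 𝕂ˣ) : 𝕂)])) →
      f φ' = (ψ (g₁ 0 2))⁻¹ * (ψ (g₂ 0 2))⁻¹ * f φ)
    (hskew : ∀ φ φ' : SchwartzMap (Matrix (Fin 3) (Fin 3) 𝕂) ℂ,
      (∀ x, φ' x = φ xᵀ) → f φ' = - f φ) :
    ∀ φ : SchwartzMap (Matrix (Fin 3) (Fin 3) 𝕂) ℂ, HasCompactSupport ⇑φ →
      Disjoint (tsupport ⇑φ)
        {x : Matrix (Fin 3) (Fin 3) 𝕂 | x 2 2 = 0 ∧ x 0 2 = x 2 0} →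
      f φ = 0 := by
  obtain ⟨ℓ, hℓ⟩ := exists_continuousLinearMap_of_character ψ hψ_add hψ_unitary hψ_cont
  have hℓ0 : ℓ ≠ 0 := by
    rintro rfl
    obtain ⟨t, ht⟩ := hψ_nontriv
    exact ht (by simp [hℓ])
  have hψ0 : ψ 0 = 1 := by simp [hℓ]
  have hψi : ∀ t, (ψ t)⁻¹ = Complex.exp (-(ℓ t : ℂ) * Complex.I) := fun t ↦ by
    rw [hℓ, ← Complex.exp_neg, neg_mul]
  let f' : SchwartzMap (Fin 3 → Fin 3 → 𝕂) ℂ →L[ℂ] ℂ := f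
  have h1 : (1 : Matrix (Fin 3) (Fin 3) 𝕂) ∈ N3 𝕂 := ⟨0, 0, by
    ext i j
    fin_cases i <;> fin_cases j <;> simp⟩
  have hf : IsEquivariantSkew ℓ f' := by
    refine ⟨fun p hp φ φ' h ↦ ?_, fun p hp φ φ' h ↦ ?_, fun a ha φ φ' h ↦ ?_, hskew⟩
    · have := hequiv 1 !![1, 0, p 0; 0, 1, p 1; 0, 0, 1] ⟨_, _, rfl⟩ 1 h1 φ φ' fun x ↦ by
        refine (h x).trans (congrArg φ ?_)
        ext i j
        change x i j + p i * x 2 j = _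
        fin_cases i <;> fin_cases j <;>
          simp [Matrix.mul_apply, Fin.sum_univ_three, hp, Matrix.diagonal_apply]
      refine this.trans ?_
      change _ = _ * f φ
      simp [hψ0, hψi]
    · have := hequiv 1 1 h1 !![1, 0, p 0; 0, 1, p 1; 0, 0, 1] ⟨_, _, rfl⟩ φ φ' fun x ↦ by
        refine (h x).trans (congrArg φ ?_)
        ext i j
        change x i j + p j * x i 2 = _
        rw [mul_comm]
        fin_cases i <;> fin_cases j <;>
          simp [Matrix.mul_apply, Fin.sum_univ_three, hp, Matrix.diagonal_apply]
      refine this.trans ?_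
      change _ = _ * f φ
      simp [hψ0, hψi]
    · have := hequiv (Units.mk0 a ha) 1 h1 1 h1 φ φ' fun x ↦ by
        refine (h x).trans (congrArg φ ?_)
        ext i j
        fin_cases i <;> fin_cases j <;>
          simp [Matrix.mul_apply, torusConj, Matrix.diagonal_apply]
      refine this.trans ?_
      change _ = f φ
      simp [hψ0]
  exact fun φ hφ hs ↦ hf.map_eq_zero hℓ0 φ hφ hs
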